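/- Let Γ̄ be the tropical hyperelliptic curve of genus g and Γ its bounded part. The restriction of the map φ̄ : 𝔇_g^+(Γ) → J(Γ) to the subset 𝔇̃_g^+(Γ) is a bijection 𝔇̃_g^+(Γ) → J(Γ). -/

import Mathlib

open scoped BigOperators

namespace TropicalHyperelliptic

/-! ## The tropical hyperelliptic curve

For a genus `g ≥ 1` and parameters `c₋₁, c₀, …, c_{g+1}` (encoded as a function
`c : ℤ → ℝ`; only the values `c (-1), …, c (g+1)` matter), the tropical
polynomial `F̃(X,Y) = max(2Y, Y + P̃(X), c₋₁)` with
`P̃(X) = max_{0 ≤ i ≤ g+1} (c_i + iX)` defines the tropical hyperelliptic curve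
`Γ̄` as the locus of points of `ℝ²` where `F̃` fails to be differentiable. -/

/-- The tropical polynomial `P̃(X) = max_{0 ≤ i ≤ g+1} (c_i + i X)`. -/
noncomputable def Ptilde (g : ℕ) (c : ℤ → ℝ) (X : ℝ) : ℝ :=
  (Finset.range (g + 2)).sup' (Finset.nonempty_range_iff.mpr (by omega))
    fun i => c (i : ℤ) + (i : ℝ) * X

/-- The tropical polynomial `F̃(X,Y) = max(2Y, Y + P̃(X), c₋₁)`. -/
noncomputable def Ftilde (g : ℕ) (c : ℤ → ℝ) (P : ℝ × ℝ) : ℝ :=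
  max (2 * P.2) (max (P.2 + Ptilde g c P.1) (c (-1)))

/-- The tropical hyperelliptic curve `Γ̄` of genus `g`: the set of points of
`ℝ²` at which `F̃` is not differentiable. -/
def curveBar (g : ℕ) (c : ℤ → ℝ) : Set (ℝ × ℝ) :=
  {P | ¬ DifferentiableAt ℝ (Ftilde g c) P}

/-- The hypotheses on the parameters: `c_{g+1} = c_g = 0`, `c₋₁ < 2c₀`,
`cᵢ + c_{i+2} < 2c_{i+1}` for `0 ≤ i ≤ g − 2`, and `c_{g−1} < 2c_g = 0`.
Under these assumptions `Γ̄` is a smooth tropical curve of genus `g`. -/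
def Hyp (g : ℕ) (c : ℤ → ℝ) : Prop :=
  c ((g : ℤ) + 1) = 0 ∧ c (g : ℤ) = 0 ∧ c (-1) < 2 * c 0 ∧
  (∀ i : ℕ, (i : ℤ) ≤ (g : ℤ) - 2 → c i + c ((i : ℤ) + 2) < 2 * c ((i : ℤ) + 1)) ∧
  c ((g : ℤ) - 1) < 0

/-- The vertices `V_i` (`0 ≤ i ≤ g`) of `Γ̄` lying above the line
`Y = c₋₁/2`:  `V_0 = (0,0)` and
`V_i = (c_{g−i} − c_{g−i+1}, (g−i+1)c_{g−i} − (g−i)c_{g−i+1})`.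
(The formula below also gives `V_0 = (0,0)` for `i = 0`, since
`c_g = c_{g+1} = 0`.) -/
noncomputable def V (g : ℕ) (c : ℤ → ℝ) (i : ℕ) : ℝ × ℝ :=
  (c ((g : ℤ) - i) - c ((g : ℤ) - i + 1),
   (((g : ℤ) - i + 1 : ℤ) : ℝ) * c ((g : ℤ) - i)
     - (((g : ℤ) - i : ℤ) : ℝ) * c ((g : ℤ) - i + 1))

/-- The conjugate `P′` of a point `P`: the reflection with respect to the line
`Y = c₋₁/2`. -/
def conj (c : ℤ → ℝ) (P : ℝ × ℝ) : ℝ × ℝ := (P.1, c (-1) - P.2)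

/-- The metric graph `Γ` obtained from `Γ̄` by removing all unbounded edges:
the part of `Γ̄` lying in the vertical strip `x(V_g) ≤ X ≤ x(V_0) = 0`,
where `x(V_g) = c_0 − c_1`. -/
def Gam (g : ℕ) (c : ℤ → ℝ) : Set (ℝ × ℝ) :=
  {P ∈ curveBar g c | c 0 - c 1 ≤ P.1 ∧ P.1 ≤ 0}

/-! ## Rational functions, orders, and divisors -/

/-- The image in `ℝ²` of an integer vector. -/
def vr (v : ℤ × ℤ) : ℝ × ℝ := ((v.1 : ℝ), (v.2 : ℝ))

/-- The primitive integer directions along which one can leave the point `P`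
inside the set `S` (the outgoing directions of the segments of `S` emanating
from `P`). -/
def localDirs (S : Set (ℝ × ℝ)) (P : ℝ × ℝ) : Set (ℤ × ℤ) :=
  {v | IsCoprime v.1 v.2 ∧ ∃ ε > (0 : ℝ), ∀ t : ℝ, 0 < t → t < ε → P + t • vr v ∈ S}

/-- `f` has (integer) outgoing slope `s` at `P` in the direction `v` (slopes are
measured with respect to the lattice length). -/
def HasSlope (S : Set (ℝ × ℝ)) (f : ℝ × ℝ → ℝ) (P : ℝ × ℝ) (v : ℤ × ℤ) (s : ℤ) : Prop :=
  ∃ ε > (0 : ℝ), ∀ t : ℝ, 0 ≤ t → t < ε → P + t • vr v ∈ S →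
    f (P + t • vr v) = f P + (s : ℝ) * t

/-- A rational function on (the tropical curve) `S ⊆ ℝ²`: a continuous function
whose restriction to every edge is piecewise linear with integer slopes,
i.e. which has an integer outgoing slope at every point of `S` in every
outgoing direction. -/
structure IsRationalFn (S : Set (ℝ × ℝ)) (f : ℝ × ℝ → ℝ) : Prop where
  cont : ContinuousOn f S
  slope_int : ∀ P ∈ S, ∀ v ∈ localDirs S P, ∃ s : ℤ, HasSlope S f P v s

/-- The outgoing slope of `f` at `P` in the direction `v` (defaulting to `0`
when no integer slope exists). -/
noncomputable def slope (S : Set (ℝ × ℝ)) (f : ℝ × ℝ → ℝ) (P : ℝ × ℝ) (v : ℤ × ℤ) : ℤ :=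
  open scoped Classical in
  if h : ∃ s : ℤ, HasSlope S f P v s then h.choose else 0

/-- The order `ord_P f`: the sum of the outgoing slopes of `f` over all segments
of `S` emanating from `P`.  Points with `ord_P f > 0` are the zeros of `f`,
points with `ord_P f < 0` its poles. -/
noncomputable def ord (S : Set (ℝ × ℝ)) (f : ℝ × ℝ → ℝ) (P : ℝ × ℝ) : ℤ :=
  ∑ᶠ v ∈ localDirs S P, slope S f P v

/-- Divisors: formal `ℤ`-linear combinations of finitely many points of `ℝ²`. -/
abbrev Div := (ℝ × ℝ) →₀ ℤ

/-- The degree of a divisor: the sum of its coefficients. -/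
def deg (D : Div) : ℤ := D.sum fun _ n => n

/-- A divisor is effective (`D > 0`) when all its coefficients are nonnegative. -/
def Eff (D : Div) : Prop := ∀ P, 0 ≤ D P

/-- `R(D)`: the set of rational functions `f` on `S` with `(f) + D` effective. -/
def RSet (S : Set (ℝ × ℝ)) (D : Div) : Set ((ℝ × ℝ) → ℝ) :=
  {f | IsRationalFn S f ∧ ∀ P ∈ S, 0 ≤ ord S f P + D P}

/-- A divisor is principal when it is the divisor `(f) = Σ_P (ord_P f)·P` of a
rational function `f` on `S`. -/
def IsPrincipal (S : Set (ℝ × ℝ)) (D : Div) : Prop :=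
  ∃ f : (ℝ × ℝ) → ℝ, IsRationalFn S f ∧ ∀ P, D P = ord S f P

/-- Two divisors are (linearly) equivalent, `D ∼ D′`, when `D′ = D + (f)` for
some rational function `f` on `S`. -/
def LinEquiv (S : Set (ℝ × ℝ)) (D D' : Div) : Prop :=
  ∃ f : (ℝ × ℝ) → ℝ, IsRationalFn S f ∧ ∀ P, D' P = D P + ord S f P

end TropicalHyperelliptic

/-! ## The cycles `α_i` and the set `𝔇̃_g^+(Γ)` -/

namespace TropicalHyperelliptic

/-- The basis cycle `α_i` (`1 ≤ i ≤ g`) of the fundamental group `π₁(Γ)`: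
the cycle of `Γ` through the vertices `V_{i−1}`, `V_i` and their conjugates
`V_{i−1}′`, `V_i′`, i.e. the part of `Γ` in the vertical strip
`x(V_i) ≤ X ≤ x(V_{i−1})`. -/
def alphaCycle (g : ℕ) (c : ℤ → ℝ) (i : ℕ) : Set (ℝ × ℝ) :=
  {P ∈ Gam g c | (V g c i).1 ≤ P.1 ∧ P.1 ≤ (V g c (i - 1)).1}

/-- The overlap `α_{k,k+1} = (α_k ∩ α_{k+1}) ∖ {endpoints}` (`1 ≤ k ≤ g − 1`):
the open vertical edge of `Γ` joining `V_k` to `V_k′`.  (For non-adjacent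
indices the overlaps `α_i ∩ α_j` are empty.) -/
def alphaOpen (g : ℕ) (c : ℤ → ℝ) (k : ℕ) : Set (ℝ × ℝ) :=
  {P ∈ Gam g c | P.1 = (V g c k).1 ∧ P ≠ V g c k ∧ P ≠ conj c (V g c k)}

/-- The subset `𝔇̃_g^+(Γ)` of `𝔇_g^+(Γ)`: effective divisors
`P_1 + ⋯ + P_g` with `P_i ∈ α_i` for all `i`, such that each overlap `α_{ij}`
contains at most one of the points. -/
def Dtilde (g : ℕ) (c : ℤ → ℝ) : Set Div :=
  {D | ∃ Pt : Fin g → ℝ × ℝ,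
    (∀ i : Fin g, Pt i ∈ alphaCycle g c (i + 1)) ∧
    (∀ k : ℕ, 1 ≤ k → k ≤ g - 1 →
      ∀ i j : Fin g, Pt i ∈ alphaOpen g c k → Pt j ∈ alphaOpen g c k → i = j) ∧
    D = ∑ i : Fin g, Finsupp.single (Pt i) (1 : ℤ)}

/-- For even `g`, the base divisor `D* = (g/2)(V_0 + V_0′)`. -/
noncomputable def DstarEven (g : ℕ) (c : ℤ → ℝ) : Div :=
  ((g / 2 : ℕ) : ℤ) •
    (Finsupp.single (V g c 0) (1 : ℤ) + Finsupp.single (conj c (V g c 0)) (1 : ℤ))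

/-- For odd `g`, the base divisor `D* = ((g−1)/2)(V_0 + V_0′) + V_0`. -/
noncomputable def DstarOdd (g : ℕ) (c : ℤ → ℝ) : Div :=
  (((g - 1) / 2 : ℕ) : ℤ) •
    (Finsupp.single (V g c 0) (1 : ℤ) + Finsupp.single (conj c (V g c 0)) (1 : ℤ))
  + Finsupp.single (V g c 0) (1 : ℤ)

end TropicalHyperelliptic

open TropicalHyperelliptic


section
open scoped BigOperators
open TropicalHyperelliptic

namespace LadderAux

open Filter Topology Set

/-! ### Piecewise linear functions of one real variable -/

/-- `h` has right outgoing slope `s` at `a`. -/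
def RS (h : ℝ → ℝ) (a : ℝ) (s : ℤ) : Prop :=
  ∀ᶠ t : ℝ in 𝓝[>] 0, h (a + t) = h a + (s : ℝ) * t

/-- `h` has left outgoing slope `s` at `a`. -/
def LS (h : ℝ → ℝ) (a : ℝ) (s : ℤ) : Prop :=
  ∀ᶠ t : ℝ in 𝓝[>] 0, h (a - t) = h a + (s : ℝ) * t

lemma ev_pos : ∀ᶠ t : ℝ in 𝓝[>] 0, 0 < t := self_mem_nhdsWithin

lemma ev_lt {e : ℝ} (he : 0 < e) : ∀ᶠ t : ℝ in 𝓝[>] 0, t < e :=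
  nhdsWithin_le_nhds (Iio_mem_nhds he)

lemma ev_mul_lt {e : ℝ} (q : ℝ) (he : 0 < e) : ∀ᶠ t : ℝ in 𝓝[>] 0, t * q < e := by
  have h : Tendsto (fun t : ℝ => t * q) (𝓝 0) (𝓝 0) := by
    have := Continuous.tendsto (f := fun t : ℝ => t * q) (by fun_prop) (0 : ℝ)
    simpa using this
  exact Filter.Eventually.filter_mono nhdsWithin_le_nhds (h.eventually (Iio_mem_nhds he))

lemma ev_exists {Q : ℝ → Prop} (h : ∀ᶠ t : ℝ in 𝓝[>] 0, Q t) : ∃ t, Q t := h.exists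

lemma ev_iff {Q : ℝ → Prop} :
    (∀ᶠ t : ℝ in 𝓝[>] 0, Q t) ↔ ∃ e > (0:ℝ), ∀ t, 0 < t → t < e → Q t := by
  constructor
  · intro h
    obtain ⟨e, he, h'⟩ := mem_nhdsGT_iff_exists_Ioo_subset.1 h
    exact ⟨e, he, fun t h0 h1 => h' ⟨h0, h1⟩⟩
  · rintro ⟨e, he, h⟩
    filter_upwards [ev_pos, ev_lt he] with t h0 h1 using h t h0 h1

lemma RS.unique {h : ℝ → ℝ} {a : ℝ} {s s' : ℤ} (h1 : RS h a s) (h2 : RS h a s') : s = s' := by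
  obtain ⟨t, h1, h2, h0⟩ := (h1.and (h2.and ev_pos)).exists
  have : (s : ℝ) * t = s' * t := by linarith
  exact_mod_cast mul_right_cancel₀ h0.ne' this

lemma LS.unique {h : ℝ → ℝ} {a : ℝ} {s s' : ℤ} (h1 : LS h a s) (h2 : LS h a s') : s = s' := by
  obtain ⟨t, h1, h2, h0⟩ := (h1.and (h2.and ev_pos)).exists
  have : (s : ℝ) * t = s' * t := by linarith
  exact_mod_cast mul_right_cancel₀ h0.ne' this

/-- `h` is piecewise linear with integer slopes and its order function is `o`. -/
def PLf (h : ℝ → ℝ) (o : ℝ → ℤ) : Prop :=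
  ∀ a, ∃ r l : ℤ, RS h a r ∧ LS h a l ∧ o a = r + l

lemma PLf.add {h h' : ℝ → ℝ} {o o' : ℝ → ℤ} (H : PLf h o) (H' : PLf h' o') :
    PLf (fun x => h x + h' x) (fun x => o x + o' x) := by
  intro a
  obtain ⟨r, l, h1, h2, h3⟩ := H a
  obtain ⟨r', l', h1', h2', h3'⟩ := H' a
  refine ⟨r + r', l + l', ?_, ?_, by simp only [h3, h3']; ring⟩
  · filter_upwards [h1, h1'] with t e e'
    rw [e, e']; push_cast; ring
  · filter_upwards [h2, h2'] with t e e'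
    rw [e, e']; push_cast; ring

lemma PLf.smul {h : ℝ → ℝ} {o : ℝ → ℤ} (n : ℤ) (H : PLf h o) :
    PLf (fun x => n * h x) (fun x => n * o x) := by
  intro a
  obtain ⟨r, l, h1, h2, h3⟩ := H a
  refine ⟨n * r, n * l, ?_, ?_, by simp only [h3]; ring⟩
  · filter_upwards [h1] with t e
    rw [e]; push_cast; ring
  · filter_upwards [h2] with t e
    rw [e]; push_cast; ring

lemma PLf.const (k : ℝ) : PLf (fun _ => k) (fun _ => 0) := by
  intro a
  refine ⟨0, 0, ?_, ?_, by simp⟩ <;> exact Filter.Eventually.of_forall (fun t => by simp)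

lemma PLf.ramp (s : ℝ) : PLf (fun x => max (x - s) 0) (fun x => Finsupp.single s (1 : ℤ) x) := by
  intro a
  rcases lt_trichotomy a s with h | h | h
  · refine ⟨0, 0, ?_, ?_, by simp [h.ne']⟩
    · filter_upwards [ev_lt (sub_pos.2 h)] with t ht
      rw [max_eq_right (by linarith), max_eq_right (by linarith)]; simp
    · filter_upwards [ev_pos] with t ht
      rw [max_eq_right (by linarith), max_eq_right (by linarith)]; simp
  · subst h
    refine ⟨1, 0, ?_, ?_, by simp⟩
    · filter_upwards [ev_pos] with t ht
      rw [max_eq_left (by linarith), max_eq_left (by linarith)]; push_cast; ring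
    · filter_upwards [ev_pos] with t ht
      rw [max_eq_right (by linarith), max_eq_right (by linarith)]; simp
  · refine ⟨1, -1, ?_, ?_, by simp [h.ne]⟩
    · filter_upwards [ev_pos] with t ht
      rw [max_eq_left (by linarith), max_eq_left (by linarith)]; push_cast; ring
    · filter_upwards [ev_lt (sub_pos.2 h)] with t ht
      rw [max_eq_left (by linarith), max_eq_left (by linarith)]; push_cast; ring

/-- The moment of `o` with respect to the weight `w`. -/
noncomputable def M (w : ℝ → ℝ) (o : ℝ →₀ ℤ) : ℝ := o.sum fun t n => (n : ℝ) * w t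

lemma M_zero (w : ℝ → ℝ) : M w 0 = 0 := by simp [M]

lemma M_add (w : ℝ → ℝ) (o o' : ℝ →₀ ℤ) : M w (o + o') = M w o + M w o' := by
  unfold M
  apply Finsupp.sum_add_index'
  · intro a; simp
  · intro a m n; push_cast; ring

lemma M_single (w : ℝ → ℝ) (s : ℝ) (n : ℤ) : M w (Finsupp.single s n) = n * w s := by
  unfold M; rw [Finsupp.sum_single_index]; simp

lemma M_neg (w : ℝ → ℝ) (o : ℝ →₀ ℤ) : M w (-o) = - M w o := by
  have := M_add w o (-o)
  rw [add_neg_cancel, M_zero] at this; linarith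

lemma M_sub (w : ℝ → ℝ) (o o' : ℝ →₀ ℤ) : M w (o - o') = M w o - M w o' := by
  rw [sub_eq_add_neg, M_add, M_neg]; ring

lemma M_congr {w w' : ℝ → ℝ} {o : ℝ →₀ ℤ} (h : ∀ t, o t ≠ 0 → w t = w' t) : M w o = M w' o := by
  unfold M
  apply Finsupp.sum_congr
  intro t ht
  rw [h t (Finsupp.mem_support_iff.1 ht)]

lemma M_lin (w w' : ℝ → ℝ) (k k' : ℝ) (o : ℝ →₀ ℤ) :
    M (fun t => k * w t + k' * w' t) o = k * M w o + k' * M w' o := by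
  unfold M Finsupp.sum
  rw [Finset.mul_sum, Finset.mul_sum, ← Finset.sum_add_distrib]
  apply Finset.sum_congr rfl; intros; ring

/-- `o` is an edge divisor of degree `0` on `[A, B]`. -/
def Ed (A B : ℝ) (o : ℝ →₀ ℤ) : Prop :=
  (∀ t, o t ≠ 0 → A ≤ t ∧ t ≤ B) ∧ M (fun _ => 1) o = 0

lemma Ed.zero (A B : ℝ) : Ed A B 0 := ⟨by simp, by simp [M_zero]⟩

lemma Ed.add {A B : ℝ} {o o' : ℝ →₀ ℤ} (h : Ed A B o) (h' : Ed A B o') : Ed A B (o + o') := by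
  refine ⟨fun t ht => ?_, by rw [M_add, h.2, h'.2, add_zero]⟩
  by_cases h0 : o t = 0
  · exact h'.1 t (by simpa [h0] using ht)
  · exact h.1 t h0

lemma Ed.neg {A B : ℝ} {o : ℝ →₀ ℤ} (h : Ed A B o) : Ed A B (-o) := by
  refine ⟨fun t ht => h.1 t (by simpa using ht), by rw [M_neg, h.2, neg_zero]⟩

lemma Ed.move {A B s t : ℝ} (hs : A ≤ s ∧ s ≤ B) (ht : A ≤ t ∧ t ≤ B) :
    Ed A B (Finsupp.single t 1 - Finsupp.single s 1) := by
  refine ⟨fun x hx => ?_, by simp [M_sub, M_single]⟩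
  by_cases h1 : x = s
  · subst h1; exact hs
  by_cases h2 : x = t
  · subst h2; exact ht
  · exfalso; apply hx; simp [Ne.symm h1, Ne.symm h2]

/-- The potential of the divisor `o`. -/
noncomputable def pot (o : ℝ →₀ ℤ) (x : ℝ) : ℝ := M (fun t => max (x - t) 0) o

lemma pot_PLf (o : ℝ →₀ ℤ) : PLf (pot o) o := by
  induction o using Finsupp.induction_linear with
  | zero =>
    have : pot 0 = fun _ => 0 := by ext; simp [pot, M_zero]
    rw [this]; exact PLf.const 0
  | add f g hf hg =>
    have : pot (f + g) = fun x => pot f x + pot g x := by ext; simp [pot, M_add]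
    rw [this]; exact hf.add hg
  | single a n =>
    have : pot (Finsupp.single a n) = fun x => n * max (x - a) 0 := by ext; simp [pot, M_single]
    rw [this]
    have h := (PLf.ramp a).smul n
    convert h using 2 with x
    simp [Finsupp.single_apply]

lemma PLf.continuous {h : ℝ → ℝ} {o : ℝ → ℤ} (H : PLf h o) : Continuous h := by
  rw [continuous_iff_continuousAt]
  intro a
  obtain ⟨r, l, h1, h2, -⟩ := H a
  rw [continuousAt_iff_continuous_left'_right']
  constructor
  · have : Tendsto (fun x => h a + (l:ℝ) * (a - x)) (𝓝[<] a) (𝓝 (h a)) := by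
      have : Tendsto (fun x => h a + (l:ℝ) * (a - x)) (𝓝 a) (𝓝 (h a + l * (a - a))) :=
        (Continuous.tendsto (by fun_prop) a)
      simpa using this.mono_left nhdsWithin_le_nhds
    refine this.congr' ?_
    obtain ⟨e, he, h2⟩ := ev_iff.1 h2
    filter_upwards [self_mem_nhdsWithin, nhdsWithin_le_nhds (Ioi_mem_nhds (show a - e < a by linarith))] with x hx hx'
    have := h2 (a - x) (by simpa using hx) (by have := mem_Ioi.1 hx'; linarith)
    rw [← this]; congr 1; ring
  · have : Tendsto (fun x => h a + (r:ℝ) * (x - a)) (𝓝[>] a) (𝓝 (h a)) := by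
      have : Tendsto (fun x => h a + (r:ℝ) * (x - a)) (𝓝 a) (𝓝 (h a + r * (a - a))) :=
        (Continuous.tendsto (by fun_prop) a)
      simpa using this.mono_left nhdsWithin_le_nhds
    refine this.congr' ?_
    obtain ⟨e, he, h1⟩ := ev_iff.1 h1
    filter_upwards [self_mem_nhdsWithin, nhdsWithin_le_nhds (Iio_mem_nhds (show a < a + e by linarith))] with x hx hx'
    have := h1 (x - a) (by simpa using hx) (by have := mem_Iio.1 hx'; linarith)
    rw [← this]; congr 1; ring

/-- Potentials are constant to the left of the support. -/
lemma pot_left {A B : ℝ} {o : ℝ →₀ ℤ} (h : Ed A B o) {x : ℝ} (hx : x ≤ A) : pot o x = 0 := by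
  unfold pot
  rw [M_congr (w' := fun _ => 0)]
  · simp [M]
  · intro t ht
    exact max_eq_right (by linarith [(h.1 t ht).1])

lemma pot_right {A B : ℝ} {o : ℝ →₀ ℤ} (h : Ed A B o) {x : ℝ} (hx : B ≤ x) :
    pot o x = - M (fun t => t) o := by
  unfold pot
  rw [M_congr (w' := fun t => x * 1 + (-1) * t)]
  · rw [M_lin (fun _ => 1) (fun t => t), h.2]; ring
  · intro t ht
    rw [max_eq_left (by linarith [(h.1 t ht).2])]; ring

/-- The projection onto `[A, B]`. -/
noncomputable def cl (A B x : ℝ) : ℝ := max A (min x B)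

lemma pot_diff {A B : ℝ} {o : ℝ →₀ ℤ} (h : Ed A B o) {x y : ℝ} (hxy : x ≤ y) :
    pot o y - pot o x = - M (cl x y) o := by
  unfold pot
  have e : M (cl x y) o = M (fun t => 1 * (y * 1 + (-1) * max (y - t) 0) + 1 * max (x - t) 0) o := by
    apply M_congr
    intro t _
    unfold cl
    rcases le_total t x with h1 | h1
    · rw [min_eq_left (by linarith), max_eq_left h1, max_eq_left (by linarith), max_eq_left (by linarith)]; ring
    · rcases le_total t y with h2 | h2
      · rw [min_eq_left h2, max_eq_right h1, max_eq_left (by linarith), max_eq_right (by linarith)]; ring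
      · rw [min_eq_right h2, max_eq_right hxy, max_eq_right (by linarith), max_eq_right (by linarith)]; ring
  rw [e, M_lin (fun t => y * 1 + (-1) * max (y - t) 0) (fun t => max (x - t) 0),
    M_lin (fun _ => 1) (fun t => max (y - t) 0), h.2]
  ring

/-- A locally affine function which is constant near `-∞` is constant. -/
lemma PLf.const_of_zero {h : ℝ → ℝ} (H : PLf h (fun _ => 0)) {A : ℝ}
    (hA : ∀ x, x ≤ A → h x = h A) : ∀ x, h x = h A := by
  have key : ∀ a, ∃ r : ℤ, ∃ e > (0:ℝ), ∀ x, |x - a| < e → h x = h a + r * (x - a) := by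
    intro a
    obtain ⟨r, l, h1, h2, h3⟩ := H a
    obtain ⟨e, he, h1⟩ := ev_iff.1 h1
    obtain ⟨e', he', h2⟩ := ev_iff.1 h2
    refine ⟨r, min e e', lt_min he he', fun x hx => ?_⟩
    obtain ⟨hx1, hx2⟩ := abs_lt.1 hx
    have := min_le_left e e'
    have := min_le_right e e'
    have hl : (l : ℝ) = - r := by
      have : l = -r := by simp at h3; omega
      rw [this]; push_cast; ring
    rcases lt_trichotomy x a with c | c | c
    · have := h2 (a - x) (by linarith) (by linarith)
      rw [sub_sub_cancel] at this; rw [this, hl]; ring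
    · rw [c]; simp
    · have := h1 (x - a) (by linarith) (by linarith)
      rw [add_sub_cancel] at this; rw [this]
  choose r e he hr using key
  have hd : ∀ a x, |x - a| < e a → HasDerivAt h (r a) x := by
    intro a x hx
    have h1 : HasDerivAt (fun x => h a + r a * (x - a)) (r a : ℝ) x := by
      have := (((hasDerivAt_id x).sub_const a).const_mul (r a : ℝ)).const_add (h a)
      simpa using this
    refine h1.congr_of_eventuallyEq ?_
    have : IsOpen {x | |x - a| < e a} := isOpen_lt (by fun_prop) (by fun_prop)
    filter_upwards [this.mem_nhds hx] with z hz using hr a z hz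
  have hd0 : ∀ a, HasDerivAt h (r a) a := fun a => hd a a (by simpa using he a)
  have hlc : IsLocallyConstant r := by
    rw [IsLocallyConstant.iff_eventually_eq]
    intro a
    have : IsOpen {x | |x - a| < e a} := isOpen_lt (by fun_prop) (by fun_prop)
    filter_upwards [this.mem_nhds (show |a - a| < e a by simpa using he a)] with z hz
    have := (hd0 z).unique (hd a z hz)
    exact_mod_cast this
  have hr0 : ∀ a, r a = 0 := by
    intro a
    rw [hlc.apply_eq_of_isPreconnected (isPreconnected_univ) (mem_univ a) (mem_univ (A - 1))]
    have h1 : HasDerivAt h 0 (A - 1) := by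
      refine (hasDerivAt_const (A-1) (h A)).congr_of_eventuallyEq ?_
      filter_upwards [Iio_mem_nhds (show A - 1 < A by linarith)] with z hz using hA z (le_of_lt hz)
    have := (hd0 (A-1)).unique h1
    exact_mod_cast this
  intro x
  refine is_const_of_deriv_eq_zero (f := h) (fun a => (hd0 a).differentiableAt) (fun a => ?_) x A
  rw [(hd0 a).deriv, hr0 a]; simp

/-- Every PL function which is constant outside `[A,B]` comes from a divisor. -/
lemma PLf.exists_divisor {h : ℝ → ℝ} {o : ℝ → ℤ} (H : PLf h o) {A B : ℝ}
    (hA : ∀ x, x ≤ A → h x = h A) (hB : ∀ x, B ≤ x → h x = h B) (hAB : A ≤ B) :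
    ∃ O : ℝ →₀ ℤ, (∀ a, O a = o a) ∧ Ed A B O ∧ ∀ x, h x = h A + pot O x := by
  have hsupp : ∀ a, o a ≠ 0 → a ∈ Icc A B := by
    intro a ha
    obtain ⟨r, l, h1, h2, h3⟩ := H a
    by_contra hc
    rw [mem_Icc, not_and_or, not_le, not_le] at hc
    apply ha
    rcases hc with hc | hc
    · have hr : RS h a 0 := by
        filter_upwards [ev_lt (sub_pos.2 hc)] with t ht
        rw [hA _ (by linarith), hA a hc.le]; simp
      have hl : LS h a 0 := by
        filter_upwards [ev_pos] with t ht
        rw [hA _ (by linarith), hA a hc.le]; simp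
      rw [h3, h1.unique hr, h2.unique hl]; rfl
    · have hr : RS h a 0 := by
        filter_upwards [ev_pos] with t ht
        rw [hB _ (by linarith), hB a hc.le]; simp
      have hl : LS h a 0 := by
        filter_upwards [ev_lt (sub_pos.2 hc)] with t ht
        rw [hB _ (by linarith), hB a hc.le]; simp
      rw [h3, h1.unique hr, h2.unique hl]; rfl
  -- punctured neighbourhoods
  have hloc : ∀ a, ∀ᶠ x in 𝓝[≠] a, o x = 0 := by
    intro a
    obtain ⟨r, l, h1, h2, h3⟩ := H a
    obtain ⟨e, he, h1⟩ := ev_iff.1 h1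
    obtain ⟨e', he', h2⟩ := ev_iff.1 h2
    have m1 : Ioo (a - e') (a + e) ∈ 𝓝 a := Ioo_mem_nhds (by linarith) (by linarith)
    filter_upwards [self_mem_nhdsWithin, nhdsWithin_le_nhds m1] with x hx hx'
    obtain ⟨r', l', k1, k2, k3⟩ := H x
    rcases lt_or_gt_of_ne (show x ≠ a from hx) with c | c
    · have hval : ∀ z, a - e' < z → z < a → h z = h a + l * (a - z) := by
        intro z z1 z2
        have := h2 (a - z) (by linarith) (by linarith)
        rwa [sub_sub_cancel] at this
      have hr : RS h x (-l) := by
        filter_upwards [ev_pos, ev_lt (sub_pos.2 c)] with t t0 ht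
        rw [hval _ (by linarith [hx'.1]) (by linarith), hval x hx'.1 c]; push_cast; ring
      have hl : LS h x l := by
        filter_upwards [ev_pos, ev_lt (sub_pos.2 hx'.1)] with t t0 ht
        rw [hval _ (by linarith [hx'.1]) (by linarith), hval x hx'.1 c]; push_cast; ring
      rw [k3, k1.unique hr, k2.unique hl]; ring
    · have hval : ∀ z, a < z → z < a + e → h z = h a + r * (z - a) := by
        intro z z1 z2
        have := h1 (z - a) (by linarith) (by linarith)
        rwa [add_sub_cancel] at this
      have hr : RS h x r := by
        filter_upwards [ev_pos, ev_lt (sub_pos.2 hx'.2)] with t t0 ht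
        rw [hval _ (by linarith) (by linarith [hx'.1]), hval x c hx'.2]; push_cast; ring
      have hl : LS h x (-r) := by
        filter_upwards [ev_pos, ev_lt (sub_pos.2 c)] with t t0 ht
        rw [hval _ (by linarith) (by linarith [hx'.2]), hval x c hx'.2]; push_cast; ring
      rw [k3, k1.unique hr, k2.unique hl]; ring
  have hfin : {a | o a ≠ 0}.Finite := by
    by_contra hinf
    obtain ⟨a, -, ha⟩ := Set.Infinite.exists_accPt_of_subset_isCompact
      (s := {a | o a ≠ 0}) hinf (isCompact_Icc (a := A) (b := B)) hsupp
    have := (accPt_iff_frequently_nhdsNE.1 ha)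
    exact this ((hloc a).mono fun x hx => by simpa using hx)
  let O : ℝ →₀ ℤ := Finsupp.ofSupportFinite o hfin
  have hO : ∀ a, O a = o a := fun a => rfl
  have hOs : ∀ t, O t ≠ 0 → A ≤ t ∧ t ≤ B := fun t ht => hsupp t ht
  have hpl : PLf (fun x => h x + ((-1 : ℤ) : ℝ) * pot O x) (fun _ => 0) := by
    have := H.add ((pot_PLf O).smul (-1))
    convert this using 2 with x
    rw [hO]; ring
  have potl : ∀ x, x ≤ A → pot O x = 0 := by
    intro x hx
    unfold pot
    rw [M_congr (w' := fun _ => 0)]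
    · simp [M]
    · intro t ht
      exact max_eq_right (by linarith [(hOs t ht).1])
  have hh : ∀ x, h x = h A + pot O x := by
    intro x
    have := hpl.const_of_zero (A := A) (fun x hx => by simp only [potl x hx, potl A le_rfl, hA x hx]) x
    simp only [potl A le_rfl] at this
    push_cast at this; linarith
  refine ⟨O, hO, ⟨hOs, ?_⟩, hh⟩
  have e : ∀ x, B ≤ x → pot O x = x * M (fun _ => 1) O + (-1) * M (fun t => t) O := by
    intro x hx
    unfold pot
    rw [← M_lin (fun _ => 1) (fun t => t)]
    apply M_congr
    intro t ht
    rw [max_eq_left (by linarith [(hOs t ht).2])]; ring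
  have h1 := hh B
  have h2 := hh (B + 1)
  rw [hB (B+1) (by linarith), e _ (by linarith)] at h2
  rw [e _ le_rfl] at h1
  linarith

end LadderAux
end

section
open scoped BigOperators
open TropicalHyperelliptic

namespace LadderAux

open Filter Topology Set

/-! ### Ladders -/

/-- Combinatorial data of a ladder: rungs at `X 0 < ⋯ < X g`, upper rail the graph of `p`,
lower rail the graph of `b - p`. -/
structure Lad (g : ℕ) (X : ℕ → ℝ) (p : ℝ → ℝ) (b : ℝ) : Prop where
  g1 : 1 ≤ g
  lt : ∀ k, k < g → X k < X (k + 1)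
  lin : ∀ k, k < g → ∀ x, X k ≤ x → x ≤ X (k + 1) → p x = p (X k) + ((k : ℝ) + 1) * (x - X k)
  pos : ∀ x, X 0 ≤ x → x ≤ X g → b - p x < p x

/-- The ladder as a subset of the plane. -/
def G (g : ℕ) (X : ℕ → ℝ) (p : ℝ → ℝ) (b : ℝ) : Set (ℝ × ℝ) :=
  {P | (X 0 ≤ P.1 ∧ P.1 ≤ X g) ∧ (P.2 = p P.1 ∨ P.2 = b - p P.1 ∨
    ((∃ k, k ≤ g ∧ P.1 = X k) ∧ b - p P.1 ≤ P.2 ∧ P.2 ≤ p P.1))}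

variable {g : ℕ} {X : ℕ → ℝ} {p : ℝ → ℝ} {b : ℝ}

lemma Lad.slt (L : Lad g X p b) {j k : ℕ} (hjk : j < k) (hk : k ≤ g) : X j < X k := by
  induction k with
  | zero => omega
  | succ n ih =>
    rcases Nat.lt_succ_iff_lt_or_eq.1 hjk with h | h
    · exact (ih h (by omega)).trans (L.lt n (by omega))
    · subst h; exact L.lt j (by omega)

lemma Lad.sle (L : Lad g X p b) {j k : ℕ} (hjk : j ≤ k) (hk : k ≤ g) : X j ≤ X k := by
  rcases hjk.eq_or_lt with h | h
  · rw [h]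
  · exact (L.slt h hk).le

lemma Lad.inj (L : Lad g X p b) {j k : ℕ} (hj : j ≤ g) (hk : k ≤ g) (h : X j = X k) : j = k := by
  rcases lt_trichotomy j k with c | c | c
  · exact absurd h (L.slt c hk).ne
  · exact c
  · exact absurd h (L.slt c hj).ne'

lemma Lad.cellR (_L : Lad g X p b) {x : ℝ} (h0 : X 0 ≤ x) (h1 : x < X g) :
    ∃ k, k < g ∧ X k ≤ x ∧ x < X (k + 1) := by
  by_contra hc
  push Not at hc
  have : ∀ k, k ≤ g → X k ≤ x := by
    intro k
    induction k with
    | zero => intro _; exact h0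
    | succ n ih => intro hn; exact hc n (by omega) (ih (by omega))
  linarith [this g le_rfl]

lemma Lad.cellL (_L : Lad g X p b) {x : ℝ} (h0 : X 0 < x) (h1 : x ≤ X g) :
    ∃ k, k < g ∧ X k < x ∧ x ≤ X (k + 1) := by
  by_contra hc
  push Not at hc
  have : ∀ k, k ≤ g → X k < x := by
    intro k
    induction k with
    | zero => intro _; exact h0
    | succ n ih => intro hn; exact hc n (by omega) (ih (by omega))
  linarith [this g le_rfl]

lemma Lad.not_rung (L : Lad g X p b) {x : ℝ} {k : ℕ} (hk : k < g) (h0 : X k < x)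
    (h1 : x < X (k + 1)) : ∀ j, j ≤ g → x ≠ X j := by
  intro j hj e
  rcases Nat.lt_or_ge k j with c | c
  · linarith [L.sle (show k + 1 ≤ j by omega) hj]
  · linarith [L.sle c hk.le]

lemma Lad.lin2 (L : Lad g X p b) {x y : ℝ} {k : ℕ} (hk : k < g) (hx : X k ≤ x)
    (hx' : x ≤ X (k + 1)) (hy : X k ≤ y) (hy' : y ≤ X (k + 1)) :
    p y = p x + ((k : ℝ) + 1) * (y - x) := by
  rw [L.lin k hk x hx hx', L.lin k hk y hy hy']; ring

lemma G_top {x : ℝ} (h0 : X 0 ≤ x) (h1 : x ≤ X g) : (x, p x) ∈ G g X p b :=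
  ⟨⟨h0, h1⟩, Or.inl rfl⟩

lemma G_bot {x : ℝ} (h0 : X 0 ≤ x) (h1 : x ≤ X g) : (x, b - p x) ∈ G g X p b :=
  ⟨⟨h0, h1⟩, Or.inr (Or.inl rfl)⟩

lemma Lad.G_rung (L : Lad g X p b) {k : ℕ} (hk : k ≤ g) {y : ℝ} (h0 : b - p (X k) ≤ y)
    (h1 : y ≤ p (X k)) : (X k, y) ∈ G g X p b :=
  ⟨⟨L.sle (Nat.zero_le k) hk, L.sle hk le_rfl⟩, Or.inr (Or.inr ⟨⟨k, hk, rfl⟩, h0, h1⟩)⟩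

lemma Lad.G_bd (L : Lad g X p b) {x y : ℝ} (h : (x, y) ∈ G g X p b) :
    b - p x ≤ y ∧ y ≤ p x := by
  obtain ⟨⟨h0, h1⟩, h | h | h⟩ := h <;> have := L.pos _ h0 h1 <;> dsimp only at *
  · constructor <;> linarith
  · constructor <;> linarith
  · exact h.2

/-! ### Local directions -/

/-- The rails are locally straight on the side `σ` of `x`, with slope `m`. -/
def Side (g : ℕ) (X : ℕ → ℝ) (p : ℝ → ℝ) (x : ℝ) (σ m : ℤ) : Prop :=
  ∀ᶠ t : ℝ in 𝓝[>] 0, (∀ j, j ≤ g → x + σ * t ≠ X j) ∧ (X 0 ≤ x + σ * t ∧ x + σ * t ≤ X g) ∧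
    p (x + σ * t) = p x + m * t

lemma Lad.sideR (L : Lad g X p b) {x : ℝ} (h0 : X 0 ≤ x) (h1 : x < X g) :
    ∃ m, Side g X p x 1 m := by
  obtain ⟨k, hk, hx, hx'⟩ := L.cellR h0 h1
  refine ⟨k + 1, ?_⟩
  filter_upwards [ev_pos, ev_lt (sub_pos.2 hx')] with t t0 t1
  have e : x + ((1 : ℤ) : ℝ) * t = x + t := by simp
  rw [e]
  refine ⟨L.not_rung hk (by linarith) (by linarith), ⟨by linarith, ?_⟩, ?_⟩
  · linarith [L.sle (show k + 1 ≤ g by omega) le_rfl]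
  · rw [L.lin2 hk hx hx'.le (y := x + t) (by linarith) (by linarith)]; push_cast; ring

lemma Lad.sideL (L : Lad g X p b) {x : ℝ} (h0 : X 0 < x) (h1 : x ≤ X g) :
    ∃ m, Side g X p x (-1) m := by
  obtain ⟨k, hk, hx, hx'⟩ := L.cellL h0 h1
  refine ⟨-(k + 1), ?_⟩
  filter_upwards [ev_pos, ev_lt (sub_pos.2 hx)] with t t0 t1
  have e : x + ((-1 : ℤ) : ℝ) * t = x - t := by push_cast; ring
  rw [e]
  refine ⟨L.not_rung hk (by linarith) (by linarith), ⟨?_, by linarith⟩, ?_⟩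
  · linarith [L.sle (Nat.zero_le k) hk.le]
  · rw [L.lin2 hk hx.le hx' (y := x - t) (by linarith) (by linarith)]; push_cast; ring

lemma mem_localDirs {S : Set (ℝ × ℝ)} {P : ℝ × ℝ} {v : ℤ × ℤ} :
    v ∈ localDirs S P ↔ IsCoprime v.1 v.2 ∧ ∀ᶠ t : ℝ in 𝓝[>] 0, P + t • vr v ∈ S := by
  rw [ev_iff]; rfl

lemma pt_add (x y t : ℝ) (v : ℤ × ℤ) :
    ((x, y) : ℝ × ℝ) + t • vr v = (x + t * v.1, y + t * v.2) := by
  simp [vr]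

lemma Lad.side_dirs (L : Lad g X p b) {x y : ℝ} (hP : (x, y) ∈ G g X p b) {σ m : ℤ}
    (hσ : σ = 1 ∨ σ = -1) (hs : Side g X p x σ m) (v : ℤ × ℤ) :
    (v ∈ localDirs (G g X p b) (x, y) ∧ 0 < σ * v.1) ↔
      (y = p x ∧ v = (σ, m)) ∨ (y = b - p x ∧ v = (σ, -m)) := by
  have hpos := L.pos x hP.1.1 hP.1.2
  have hbd := L.G_bd hP
  have hσ2 : σ * σ = 1 := by rcases hσ with h | h <;> rw [h] <;> rfl
  constructor
  · rintro ⟨hv, hv1⟩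
    obtain ⟨hco, hv⟩ := mem_localDirs.1 hv
    obtain ⟨a, w⟩ := v
    dsimp only at *
    obtain ⟨n, hn⟩ : ∃ n : ℤ, n = σ * a := ⟨_, rfl⟩
    have ha : a = σ * n := by rw [hn, ← mul_assoc, hσ2, one_mul]
    rw [← hn] at hv1
    have hnR : (0 : ℝ) < n := by exact_mod_cast hv1
    have hs' : ∀ᶠ t : ℝ in 𝓝[>] 0, (∀ j, j ≤ g → x + σ * (n * t) ≠ X j) ∧
        p (x + σ * (n * t)) = p x + m * (n * t) := by
      obtain ⟨e, he, hs⟩ := ev_iff.1 hs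
      filter_upwards [ev_pos, ev_mul_lt (n : ℝ) he] with t t0 t1
      obtain ⟨h1, -, h3⟩ := hs (n * t) (by positivity) (by linarith)
      exact ⟨h1, h3⟩
    have key : ∀ᶠ t : ℝ in 𝓝[>] 0, 0 < t ∧ (y + t * w = p x + m * (n * t) ∨
        y + t * w = b - (p x + m * (n * t))) := by
      filter_upwards [hv, hs', ev_pos] with t h1 h2 t0
      rw [pt_add, ha] at h1
      have e : x + t * ((σ * n : ℤ) : ℝ) = x + σ * (n * t) := by push_cast; ring
      rw [e] at h1
      obtain ⟨-, h1⟩ := h1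
      dsimp only at h1
      rw [h2.2] at h1
      refine ⟨t0, ?_⟩
      rcases h1 with h1 | h1 | h1
      · exact Or.inl h1
      · exact Or.inr h1
      · obtain ⟨⟨j, hj, hj'⟩, -⟩ := h1
        exact absurd hj' (h2.1 j hj)
    have hunit : ∀ q : ℤ, w = q * n → n = 1 ∧ w = q := by
      intro q hq
      have h1 : IsUnit n := by
        have : IsCoprime n (q * n) := by
          rw [ha, hq] at hco
          exact (IsCoprime.of_mul_left_right hco)
        exact this.isUnit_of_dvd' dvd_rfl (Dvd.intro_left q rfl)
      have : n = 1 := by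
        rcases Int.isUnit_iff.1 h1 with h | h <;> omega
      exact ⟨this, by rw [hq, this, mul_one]⟩
    by_cases c1 : y = p x
    · left
      refine ⟨c1, ?_⟩
      have hpos' : 0 < p x - (b - p x) := by linarith
      obtain ⟨t, ⟨t0, h⟩, h'⟩ := (key.and (ev_mul_lt (-(w + m * n) : ℝ) hpos')).exists
      have hw : w = m * n := by
        rcases h with h | h
        · have : (w : ℝ) * t = (m * n) * t := by linarith
          exact_mod_cast mul_right_cancel₀ t0.ne' this
        · exfalso; nlinarith
      obtain ⟨h1, h2⟩ := hunit m hw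
      rw [ha, h1, h2, mul_one]
    · have c1' : 0 < p x - y := by
        rcases hbd.2.eq_or_lt with h | h
        · exact absurd h c1
        · linarith
      by_cases c2 : y = b - p x
      · right
        refine ⟨c2, ?_⟩
        obtain ⟨t, ⟨t0, h⟩, h'⟩ := (key.and (ev_mul_lt ((w - m * n) : ℝ) c1')).exists
        have hw : w = -m * n := by
          rcases h with h | h
          · exfalso; nlinarith
          · have : (w : ℝ) * t = (-m * n) * t := by linarith
            exact_mod_cast mul_right_cancel₀ t0.ne' this
        obtain ⟨h1, h2⟩ := hunit (-m) hw
        rw [ha, h1, h2, mul_one]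
      · exfalso
        have c2' : 0 < y - (b - p x) := by
          rcases hbd.1.eq_or_lt with h | h
          · exact absurd h.symm c2
          · linarith
        obtain ⟨t, ⟨⟨t0, h⟩, h'⟩, h''⟩ := ((key.and (ev_mul_lt ((w - m * n) : ℝ) c1')).and
          (ev_mul_lt (-(w + m * n) : ℝ) c2')).exists
        rcases h with h | h <;> nlinarith
  · rintro (⟨h1, rfl⟩ | ⟨h1, rfl⟩)
    · refine ⟨mem_localDirs.2 ⟨?_, ?_⟩, by simp [hσ2]⟩
      · rcases hσ with h | h <;> rw [h]
        · exact isCoprime_one_left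
        · exact isCoprime_one_left.neg_left
      · filter_upwards [hs] with t ht
        rw [pt_add]
        dsimp only
        rw [mul_comm t, mul_comm t, h1, ← ht.2.2]
        exact G_top ht.2.1.1 ht.2.1.2
    · refine ⟨mem_localDirs.2 ⟨?_, ?_⟩, by simp [hσ2]⟩
      · rcases hσ with h | h <;> rw [h]
        · exact isCoprime_one_left
        · exact isCoprime_one_left.neg_left
      · filter_upwards [hs] with t ht
        rw [pt_add]
        dsimp only
        have e : y + t * ((-m : ℤ) : ℝ) = b - p (x + σ * t) := by
          rw [ht.2.2, h1]; push_cast; ring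
        rw [mul_comm t, e]
        exact G_bot ht.2.1.1 ht.2.1.2

lemma Lad.no_right {y : ℝ} (v : ℤ × ℤ) :
    ¬ (v ∈ localDirs (G g X p b) (X g, y) ∧ 0 < v.1) := by
  rintro ⟨h, h1⟩
  obtain ⟨t, h, t0⟩ := ((mem_localDirs.1 h).2.and ev_pos).exists
  rw [pt_add] at h
  have := h.1.2
  have h1' : (0 : ℝ) < v.1 := by exact_mod_cast h1
  dsimp only at this
  nlinarith

lemma Lad.no_left {y : ℝ} (v : ℤ × ℤ) :
    ¬ (v ∈ localDirs (G g X p b) (X 0, y) ∧ 0 < -v.1) := by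
  rintro ⟨h, h1⟩
  obtain ⟨t, h, t0⟩ := ((mem_localDirs.1 h).2.and ev_pos).exists
  rw [pt_add] at h
  have := h.1.1
  have h1' : (0 : ℝ) < -v.1 := by exact_mod_cast h1
  dsimp only at this
  nlinarith

lemma ev_ne (q : ℝ) : ∀ᶠ t : ℝ in 𝓝[>] 0, t ≠ q := by
  rcases le_or_gt q 0 with h | h
  · filter_upwards [ev_pos] with t ht e; linarith
  · filter_upwards [ev_lt h] with t ht e; linarith

lemma Lad.vert_dirs (L : Lad g X p b) {x y : ℝ} (hP : (x, y) ∈ G g X p b) (v : ℤ × ℤ) :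
    (v ∈ localDirs (G g X p b) (x, y) ∧ v.1 = 0) ↔
      (∃ k, k ≤ g ∧ x = X k) ∧ ((y < p x ∧ v = (0, 1)) ∨ (b - p x < y ∧ v = (0, -1))) := by
  have hpos := L.pos x hP.1.1 hP.1.2
  have hbd := L.G_bd hP
  constructor
  · rintro ⟨hv, hv1⟩
    obtain ⟨hco, hv⟩ := mem_localDirs.1 hv
    obtain ⟨a, w⟩ := v
    dsimp only at *
    subst hv1
    have hw : w = 1 ∨ w = -1 := Int.isUnit_iff.1 (isCoprime_zero_left.1 hco)
    have hv' : ∀ᶠ t : ℝ in 𝓝[>] 0, (x, y + t * w) ∈ G g X p b := by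
      filter_upwards [hv] with t ht
      rw [pt_add] at ht
      simpa using ht
    constructor
    · rcases hw with rfl | rfl
      · obtain ⟨t, ⟨h1, h2⟩, h3⟩ := ((hv'.and (ev_ne (p x - y))).and (ev_ne (b - p x - y))).exists
        rcases h1.2 with h | h | h
        · exact absurd (by push_cast at h; simp at h; linarith) h2
        · exact absurd (by push_cast at h; simp at h; linarith) h3
        · exact h.1
      · obtain ⟨t, ⟨h1, h2⟩, h3⟩ := ((hv'.and (ev_ne (y - p x))).and (ev_ne (y - b + p x))).exists
        rcases h1.2 with h | h | h
        · exact absurd (by push_cast at h; simp at h; linarith) h2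
        · exact absurd (by push_cast at h; simp at h; linarith) h3
        · exact h.1
    · obtain ⟨t, h1, t0⟩ := (hv'.and ev_pos).exists
      have := L.G_bd h1
      rcases hw with rfl | rfl
      · left; push_cast at this; exact ⟨by linarith, rfl⟩
      · right; push_cast at this; exact ⟨by linarith, rfl⟩
  · rintro ⟨⟨k, hk, rfl⟩, ⟨h1, rfl⟩ | ⟨h1, rfl⟩⟩
    · refine ⟨mem_localDirs.2 ⟨isCoprime_one_right, ?_⟩, rfl⟩
      filter_upwards [ev_pos, ev_lt (sub_pos.2 h1)] with t t0 t1
      rw [pt_add]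
      simp only [Int.cast_zero, mul_zero, add_zero, Int.cast_one, mul_one]
      exact L.G_rung hk (by linarith) (by linarith)
    · refine ⟨mem_localDirs.2 ⟨isCoprime_one_right.neg_right, ?_⟩, rfl⟩
      filter_upwards [ev_pos, ev_lt (sub_pos.2 h1)] with t t0 t1
      rw [pt_add]
      simp only [Int.cast_zero, mul_zero, add_zero, Int.cast_neg, Int.cast_one, mul_neg, mul_one]
      exact L.G_rung hk (by linarith) (by linarith)

/-! ### Slopes and orders -/

lemma hasSlope_of {S : Set (ℝ × ℝ)} {f : ℝ × ℝ → ℝ} {P : ℝ × ℝ} {v : ℤ × ℤ} {s : ℤ}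
    (h : ∀ᶠ t : ℝ in 𝓝[>] 0, f (P + t • vr v) = f P + (s : ℝ) * t) : HasSlope S f P v s := by
  obtain ⟨e, he, h⟩ := ev_iff.1 h
  refine ⟨e, he, fun t t0 t1 _ => ?_⟩
  rcases t0.eq_or_lt with c | c
  · rw [← c]; simp
  · exact h t c t1

lemma ev_of_hasSlope {S : Set (ℝ × ℝ)} {f : ℝ × ℝ → ℝ} {P : ℝ × ℝ} {v : ℤ × ℤ} {s : ℤ}
    (hv : v ∈ localDirs S P) (h : HasSlope S f P v s) :
    ∀ᶠ t : ℝ in 𝓝[>] 0, f (P + t • vr v) = f P + (s : ℝ) * t := by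
  obtain ⟨e, he, h⟩ := h
  filter_upwards [(mem_localDirs.1 hv).2, ev_pos, ev_lt he] with t h1 h2 h3
  exact h t h2.le h3 h1

lemma slope_eq {S : Set (ℝ × ℝ)} {f : ℝ × ℝ → ℝ} {P : ℝ × ℝ} {v : ℤ × ℤ} {s : ℤ}
    (hv : v ∈ localDirs S P)
    (h : ∀ᶠ t : ℝ in 𝓝[>] 0, f (P + t • vr v) = f P + (s : ℝ) * t) :
    TropicalHyperelliptic.slope S f P v = s := by
  have hex : ∃ s : ℤ, HasSlope S f P v s := ⟨s, hasSlope_of h⟩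
  unfold TropicalHyperelliptic.slope
  rw [dif_pos hex]
  have h2 := ev_of_hasSlope hv hex.choose_spec
  obtain ⟨t, ⟨h1, h2⟩, t0⟩ := ((h.and h2).and ev_pos).exists
  have : (hex.choose : ℝ) * t = s * t := by linarith
  exact_mod_cast mul_right_cancel₀ t0.ne' this

lemma Lad.side_sum (L : Lad g X p b) {x y : ℝ} (hP : (x, y) ∈ G g X p b) {σ m : ℤ}
    (hσ : σ = 1 ∨ σ = -1) (hs : Side g X p x σ m) {f : ℝ × ℝ → ℝ} {su sd : ℤ}
    (hu : ∀ᶠ t : ℝ in 𝓝[>] 0, f (x + σ * t, p (x + σ * t)) = f (x, p x) + su * t)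
    (hd : ∀ᶠ t : ℝ in 𝓝[>] 0, f (x + σ * t, b - p (x + σ * t)) = f (x, b - p x) + sd * t) :
    {v | v ∈ localDirs (G g X p b) (x, y) ∧ 0 < σ * v.1}.Finite ∧
    (∀ v, v ∈ localDirs (G g X p b) (x, y) ∧ 0 < σ * v.1 →
      ∃ s, HasSlope (G g X p b) f (x, y) v s) ∧
    ∑ᶠ v ∈ {v | v ∈ localDirs (G g X p b) (x, y) ∧ 0 < σ * v.1},
      TropicalHyperelliptic.slope (G g X p b) f (x, y) v =
      (if y = p x then su else 0) + (if y = b - p x then sd else 0) := by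
  have hpos := L.pos x hP.1.1 hP.1.2
  have hD := L.side_dirs hP hσ hs
  by_cases c1 : y = p x
  · have c2 : ¬ y = b - p x := by intro h; linarith
    have e : {v | v ∈ localDirs (G g X p b) (x, y) ∧ 0 < σ * v.1} = {(σ, m)} := by
      ext v
      refine (hD v).trans ?_
      rw [mem_singleton_iff]
      constructor
      · rintro (⟨_, h⟩ | ⟨h, _⟩)
        · exact h
        · exact absurd h c2
      · exact fun h => Or.inl ⟨c1, h⟩
    have hev : ∀ᶠ t : ℝ in 𝓝[>] 0,
        f ((x, y) + t • vr (σ, m)) = f (x, y) + (su : ℝ) * t := by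
      filter_upwards [hu, hs] with t h1 h2
      rw [c1, ← h1, h2.2.2, pt_add]
      dsimp only
      rw [mul_comm t, mul_comm t]
    have hmem : (σ, m) ∈ localDirs (G g X p b) (x, y) := ((hD (σ, m)).2 (Or.inl ⟨c1, rfl⟩)).1
    refine ⟨by rw [e]; exact finite_singleton _, ?_, ?_⟩
    · intro v hv
      have : v ∈ {v | v ∈ localDirs (G g X p b) (x, y) ∧ 0 < σ * v.1} := hv
      rw [e] at this
      rw [mem_singleton_iff.1 this]
      exact ⟨su, hasSlope_of hev⟩
    · rw [e, finsum_mem_singleton, slope_eq hmem hev, if_pos c1, if_neg c2, add_zero]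
  · by_cases c2 : y = b - p x
    · have e : {v | v ∈ localDirs (G g X p b) (x, y) ∧ 0 < σ * v.1} = {(σ, -m)} := by
        ext v
        refine (hD v).trans ?_
        rw [mem_singleton_iff]
        constructor
        · rintro (⟨h, _⟩ | ⟨_, h⟩)
          · exact absurd h c1
          · exact h
        · exact fun h => Or.inr ⟨c2, h⟩
      have hev : ∀ᶠ t : ℝ in 𝓝[>] 0,
          f ((x, y) + t • vr (σ, -m)) = f (x, y) + (sd : ℝ) * t := by
        filter_upwards [hd, hs] with t h1 h2
        rw [c2, ← h1, h2.2.2, pt_add]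
        dsimp only
        congr 2
        · ring
        · push_cast; ring
      have hmem : (σ, -m) ∈ localDirs (G g X p b) (x, y) := ((hD (σ, -m)).2 (Or.inr ⟨c2, rfl⟩)).1
      refine ⟨by rw [e]; exact finite_singleton _, ?_, ?_⟩
      · intro v hv
        have : v ∈ {v | v ∈ localDirs (G g X p b) (x, y) ∧ 0 < σ * v.1} := hv
        rw [e] at this
        rw [mem_singleton_iff.1 this]
        exact ⟨sd, hasSlope_of hev⟩
      · rw [e, finsum_mem_singleton, slope_eq hmem hev, if_neg c1, if_pos c2, zero_add]
    · have e : {v | v ∈ localDirs (G g X p b) (x, y) ∧ 0 < σ * v.1} = ∅ := by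
        ext v
        refine (hD v).trans ?_
        simp only [c1, c2, false_and, or_self, mem_empty_iff_false]
      refine ⟨by rw [e]; exact finite_empty, ?_, ?_⟩
      · intro v hv
        have : v ∈ {v | v ∈ localDirs (G g X p b) (x, y) ∧ 0 < σ * v.1} := hv
        rw [e] at this
        exact absurd this (notMem_empty _)
      · rw [e, finsum_mem_empty, if_neg c1, if_neg c2, zero_add]

end LadderAux
end

section
open scoped BigOperators
open TropicalHyperelliptic

namespace LadderAux

open Filter Topology Set

variable {g : ℕ} {X : ℕ → ℝ} {p : ℝ → ℝ} {b : ℝ}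

lemma Lad.vert_sum (L : Lad g X p b) {k : ℕ} (hk : k ≤ g) {y : ℝ}
    (hP : (X k, y) ∈ G g X p b) {f : ℝ × ℝ → ℝ} {s1 s2 : ℤ}
    (h1 : y < p (X k) → ∀ᶠ t : ℝ in 𝓝[>] 0, f (X k, y + t) = f (X k, y) + s1 * t)
    (h2 : b - p (X k) < y → ∀ᶠ t : ℝ in 𝓝[>] 0, f (X k, y - t) = f (X k, y) + s2 * t)
    (h1' : y = p (X k) → s1 = 0) (h2' : y = b - p (X k) → s2 = 0) :
    {v | v ∈ localDirs (G g X p b) (X k, y) ∧ v.1 = 0}.Finite ∧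
    (∀ v, v ∈ localDirs (G g X p b) (X k, y) ∧ v.1 = 0 →
      ∃ s, HasSlope (G g X p b) f (X k, y) v s) ∧
    ∑ᶠ v ∈ {v | v ∈ localDirs (G g X p b) (X k, y) ∧ v.1 = 0},
      TropicalHyperelliptic.slope (G g X p b) f (X k, y) v = s1 + s2 := by
  have hbd := L.G_bd hP
  have hpos := L.pos _ hP.1.1 hP.1.2
  dsimp only at hpos
  have hD := L.vert_dirs hP
  have ev1 : y < p (X k) → ∀ᶠ t : ℝ in 𝓝[>] 0,
      f ((X k, y) + t • vr (0, 1)) = f (X k, y) + (s1 : ℝ) * t := by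
    intro h
    filter_upwards [h1 h] with t ht
    rw [pt_add, ← ht]; simp
  have ev2 : b - p (X k) < y → ∀ᶠ t : ℝ in 𝓝[>] 0,
      f ((X k, y) + t • vr (0, -1)) = f (X k, y) + (s2 : ℝ) * t := by
    intro h
    filter_upwards [h2 h] with t ht
    rw [pt_add, ← ht]; simp [sub_eq_add_neg]
  have sl1 : y < p (X k) → TropicalHyperelliptic.slope (G g X p b) f (X k, y) (0, 1) = s1 :=
    fun h => slope_eq ((hD (0, 1)).2 ⟨⟨k, hk, rfl⟩, Or.inl ⟨h, rfl⟩⟩).1 (ev1 h)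
  have sl2 : b - p (X k) < y →
      TropicalHyperelliptic.slope (G g X p b) f (X k, y) (0, -1) = s2 :=
    fun h => slope_eq ((hD (0, -1)).2 ⟨⟨k, hk, rfl⟩, Or.inr ⟨h, rfl⟩⟩).1 (ev2 h)
  refine ⟨?_, ?_, ?_⟩
  · refine Set.Finite.subset (Set.toFinite {((0:ℤ), (1:ℤ)), (0, -1)}) ?_
    intro v hv
    rcases ((hD v).1 hv).2 with h | h
    · rw [h.2]; simp
    · rw [h.2]; simp
  · intro v hv
    rcases ((hD v).1 hv).2 with h | h
    · rw [h.2]; exact ⟨s1, hasSlope_of (ev1 h.1)⟩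
    · rw [h.2]; exact ⟨s2, hasSlope_of (ev2 h.1)⟩
  · rcases hbd.2.eq_or_lt with c1 | c1
    · have c2 : b - p (X k) < y := by linarith
      have e : {v | v ∈ localDirs (G g X p b) (X k, y) ∧ v.1 = 0} = {((0:ℤ), (-1:ℤ))} := by
        ext v
        refine (hD v).trans ?_
        rw [mem_singleton_iff]
        constructor
        · rintro ⟨-, h | h⟩
          · linarith [h.1]
          · exact h.2
        · exact fun h => ⟨⟨k, hk, rfl⟩, Or.inr ⟨c2, h⟩⟩
      rw [e, finsum_mem_singleton, sl2 c2, h1' c1, zero_add]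
    · rcases hbd.1.eq_or_lt with c2 | c2
      · have e : {v | v ∈ localDirs (G g X p b) (X k, y) ∧ v.1 = 0} = {((0:ℤ), (1:ℤ))} := by
          ext v
          refine (hD v).trans ?_
          rw [mem_singleton_iff]
          constructor
          · rintro ⟨-, h | h⟩
            · exact h.2
            · linarith [h.1]
          · exact fun h => ⟨⟨k, hk, rfl⟩, Or.inl ⟨c1, h⟩⟩
        rw [e, finsum_mem_singleton, sl1 c1, h2' c2.symm, add_zero]
      · have e : {v | v ∈ localDirs (G g X p b) (X k, y) ∧ v.1 = 0}
            = {((0:ℤ), (1:ℤ)), ((0:ℤ), (-1:ℤ))} := by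
          ext v
          refine (hD v).trans ?_
          rw [mem_insert_iff, mem_singleton_iff]
          constructor
          · rintro ⟨-, h | h⟩
            · exact Or.inl h.2
            · exact Or.inr h.2
          · rintro (h | h)
            · exact ⟨⟨k, hk, rfl⟩, Or.inl ⟨c1, h⟩⟩
            · exact ⟨⟨k, hk, rfl⟩, Or.inr ⟨c2, h⟩⟩
        rw [e, finsum_mem_pair (by simp), sl1 c1, sl2 c2]

/-- `f` is described along the rails and the rungs by `u`, `d`, `r`. -/
structure Desc (g : ℕ) (X : ℕ → ℝ) (p : ℝ → ℝ) (b : ℝ) (f : ℝ × ℝ → ℝ)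
    (u d : ℝ → ℝ) (r : ℕ → ℝ → ℝ) : Prop where
  fu : ∀ x, X 0 ≤ x → x ≤ X g → f (x, p x) = u x
  fd : ∀ x, X 0 ≤ x → x ≤ X g → f (x, b - p x) = d x
  fr : ∀ k, k ≤ g → ∀ y, b - p (X k) ≤ y → y ≤ p (X k) → f (X k, y) = r k y
  uL : ∀ x, x ≤ X 0 → u x = u (X 0)
  uR : ∀ x, X g ≤ x → u x = u (X g)
  dL : ∀ x, x ≤ X 0 → d x = d (X 0)
  dR : ∀ x, X g ≤ x → d x = d (X g)
  rL : ∀ k, k ≤ g → ∀ y, y ≤ b - p (X k) → r k y = r k (b - p (X k))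
  rR : ∀ k, k ≤ g → ∀ y, p (X k) ≤ y → r k y = r k (p (X k))

lemma rs_zero {h : ℝ → ℝ} {a : ℝ} (H : ∀ x, a ≤ x → h x = h a) {s : ℤ} (hs : RS h a s) :
    s = 0 := by
  refine hs.unique ?_
  filter_upwards [ev_pos] with t ht
  rw [H _ (by linarith)]; simp

lemma ls_zero {h : ℝ → ℝ} {a : ℝ} (H : ∀ x, x ≤ a → h x = h a) {s : ℤ} (hs : LS h a s) :
    s = 0 := by
  refine hs.unique ?_
  filter_upwards [ev_pos] with t ht
  rw [H _ (by linarith)]; simp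

theorem Lad.ord_formula (L : Lad g X p b) {f : ℝ × ℝ → ℝ} {u d : ℝ → ℝ} {r : ℕ → ℝ → ℝ}
    (H : Desc g X p b f u d r) {oT oB : ℝ → ℤ} {oR : ℕ → ℝ → ℤ}
    (hT : PLf u oT) (hB : PLf d oB) (hR : ∀ k, k ≤ g → PLf (r k) (oR k))
    (P : ℝ × ℝ) (hP : P ∈ G g X p b) :
    (∀ v ∈ localDirs (G g X p b) P, ∃ s, HasSlope (G g X p b) f P v s) ∧
    ord (G g X p b) f P = (if P.2 = p P.1 then oT P.1 else 0) +
      (if P.2 = b - p P.1 then oB P.1 else 0) +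
      ∑ k ∈ Finset.range (g + 1), if P.1 = X k then oR k P.2 else 0 := by
  obtain ⟨x, y⟩ := P
  have hx := hP.1
  dsimp only at hx ⊢
  obtain ⟨tr, tl, htr, htl, hto⟩ := hT x
  obtain ⟨br, bl, hbr, hbl, hbo⟩ := hB x
  have hright : {v | v ∈ localDirs (G g X p b) (x, y) ∧ 0 < v.1}.Finite ∧
      (∀ v, v ∈ localDirs (G g X p b) (x, y) ∧ 0 < v.1 →
        ∃ s, HasSlope (G g X p b) f (x, y) v s) ∧
      ∑ᶠ v ∈ {v | v ∈ localDirs (G g X p b) (x, y) ∧ 0 < v.1},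
        TropicalHyperelliptic.slope (G g X p b) f (x, y) v =
        (if y = p x then tr else 0) + (if y = b - p x then br else 0) := by
    rcases hx.2.eq_or_lt with c | c
    · have e : {v | v ∈ localDirs (G g X p b) (x, y) ∧ 0 < v.1} = ∅ := by
        ext v
        rw [c]
        exact ⟨fun h => absurd h (Lad.no_right v), fun h => absurd h (notMem_empty _)⟩
      have e1 : tr = 0 := rs_zero (fun z hz => by rw [H.uR z (by rw [← c]; exact hz), c]) htr
      have e2 : br = 0 := rs_zero (fun z hz => by rw [H.dR z (by rw [← c]; exact hz), c]) hbr
      rw [e]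
      refine ⟨finite_empty, ?_, by simp [e1, e2]⟩
      intro v hv
      rw [c] at hv
      exact absurd hv (Lad.no_right v)
    · obtain ⟨m, hm⟩ := L.sideR hx.1 c
      have := L.side_sum hP (σ := 1) (Or.inl rfl) hm (f := f) (su := tr) (sd := br) ?_ ?_
      · simpa only [one_mul] using this
      · filter_upwards [htr, hm] with t h1 h2
        rw [H.fu _ h2.2.1.1 h2.2.1.2, H.fu _ hx.1 hx.2]; simpa using h1
      · filter_upwards [hbr, hm] with t h1 h2
        rw [H.fd _ h2.2.1.1 h2.2.1.2, H.fd _ hx.1 hx.2]; simpa using h1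
  have hleft : {v | v ∈ localDirs (G g X p b) (x, y) ∧ 0 < -v.1}.Finite ∧
      (∀ v, v ∈ localDirs (G g X p b) (x, y) ∧ 0 < -v.1 →
        ∃ s, HasSlope (G g X p b) f (x, y) v s) ∧
      ∑ᶠ v ∈ {v | v ∈ localDirs (G g X p b) (x, y) ∧ 0 < -v.1},
        TropicalHyperelliptic.slope (G g X p b) f (x, y) v =
        (if y = p x then tl else 0) + (if y = b - p x then bl else 0) := by
    rcases hx.1.eq_or_lt with c | c
    · have e : {v | v ∈ localDirs (G g X p b) (x, y) ∧ 0 < -v.1} = ∅ := by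
        ext v
        rw [← c]
        exact ⟨fun h => absurd h (Lad.no_left v), fun h => absurd h (notMem_empty _)⟩
      have e1 : tl = 0 := ls_zero (fun z hz => by rw [H.uL z (by rw [c]; exact hz), c]) htl
      have e2 : bl = 0 := ls_zero (fun z hz => by rw [H.dL z (by rw [c]; exact hz), c]) hbl
      rw [e]
      refine ⟨finite_empty, ?_, by simp [e1, e2]⟩
      intro v hv
      rw [← c] at hv
      exact absurd hv (Lad.no_left v)
    · obtain ⟨m, hm⟩ := L.sideL c hx.2
      have := L.side_sum hP (σ := -1) (Or.inr rfl) hm (f := f) (su := tl) (sd := bl) ?_ ?_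
      · simpa only [neg_mul, one_mul] using this
      · filter_upwards [htl, hm] with t h1 h2
        rw [H.fu _ h2.2.1.1 h2.2.1.2, H.fu _ hx.1 hx.2]; simpa [sub_eq_add_neg] using h1
      · filter_upwards [hbl, hm] with t h1 h2
        rw [H.fd _ h2.2.1.1 h2.2.1.2, H.fd _ hx.1 hx.2]; simpa [sub_eq_add_neg] using h1
  have hvert : {v | v ∈ localDirs (G g X p b) (x, y) ∧ v.1 = 0}.Finite ∧
      (∀ v, v ∈ localDirs (G g X p b) (x, y) ∧ v.1 = 0 →
        ∃ s, HasSlope (G g X p b) f (x, y) v s) ∧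
      ∑ᶠ v ∈ {v | v ∈ localDirs (G g X p b) (x, y) ∧ v.1 = 0},
        TropicalHyperelliptic.slope (G g X p b) f (x, y) v =
        ∑ k ∈ Finset.range (g + 1), if x = X k then oR k y else 0 := by
    by_cases c : ∃ k, k ≤ g ∧ x = X k
    · obtain ⟨k, hk, rfl⟩ := c
      obtain ⟨rr, rl, hrr, hrl, hro⟩ := hR k hk y
      have hbd := L.G_bd hP
      have := L.vert_sum hk hP (f := f) (s1 := rr) (s2 := rl) ?_ ?_ ?_ ?_
      · refine ⟨this.1, this.2.1, ?_⟩
        rw [this.2.2, Finset.sum_eq_single k]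
        · rw [if_pos rfl, hro]
        · intro j hj hjk
          rw [if_neg]
          intro e
          exact hjk (L.inj (by simpa [Nat.lt_succ_iff] using hj) hk e.symm)
        · intro h; exact absurd (Finset.mem_range.2 (by omega)) h
      · intro h
        filter_upwards [hrr, ev_pos, ev_lt (sub_pos.2 h)] with t h1 h2 h3
        rw [H.fr k hk _ (by linarith) (by linarith), H.fr k hk _ hbd.1 hbd.2, h1]
      · intro h
        filter_upwards [hrl, ev_pos, ev_lt (sub_pos.2 h)] with t h1 h2 h3
        rw [H.fr k hk _ (by linarith) (by linarith), H.fr k hk _ hbd.1 hbd.2, h1]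
      · intro h; rw [h] at hrr; exact rs_zero (H.rR k hk) hrr
      · intro h; rw [h] at hrl; exact ls_zero (H.rL k hk) hrl
    · have e : {v | v ∈ localDirs (G g X p b) (x, y) ∧ v.1 = 0} = ∅ := by
        ext v
        exact ⟨fun h => absurd ((L.vert_dirs hP v).1 h).1 c, fun h => absurd h (notMem_empty _)⟩
      rw [e]
      refine ⟨finite_empty, fun v hv => absurd ((L.vert_dirs hP v).1 hv).1 c, ?_⟩
      rw [finsum_mem_empty, Finset.sum_eq_zero]
      intro k hk
      rw [if_neg]
      intro e
      exact c ⟨k, by simpa [Nat.lt_succ_iff] using hk, e⟩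
  obtain ⟨r1, r2, r3⟩ := hright
  obtain ⟨l1, l2, l3⟩ := hleft
  obtain ⟨v1, v2, v3⟩ := hvert
  constructor
  · intro v hv
    rcases lt_trichotomy v.1 0 with c | c | c
    · exact l2 v ⟨hv, by omega⟩
    · exact v2 v ⟨hv, c⟩
    · exact r2 v ⟨hv, c⟩
  · have e : localDirs (G g X p b) (x, y) =
        ({v | v ∈ localDirs (G g X p b) (x, y) ∧ 0 < v.1} ∪
        {v | v ∈ localDirs (G g X p b) (x, y) ∧ 0 < -v.1}) ∪
        {v | v ∈ localDirs (G g X p b) (x, y) ∧ v.1 = 0} := by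
      ext v
      constructor
      · intro hv
        rcases lt_trichotomy v.1 0 with c | c | c
        · exact Or.inl (Or.inr ⟨hv, by omega⟩)
        · exact Or.inr ⟨hv, c⟩
        · exact Or.inl (Or.inl ⟨hv, c⟩)
      · rintro ((h | h) | h) <;> exact h.1
    unfold ord
    rw [e, finsum_mem_union _ (r1.union l1) v1, finsum_mem_union _ r1 l1, r3, l3, v3, hto, hbo]
    · split_ifs <;> ring
    · rw [Set.disjoint_left]
      intro v h1 h2
      have a1 := h1.2
      have a2 := h2.2
      omega
    · rw [Set.disjoint_left]
      rintro v (h1 | h1) h2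
      · have a1 := h1.2
        have a2 := h2.2
        omega
      · have a1 := h1.2
        have a2 := h2.2
        omega

end LadderAux
end

section
open scoped BigOperators
open TropicalHyperelliptic
namespace LadderAux
open Filter Topology Set
variable {g : ℕ} {X : ℕ → ℝ} {p : ℝ → ℝ} {b : ℝ}

/-- The divisor assembled from divisors on top, bottom and rungs, pointwise. -/
noncomputable def cform (g : ℕ) (X : ℕ → ℝ) (p : ℝ → ℝ) (b : ℝ)
    (oT oB : ℝ →₀ ℤ) (oR : ℕ → ℝ →₀ ℤ) (P : ℝ × ℝ) : ℤ :=
  (if P.2 = p P.1 then oT P.1 else 0) + (if P.2 = b - p P.1 then oB P.1 else 0) +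
    ∑ k ∈ Finset.range (g + 1), if P.1 = X k then oR k P.2 else 0

/-- Holonomy around the cell `j`. -/
noncomputable def hol (X : ℕ → ℝ) (oT oB : ℝ →₀ ℤ) (oR : ℕ → ℝ →₀ ℤ) (j : ℕ) : ℝ :=
  M (cl (X j) (X (j + 1))) oT - M (cl (X j) (X (j + 1))) oB
    + M (fun t => t) (oR j) - M (fun t => t) (oR (j + 1))

/-- `D` is a boundary of an edge chain with holonomy `z`. -/
def Chain (g : ℕ) (X : ℕ → ℝ) (p : ℝ → ℝ) (b : ℝ) (D : Div) (z : ℕ → ℝ) : Prop :=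
  ∃ (oT oB : ℝ →₀ ℤ) (oR : ℕ → ℝ →₀ ℤ), Ed (X 0) (X g) oT ∧ Ed (X 0) (X g) oB ∧
    (∀ k, k ≤ g → Ed (b - p (X k)) (p (X k)) (oR k)) ∧
    (∀ P, D P = cform g X p b oT oB oR P) ∧ ∀ j, j < g → z j = hol X oT oB oR j

lemma cform_zero_off (L : Lad g X p b) {oT oB : ℝ →₀ ℤ} {oR : ℕ → ℝ →₀ ℤ}
    (hT : Ed (X 0) (X g) oT) (hB : Ed (X 0) (X g) oB)
    (hR : ∀ k, k ≤ g → Ed (b - p (X k)) (p (X k)) (oR k)) {P : ℝ × ℝ}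
    (hP : P ∉ G g X p b) : cform g X p b oT oB oR P = 0 := by
  obtain ⟨x, y⟩ := P
  unfold cform
  have h1 : (if y = p x then oT x else 0) = 0 := by
    split_ifs with h
    · by_contra hc
      obtain ⟨a1, a2⟩ := hT.1 _ hc
      exact hP (by rw [h]; exact G_top a1 a2)
    · rfl
  have h2 : (if y = b - p x then oB x else 0) = 0 := by
    split_ifs with h
    · by_contra hc
      obtain ⟨a1, a2⟩ := hB.1 _ hc
      exact hP (by rw [h]; exact G_bot a1 a2)
    · rfl
  have h3 : ∑ k ∈ Finset.range (g + 1), (if x = X k then oR k y else 0) = 0 := by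
    apply Finset.sum_eq_zero
    intro k hk
    have hk' : k ≤ g := by have := Finset.mem_range.1 hk; omega
    split_ifs with h
    · by_contra hc
      obtain ⟨a1, a2⟩ := (hR k hk').1 _ hc
      exact hP (by rw [h]; exact L.G_rung hk' a1 a2)
    · rfl
  dsimp only
  rw [h1, h2, h3]; rfl

/-- The closed pieces of the ladder. -/
def piece (g : ℕ) (X : ℕ → ℝ) (p : ℝ → ℝ) (b : ℝ) :
    Fin g ⊕ Fin g ⊕ Fin (g + 1) → Set (ℝ × ℝ)
  | Sum.inl k => {P | X k ≤ P.1 ∧ P.1 ≤ X (k + 1) ∧ P.2 = p (X k) + ((k : ℝ) + 1) * (P.1 - X k)}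
  | Sum.inr (Sum.inl k) =>
    {P | X k ≤ P.1 ∧ P.1 ≤ X (k + 1) ∧ P.2 = b - (p (X k) + ((k : ℝ) + 1) * (P.1 - X k))}
  | Sum.inr (Sum.inr k) => {P | P.1 = X k ∧ b - p (X k) ≤ P.2 ∧ P.2 ≤ p (X k)}

lemma piece_closed (i) : IsClosed (piece g X p b i) := by
  rcases i with k | k | k
  all_goals
    simp only [piece, ofPred_and]
  · refine (isClosed_le ?_ ?_).inter ((isClosed_le ?_ ?_).inter (isClosed_eq ?_ ?_)) <;> fun_prop
  · refine (isClosed_le ?_ ?_).inter ((isClosed_le ?_ ?_).inter (isClosed_eq ?_ ?_)) <;> fun_prop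
  · refine (isClosed_eq ?_ ?_).inter ((isClosed_le ?_ ?_).inter (isClosed_le ?_ ?_)) <;> fun_prop

lemma Lad.cell (L : Lad g X p b) {x : ℝ} (h0 : X 0 ≤ x) (h1 : x ≤ X g) :
    ∃ k, k < g ∧ X k ≤ x ∧ x ≤ X (k + 1) := by
  rcases h1.lt_or_eq with h | h
  · obtain ⟨k, hk, a, c⟩ := L.cellR h0 h; exact ⟨k, hk, a, c.le⟩
  · have h2 := L.g1
    refine ⟨g - 1, by omega, ?_, ?_⟩
    · rw [h]; exact L.sle (by omega) le_rfl
    · rw [h, Nat.sub_add_cancel h2]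

lemma Lad.G_eq (L : Lad g X p b) : G g X p b = ⋃ i, piece g X p b i := by
  ext ⟨x, y⟩
  rw [mem_iUnion]
  constructor
  · rintro ⟨⟨h0, h1⟩, h⟩
    dsimp only at *
    obtain ⟨k, hk, hx, hx'⟩ := L.cell h0 h1
    rcases h with h | h | ⟨⟨k, hk, rfl⟩, h⟩
    · exact ⟨Sum.inl ⟨k, hk⟩, hx, hx', by rw [h]; exact L.lin k hk x hx hx'⟩
    · exact ⟨Sum.inr (Sum.inl ⟨k, hk⟩), hx, hx', by
        dsimp only; rw [h, L.lin k hk x hx hx']⟩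
    · exact ⟨Sum.inr (Sum.inr ⟨k, by omega⟩), rfl, h⟩
  · rintro ⟨k | k | k, h⟩
    · obtain ⟨h1, h2, h3⟩ := h
      dsimp only at *
      rw [h3, ← L.lin k k.2 x h1 h2]
      exact G_top ((L.sle (Nat.zero_le _) k.2.le).trans h1) (h2.trans (L.sle k.2 le_rfl))
    · obtain ⟨h1, h2, h3⟩ := h
      dsimp only at *
      rw [h3, ← L.lin k k.2 x h1 h2]
      exact G_bot ((L.sle (Nat.zero_le _) k.2.le).trans h1) (h2.trans (L.sle k.2 le_rfl))
    · obtain ⟨h1, h2, h3⟩ := h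
      dsimp only at *
      rw [h1]
      exact L.G_rung (by have := k.2; omega) h2 h3

lemma Lad.closed (L : Lad g X p b) : IsClosed (G g X p b) := by
  rw [L.G_eq]; exact isClosed_iUnion_of_finite piece_closed

lemma Lad.ord_off (L : Lad g X p b) (f : ℝ × ℝ → ℝ) {P : ℝ × ℝ} (hP : P ∉ G g X p b) :
    ord (G g X p b) f P = 0 := by
  have : localDirs (G g X p b) P = ∅ := by
    rw [eq_empty_iff_forall_notMem]
    intro v hv
    apply hP
    have h := (mem_localDirs.1 hv).2
    have ht : Tendsto (fun t : ℝ => P + t • vr v) (𝓝[>] 0) (𝓝 P) := by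
      have := Continuous.tendsto (f := fun t : ℝ => P + t • vr v) (by fun_prop) (0 : ℝ)
      simp only [zero_smul, add_zero] at this
      exact this.mono_left nhdsWithin_le_nhds
    exact L.closed.mem_of_tendsto ht h
  unfold ord; rw [this]; simp

lemma Lad.principal_of_desc (L : Lad g X p b) {f : ℝ × ℝ → ℝ} {u d : ℝ → ℝ} {r : ℕ → ℝ → ℝ}
    (H : Desc g X p b f u d r) {oT oB : ℝ →₀ ℤ} {oR : ℕ → ℝ →₀ ℤ}
    (hT : PLf u oT) (hB : PLf d oB) (hR : ∀ k, k ≤ g → PLf (r k) (oR k)) :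
    IsRationalFn (G g X p b) f := by
  refine ⟨?_, fun P hP => (L.ord_formula H hT hB hR P hP).1⟩
  rw [L.G_eq]
  apply LocallyFinite.continuousOn_iUnion (locallyFinite_of_finite _) piece_closed
  rintro (k | k | k)
  · refine ContinuousOn.congr (f := fun P => u P.1) (hT.continuous.comp continuous_fst).continuousOn ?_
    rintro ⟨x, y⟩ ⟨h1, h2, h3⟩
    dsimp only at *
    rw [h3, ← L.lin k k.2 x h1 h2]
    exact H.fu x ((L.sle (Nat.zero_le _) k.2.le).trans h1) (h2.trans (L.sle k.2 le_rfl))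
  · refine ContinuousOn.congr (f := fun P => d P.1) (hB.continuous.comp continuous_fst).continuousOn ?_
    rintro ⟨x, y⟩ ⟨h1, h2, h3⟩
    dsimp only at *
    rw [h3, ← L.lin k k.2 x h1 h2]
    exact H.fd x ((L.sle (Nat.zero_le _) k.2.le).trans h1) (h2.trans (L.sle k.2 le_rfl))
  · have hk : (k : ℕ) ≤ g := by have := k.2; omega
    refine ContinuousOn.congr (f := fun P => r k P.2)
      ((hR k hk).continuous.comp continuous_snd).continuousOn ?_
    rintro ⟨x, y⟩ ⟨h1, h2, h3⟩
    dsimp only at *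
    rw [h1]
    exact H.fr k hk y h2 h3

lemma PLf_of {A B : ℝ} {h : ℝ → ℝ} (_hAB : A ≤ B)
    (hR : ∀ a, A ≤ a → a < B → ∃ r : ℤ, RS h a r)
    (hL : ∀ a, A < a → a ≤ B → ∃ l : ℤ, LS h a l)
    (hA : ∀ x, x ≤ A → h x = h A) (hB : ∀ x, B ≤ x → h x = h B) : ∃ o, PLf h o := by
  have h1 : ∀ a, ∃ r : ℤ, RS h a r := by
    intro a
    rcases lt_or_ge a A with c | c
    · refine ⟨0, ?_⟩
      filter_upwards [ev_lt (sub_pos.2 c)] with t ht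
      rw [hA _ (by linarith), hA _ c.le]; simp
    rcases lt_or_ge a B with c' | c'
    · exact hR a c c'
    · refine ⟨0, ?_⟩
      filter_upwards [ev_pos] with t ht
      rw [hB _ (by linarith), hB _ c']; simp
  have h2 : ∀ a, ∃ r : ℤ, LS h a r := by
    intro a
    rcases lt_or_ge B a with c | c
    · refine ⟨0, ?_⟩
      filter_upwards [ev_lt (sub_pos.2 c)] with t ht
      rw [hB _ (by linarith), hB _ c.le]; simp
    rcases lt_or_ge A a with c' | c'
    · exact hL a c' c
    · refine ⟨0, ?_⟩
      filter_upwards [ev_pos] with t ht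
      rw [hA _ (by linarith), hA _ c']; simp
  choose r hr using h1
  choose l hl using h2
  exact ⟨fun a => r a + l a, fun a => ⟨r a, l a, hr a, hl a, rfl⟩⟩

lemma cl_id {A B x : ℝ} (h : A ≤ x) (h' : x ≤ B) : cl A B x = x := by
  unfold cl; rw [min_eq_left h', max_eq_right h]

lemma cl_lo {A B x : ℝ} (hAB : A ≤ B) (h : x ≤ A) : cl A B x = A := by
  unfold cl; rw [min_eq_left (h.trans hAB), max_eq_left h]

lemma cl_hi {A B x : ℝ} (hAB : A ≤ B) (h : B ≤ x) : cl A B x = B := by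
  unfold cl; rw [min_eq_right h, max_eq_right hAB]

lemma Lad.side_PL (L : Lad g X p b) {f : ℝ × ℝ → ℝ} (hf : IsRationalFn (G g X p b) f)
    (q : ℝ → ℝ) (hq : q = p ∨ q = fun x => b - p x) :
    ∃ o, PLf (fun x => f (cl (X 0) (X g) x, q (cl (X 0) (X g) x))) o := by
  have h0g : X 0 ≤ X g := L.sle (Nat.zero_le _) le_rfl
  have hqG : ∀ x, X 0 ≤ x → x ≤ X g → (x, q x) ∈ G g X p b := by
    intro x h h'
    rcases hq with rfl | rfl
    · exact G_top h h'
    · exact G_bot h h'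
  have key : ∀ a, X 0 ≤ a → a ≤ X g → ∀ σ m : ℤ, (σ = 1 ∨ σ = -1) → Side g X p a σ m →
      ∃ s : ℤ, ∀ᶠ t : ℝ in 𝓝[>] 0, f (a + σ * t, q (a + σ * t)) = f (a, q a) + s * t := by
    intro a h h' σ m hσ hs
    obtain ⟨m', hv, hm'⟩ : ∃ m' : ℤ, (σ, m') ∈ localDirs (G g X p b) (a, q a) ∧
        ∀ᶠ t : ℝ in 𝓝[>] 0, q (a + σ * t) = q a + m' * t := by
      rcases hq with rfl | rfl
      · refine ⟨m, ((L.side_dirs (hqG a h h') hσ hs (σ, m)).2 (Or.inl ⟨rfl, rfl⟩)).1, ?_⟩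
        filter_upwards [hs] with t ht
        exact ht.2.2
      · refine ⟨-m, ((L.side_dirs (hqG a h h') hσ hs (σ, -m)).2 (Or.inr ⟨rfl, rfl⟩)).1, ?_⟩
        filter_upwards [hs] with t ht
        rw [ht.2.2]; push_cast; ring
    obtain ⟨s, hs'⟩ := hf.slope_int _ (hqG a h h') _ hv
    refine ⟨s, ?_⟩
    filter_upwards [ev_of_hasSlope hv hs', hm'] with t e e'
    rw [pt_add] at e
    rw [e', ← e]
    congr 2 <;> ring
  refine PLf_of h0g ?_ ?_ ?_ ?_
  · intro a h h'
    obtain ⟨m, hm⟩ := L.sideR h h'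
    obtain ⟨s, hs⟩ := key a h h'.le 1 m (Or.inl rfl) hm
    refine ⟨s, ?_⟩
    filter_upwards [hs, ev_pos, ev_lt (sub_pos.2 h')] with t e t0 t1
    rw [cl_id (by linarith) (by linarith), cl_id h h'.le, ← e]
    simp
  · intro a h h'
    obtain ⟨m, hm⟩ := L.sideL h h'
    obtain ⟨s, hs⟩ := key a h.le h' (-1) m (Or.inr rfl) hm
    refine ⟨s, ?_⟩
    filter_upwards [hs, ev_pos, ev_lt (sub_pos.2 h)] with t e t0 t1
    rw [cl_id (by linarith) (by linarith), cl_id h.le h', ← e]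
    simp [sub_eq_add_neg]
  · intro x hx
    simp only [cl_lo h0g hx, cl_lo h0g le_rfl]
  · intro x hx
    simp only [cl_hi h0g hx, cl_hi h0g le_rfl]

lemma Lad.rung_PL (L : Lad g X p b) {f : ℝ × ℝ → ℝ} (hf : IsRationalFn (G g X p b) f)
    (k : ℕ) (hk : k ≤ g) :
    ∃ o, PLf (fun y => f (X k, cl (b - p (X k)) (p (X k)) y)) o := by
  have hp := (L.pos (X k) (L.sle (Nat.zero_le _) hk) (L.sle hk le_rfl)).le
  refine PLf_of hp ?_ ?_ ?_ ?_
  · intro a h h'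
    have hP := L.G_rung hk h h'.le
    have hv := ((L.vert_dirs hP (0, 1)).2 ⟨⟨k, hk, rfl⟩, Or.inl ⟨h', rfl⟩⟩).1
    obtain ⟨s, hs⟩ := hf.slope_int _ hP _ hv
    refine ⟨s, ?_⟩
    filter_upwards [ev_of_hasSlope hv hs, ev_pos, ev_lt (sub_pos.2 h')] with t e t0 t1
    rw [cl_id (by linarith) (by linarith), cl_id h h'.le, ← e, pt_add]
    simp
  · intro a h h'
    have hP := L.G_rung hk h.le h'
    have hv := ((L.vert_dirs hP (0, -1)).2 ⟨⟨k, hk, rfl⟩, Or.inr ⟨h, rfl⟩⟩).1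
    obtain ⟨s, hs⟩ := hf.slope_int _ hP _ hv
    refine ⟨s, ?_⟩
    filter_upwards [ev_of_hasSlope hv hs, ev_pos, ev_lt (sub_pos.2 h)] with t e t0 t1
    rw [cl_id (by linarith) (by linarith), cl_id h.le h', ← e, pt_add]
    simp [sub_eq_add_neg]
  · intro x hx
    simp only [cl_lo hp hx, cl_lo hp le_rfl]
  · intro x hx
    simp only [cl_hi hp hx, cl_hi hp le_rfl]

theorem Lad.chain_of_principal (L : Lad g X p b) {D : Div}
    (h : IsPrincipal (G g X p b) D) : Chain g X p b D 0 := by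
  obtain ⟨f, hf, hD⟩ := h
  have h0g : X 0 ≤ X g := L.sle (Nat.zero_le _) le_rfl
  have hp : ∀ k, k ≤ g → b - p (X k) ≤ p (X k) := fun k hk =>
    (L.pos (X k) (L.sle (Nat.zero_le _) hk) (L.sle hk le_rfl)).le
  obtain ⟨o1, h1⟩ := L.side_PL hf p (Or.inl rfl)
  obtain ⟨o2, h2⟩ := L.side_PL hf _ (Or.inr rfl)
  have h3 := fun k => L.rung_PL hf k
  set u := fun x => f (cl (X 0) (X g) x, p (cl (X 0) (X g) x)) with hu
  set d := fun x => f (cl (X 0) (X g) x, b - p (cl (X 0) (X g) x)) with hd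
  set r := fun k y => f (X k, cl (b - p (X k)) (p (X k)) y) with hr
  have H : Desc g X p b f u d r := by
    constructor
    · intro x h h'; simp only [hu, cl_id h h']
    · intro x h h'; simp only [hd, cl_id h h']
    · intro k hk y h h'; simp only [hr, cl_id h h']
    · intro x hx; simp only [hu, cl_lo h0g hx, cl_lo h0g le_rfl]
    · intro x hx; simp only [hu, cl_hi h0g hx, cl_hi h0g le_rfl]
    · intro x hx; simp only [hd, cl_lo h0g hx, cl_lo h0g le_rfl]
    · intro x hx; simp only [hd, cl_hi h0g hx, cl_hi h0g le_rfl]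
    · intro k hk x hx; simp only [hr, cl_lo (hp k hk) hx, cl_lo (hp k hk) le_rfl]
    · intro k hk x hx; simp only [hr, cl_hi (hp k hk) hx, cl_hi (hp k hk) le_rfl]
  obtain ⟨oT, e1, E1, F1⟩ := h1.exists_divisor H.uL H.uR h0g
  obtain ⟨oB, e2, E2, F2⟩ := h2.exists_divisor H.dL H.dR h0g
  have h3' : ∀ k, ∃ O : ℝ →₀ ℤ, k ≤ g → PLf (r k) O ∧ Ed (b - p (X k)) (p (X k)) O ∧
      ∀ x, r k x = r k (b - p (X k)) + pot O x := by
    intro k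
    by_cases hk : k ≤ g
    · obtain ⟨o, ho⟩ := h3 k hk
      obtain ⟨O, e, E, F⟩ := ho.exists_divisor (H.rL k hk) (H.rR k hk) (hp k hk)
      refine ⟨O, fun _ => ⟨?_, E, F⟩⟩
      have : (O : ℝ → ℤ) = o := funext e
      rw [this]; exact ho
    · exact ⟨0, fun h => absurd h hk⟩
  choose oR hoR using h3'
  have e1' : (oT : ℝ → ℤ) = o1 := funext e1
  have e2' : (oB : ℝ → ℤ) = o2 := funext e2
  rw [← e1'] at h1
  rw [← e2'] at h2
  refine ⟨oT, oB, oR, E1, E2, fun k hk => (hoR k hk).2.1, ?_, ?_⟩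
  · intro P
    by_cases hP : P ∈ G g X p b
    · rw [hD P, (L.ord_formula H h1 h2 (fun k hk => (hoR k hk).1) P hP).2]; rfl
    · rw [hD P, L.ord_off f hP, cform_zero_off L E1 E2 (fun k hk => (hoR k hk).2.1) hP]
  · intro j hj
    have a1 := pot_diff E1 (L.lt j hj).le
    have a2 := pot_diff E2 (L.lt j hj).le
    have a3 : ∀ k, k ≤ g → u (X k) = d (X k) - M (fun t => t) (oR k) := by
      intro k hk
      have hx := L.sle (Nat.zero_le _) hk
      have hx' := L.sle hk le_rfl
      rw [← H.fu _ hx hx', ← H.fd _ hx hx', H.fr k hk _ (hp k hk) le_rfl,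
        H.fr k hk _ le_rfl (hp k hk), (hoR k hk).2.2 (p (X k)),
        pot_right (hoR k hk).2.1 le_rfl]
      ring
    have b1 := a3 j hj.le
    have b2 := a3 (j + 1) hj
    have c1 := F1 (X j); have c2 := F1 (X (j + 1))
    have c3 := F2 (X j); have c4 := F2 (X (j + 1))
    unfold hol
    simp only [Pi.zero_apply]
    linarith

theorem Lad.principal_of_chain (L : Lad g X p b) {D : Div}
    (h : Chain g X p b D 0) : IsPrincipal (G g X p b) D := by
  obtain ⟨oT, oB, oR, E1, E2, E3, hD, hz⟩ := h
  have h0g : X 0 ≤ X g := L.sle (Nat.zero_le _) le_rfl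
  have hp : ∀ k, k ≤ g → b - p (X k) < p (X k) := fun k hk =>
    (L.pos (X k) (L.sle (Nat.zero_le _) hk) (L.sle hk le_rfl))
  set C : ℝ := - M (fun t => t) (oR 0) with hC
  set d : ℝ → ℝ := fun x => pot oB x with hd
  set r : ℕ → ℝ → ℝ := fun k y => d (X k) + pot (oR k) y with hr
  set u : ℝ → ℝ := fun x => C + pot oT x with hu
  have cons : ∀ k, k ≤ g → u (X k) = r k (p (X k)) := by
    intro k
    induction k with
    | zero =>
      intro _
      simp only [hu, hr, hd, pot_left E1 le_rfl, pot_left E2 le_rfl,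
        pot_right (E3 0 (Nat.zero_le _)) le_rfl, hC]
      ring
    | succ n ih =>
      intro hn
      have i1 := ih (by omega)
      have i2 := hz n hn
      have a1 := pot_diff E1 (L.lt n hn).le
      have a2 := pot_diff E2 (L.lt n hn).le
      simp only [hu, hr, hd] at i1 ⊢
      rw [pot_right (E3 n (by omega)) le_rfl] at i1
      rw [pot_right (E3 (n + 1) hn) le_rfl]
      unfold hol at i2
      simp only [Pi.zero_apply] at i2
      linarith
  let f : ℝ × ℝ → ℝ := fun P => if P.2 = p P.1 then u P.1 else if P.2 = b - p P.1 then d P.1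
    else ∑ k ∈ Finset.range (g + 1), if P.1 = X k then r k P.2 else 0
  have H : Desc g X p b f u d r := by
    constructor
    · intro x h h'; simp [f]
    · intro x h h'
      have := L.pos x h h'
      simp [f, this.ne]
    · intro k hk y h h'
      simp only [f]
      split_ifs with c c'
      · rw [c]; exact cons k hk
      · rw [c']; simp only [hr]; rw [pot_left (E3 k hk) le_rfl, add_zero]
      · rw [Finset.sum_eq_single k]
        · simp
        · intro m hm hmk
          rw [if_neg]
          intro e
          exact hmk (L.inj (by have := Finset.mem_range.1 hm; omega) hk e.symm)
        · intro hc
          exact absurd (Finset.mem_range.2 (by omega)) hc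
    · intro x hx; simp only [hu, pot_left E1 hx, pot_left E1 le_rfl]
    · intro x hx; simp only [hu, pot_right E1 hx, pot_right E1 le_rfl]
    · intro x hx; simp only [hd, pot_left E2 hx, pot_left E2 le_rfl]
    · intro x hx; simp only [hd, pot_right E2 hx, pot_right E2 le_rfl]
    · intro k hk x hx; simp only [hr, pot_left (E3 k hk) hx, pot_left (E3 k hk) le_rfl]
    · intro k hk x hx; simp only [hr, pot_right (E3 k hk) hx, pot_right (E3 k hk) le_rfl]
  have P1 : PLf u oT := by simpa using (PLf.const C).add (pot_PLf oT)
  have P2 : PLf d oB := pot_PLf oB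
  have P3 : ∀ k, k ≤ g → PLf (r k) (oR k) := fun k _ => by
    simpa using (PLf.const (d (X k))).add (pot_PLf (oR k))
  refine ⟨f, L.principal_of_desc H P1 P2 P3, ?_⟩
  intro P
  by_cases hP : P ∈ G g X p b
  · rw [hD P, (L.ord_formula H P1 P2 P3 P hP).2]; rfl
  · rw [hD P, L.ord_off f hP, cform_zero_off L E1 E2 E3 hP]

end LadderAux
end

section
open scoped BigOperators
open TropicalHyperelliptic
namespace LadderAux
open Filter Topology Set
variable {g : ℕ} {X : ℕ → ℝ} {p : ℝ → ℝ} {b : ℝ}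

lemma cform_add (oT oB oT' oB' : ℝ →₀ ℤ) (oR oR' : ℕ → ℝ →₀ ℤ) (P : ℝ × ℝ) :
    cform g X p b (oT + oT') (oB + oB') (oR + oR') P =
      cform g X p b oT oB oR P + cform g X p b oT' oB' oR' P := by
  unfold cform
  have : ∑ k ∈ Finset.range (g + 1), (if P.1 = X k then (oR + oR') k P.2 else 0) =
      ∑ k ∈ Finset.range (g + 1), (if P.1 = X k then oR k P.2 else 0) +
      ∑ k ∈ Finset.range (g + 1), (if P.1 = X k then oR' k P.2 else 0) := by
    rw [← Finset.sum_add_distrib]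
    apply Finset.sum_congr rfl
    intro k _
    split_ifs <;> simp
  rw [this]
  split_ifs <;> simp <;> ring

lemma cform_neg (oT oB : ℝ →₀ ℤ) (oR : ℕ → ℝ →₀ ℤ) (P : ℝ × ℝ) :
    cform g X p b (-oT) (-oB) (-oR) P = - cform g X p b oT oB oR P := by
  have h := cform_add (g := g) (X := X) (p := p) (b := b) oT oB (-oT) (-oB) oR (-oR) P
  have h0 : cform g X p b 0 0 0 P = 0 := by simp [cform]
  rw [add_neg_cancel, add_neg_cancel, add_neg_cancel, h0] at h
  omega

lemma Chain.congr {D : Div} {z z' : ℕ → ℝ} (h : Chain g X p b D z)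
    (e : ∀ j, j < g → z j = z' j) : Chain g X p b D z' := by
  obtain ⟨oT, oB, oR, h1, h2, h3, h4, h5⟩ := h
  exact ⟨oT, oB, oR, h1, h2, h3, h4, fun j hj => by rw [← e j hj, h5 j hj]⟩

lemma Chain.zero : Chain g X p b 0 0 := by
  refine ⟨0, 0, 0, Ed.zero _ _, Ed.zero _ _, fun k _ => Ed.zero _ _, fun P => ?_, fun j _ => ?_⟩
  · simp [cform]
  · simp [hol, M_zero]

lemma Chain.add {D D' : Div} {z z' : ℕ → ℝ} (h : Chain g X p b D z) (h' : Chain g X p b D' z') :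
    Chain g X p b (D + D') (z + z') := by
  obtain ⟨oT, oB, oR, h1, h2, h3, h4, h5⟩ := h
  obtain ⟨oT', oB', oR', h1', h2', h3', h4', h5'⟩ := h'
  refine ⟨oT + oT', oB + oB', oR + oR', h1.add h1', h2.add h2',
    fun k hk => (h3 k hk).add (h3' k hk), fun P => ?_, fun j hj => ?_⟩
  · rw [cform_add, Finsupp.add_apply, h4, h4']
  · simp only [Pi.add_apply, h5 j hj, h5' j hj, hol, M_add]; ring

lemma Chain.neg {D : Div} {z : ℕ → ℝ} (h : Chain g X p b D z) :
    Chain g X p b (-D) (-z) := by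
  obtain ⟨oT, oB, oR, h1, h2, h3, h4, h5⟩ := h
  refine ⟨-oT, -oB, -oR, h1.neg, h2.neg, fun k hk => (h3 k hk).neg, fun P => ?_, fun j hj => ?_⟩
  · rw [cform_neg, Finsupp.neg_apply, h4]
  · simp only [Pi.neg_apply, h5 j hj, hol, M_neg]; ring

lemma Chain.sub {D D' : Div} {z z' : ℕ → ℝ} (h : Chain g X p b D z) (h' : Chain g X p b D' z') :
    Chain g X p b (D - D') (z - z') := by
  rw [sub_eq_add_neg, sub_eq_add_neg]; exact h.add h'.neg

lemma Chain.sum {ι : Type*} (s : Finset ι) {D : ι → Div} {z : ι → ℕ → ℝ}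
    (h : ∀ i ∈ s, Chain g X p b (D i) (z i)) :
    Chain g X p b (∑ i ∈ s, D i) (∑ i ∈ s, z i) := by
  classical
  induction s using Finset.induction_on with
  | empty => simpa using Chain.zero
  | insert a s ha ih =>
    rw [Finset.sum_insert ha, Finset.sum_insert ha]
    exact (h a (Finset.mem_insert_self _ _)).add
      (ih fun i hi => h i (Finset.mem_insert_of_mem hi))

lemma Chain.nsmul {D : Div} {z : ℕ → ℝ} (h : Chain g X p b D z) (n : ℕ) :
    Chain g X p b (n • D) (n • z) := by
  induction n with
  | zero => simpa using Chain.zero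
  | succ n ih => rw [succ_nsmul, succ_nsmul]; exact ih.add h

lemma Chain.zsmul {D : Div} {z : ℕ → ℝ} (h : Chain g X p b D z) (n : ℤ) :
    Chain g X p b (n • D) (n • z) := by
  obtain ⟨m, rfl | rfl⟩ := n.eq_nat_or_neg
  · rw [natCast_zsmul, natCast_zsmul]; exact h.nsmul m
  · rw [neg_zsmul, neg_zsmul, natCast_zsmul, natCast_zsmul]; exact (h.nsmul m).neg

lemma Lad.cl_cell (L : Lad g X p b) {i j : ℕ} (hi : i < g) (hj : j < g) {x : ℝ}
    (h0 : X j ≤ x) (h1 : x ≤ X (j + 1)) :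
    cl (X i) (X (i + 1)) x = if i = j then x else if i < j then X (i + 1) else X i := by
  have hi' := (L.lt i hi).le
  split_ifs with c c'
  · subst c; exact cl_id h0 h1
  · exact cl_hi hi' ((L.sle c' hj.le).trans h0)
  · exact cl_lo hi' (h1.trans (L.sle (by omega) hi.le))

lemma pair_single (q : ℝ → ℝ) (x : ℝ) (P : ℝ × ℝ) :
    (if P.2 = q P.1 then Finsupp.single x (1 : ℤ) P.1 else 0) =
      (Finsupp.single (x, q x) (1 : ℤ) : Div) P := by
  obtain ⟨a, c⟩ := P
  simp only [Finsupp.single_apply, Prod.mk.injEq]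
  by_cases h : x = a
  · subst h; by_cases h' : c = q x <;> simp [h', eq_comm]
  · simp [h]

lemma Lad.topMove (L : Lad g X p b) {j : ℕ} (hj : j < g) {x y : ℝ} (hx : X j ≤ x)
    (hx' : x ≤ X (j + 1)) (hy : X j ≤ y) (hy' : y ≤ X (j + 1)) :
    Chain g X p b (Finsupp.single (y, p y) 1 - Finsupp.single (x, p x) 1)
      (fun i => if i = j then y - x else 0) := by
  have h0 := L.sle (Nat.zero_le j) hj.le
  have h1 := L.sle (show j + 1 ≤ g from hj) le_rfl
  refine ⟨Finsupp.single y 1 - Finsupp.single x 1, 0, 0,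
    Ed.move ⟨h0.trans hx, hx'.trans h1⟩ ⟨h0.trans hy, hy'.trans h1⟩, Ed.zero _ _,
    fun k _ => Ed.zero _ _, fun P => ?_, fun i hi => ?_⟩
  · simp only [cform, Finsupp.sub_apply, ← pair_single p]
    split_ifs <;> simp
  · simp only [hol, M_sub, M_single, M_zero, Pi.zero_apply, L.cl_cell hi hj hx hx',
      L.cl_cell hi hj hy hy']
    split_ifs <;> simp

lemma Lad.botMove (L : Lad g X p b) {j : ℕ} (hj : j < g) {x y : ℝ} (hx : X j ≤ x)
    (hx' : x ≤ X (j + 1)) (hy : X j ≤ y) (hy' : y ≤ X (j + 1)) :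
    Chain g X p b (Finsupp.single (y, b - p y) 1 - Finsupp.single (x, b - p x) 1)
      (fun i => if i = j then x - y else 0) := by
  have h0 := L.sle (Nat.zero_le j) hj.le
  have h1 := L.sle (show j + 1 ≤ g from hj) le_rfl
  refine ⟨0, Finsupp.single y 1 - Finsupp.single x 1, 0, Ed.zero _ _,
    Ed.move ⟨h0.trans hx, hx'.trans h1⟩ ⟨h0.trans hy, hy'.trans h1⟩,
    fun k _ => Ed.zero _ _, fun P => ?_, fun i hi => ?_⟩
  · simp only [cform, Finsupp.sub_apply, ← pair_single (fun x => b - p x)]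
    split_ifs <;> simp
  · simp only [hol, M_sub, M_single, M_zero, Pi.zero_apply, L.cl_cell hi hj hx hx',
      L.cl_cell hi hj hy hy']
    split_ifs <;> simp

lemma Lad.rungMove (_L : Lad g X p b) {k : ℕ} (hk : k ≤ g) {x y : ℝ} (hx : b - p (X k) ≤ x)
    (hx' : x ≤ p (X k)) (hy : b - p (X k) ≤ y) (hy' : y ≤ p (X k)) :
    Chain g X p b (Finsupp.single (X k, y) 1 - Finsupp.single (X k, x) 1)
      (fun i => (if i = k then y - x else 0) - (if i + 1 = k then y - x else 0)) := by
  refine ⟨0, 0, fun i => if i = k then Finsupp.single y 1 - Finsupp.single x 1 else 0,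
    Ed.zero _ _, Ed.zero _ _, fun i _ => ?_, fun P => ?_, fun i hi => ?_⟩
  · dsimp only
    split_ifs with c
    · subst c; exact Ed.move ⟨hx, hx'⟩ ⟨hy, hy'⟩
    · exact Ed.zero _ _
  · obtain ⟨s, t⟩ := P
    simp only [cform, Finsupp.coe_zero, Pi.zero_apply, ite_self, zero_add]
    rw [Finset.sum_eq_single k]
    · simp only [if_true, Finsupp.sub_apply, Finsupp.single_apply, Prod.mk.injEq]
      by_cases h : s = X k
      · subst h; simp
      · simp [h, Ne.symm h]
    · intro m _ hm
      simp [hm]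
    · intro hc
      exact absurd (Finset.mem_range.2 (by omega)) hc
  · simp only [hol, M_zero]
    split_ifs <;> simp [M_sub, M_single, M_zero]

/-- length of the rung `k` -/
def Rr (X : ℕ → ℝ) (p : ℝ → ℝ) (b : ℝ) (k : ℕ) : ℝ := 2 * p (X k) - b

/-- length of the cell `j` -/
def Wd (X : ℕ → ℝ) (j : ℕ) : ℝ := X (j + 1) - X j

/-- perimeter of the cell `j` -/
def Ln (X : ℕ → ℝ) (p : ℝ → ℝ) (b : ℝ) (j : ℕ) : ℝ := Rr X p b j + 2 * Wd X j + Rr X p b (j + 1)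

/-- the point at arc length `u` on the cell `j` -/
noncomputable def cpos (X : ℕ → ℝ) (p : ℝ → ℝ) (b : ℝ) (j : ℕ) (u : ℝ) : ℝ × ℝ :=
  if u ≤ Rr X p b j then (X j, b - p (X j) + u)
  else if u ≤ Rr X p b j + Wd X j then
    (X j + (u - Rr X p b j), p (X j + (u - Rr X p b j)))
  else if u ≤ Rr X p b j + Wd X j + Rr X p b (j + 1) then
    (X (j + 1), p (X (j + 1)) - (u - Rr X p b j - Wd X j))
  else (X (j + 1) - (u - Rr X p b j - Wd X j - Rr X p b (j + 1)),
    b - p (X (j + 1) - (u - Rr X p b j - Wd X j - Rr X p b (j + 1))))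

/-- amount of motion on the left rung -/
noncomputable def lam (X : ℕ → ℝ) (p : ℝ → ℝ) (b : ℝ) (j : ℕ) (u : ℝ) : ℝ := min u (Rr X p b j)

/-- amount of motion on the right rung -/
noncomputable def rho (X : ℕ → ℝ) (p : ℝ → ℝ) (b : ℝ) (j : ℕ) (u : ℝ) : ℝ :=
  max 0 (min (Rr X p b (j + 1)) (u - Rr X p b j - Wd X j))

lemma Lad.Rr_pos (L : Lad g X p b) {k : ℕ} (hk : k ≤ g) : 0 < Rr X p b k := by
  have := L.pos (X k) (L.sle (Nat.zero_le _) hk) (L.sle hk le_rfl)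
  unfold Rr; linarith

lemma Lad.Wd_pos (L : Lad g X p b) {k : ℕ} (hk : k < g) : 0 < Wd X k := by
  have := L.lt k hk
  unfold Wd; linarith

lemma Lad.Ln_pos (L : Lad g X p b) {k : ℕ} (hk : k < g) : 0 < Ln X p b k := by
  have := L.Wd_pos hk
  have := L.Rr_pos hk.le
  have := L.Rr_pos (show k + 1 ≤ g from hk)
  unfold Ln; linarith

lemma Lad.cpos_zero (L : Lad g X p b) {j : ℕ} (hj : j < g) :
    cpos X p b j 0 = (X j, b - p (X j)) := by
  unfold cpos; rw [if_pos (L.Rr_pos hj.le).le, add_zero]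

lemma Lad.cpos_Ln (L : Lad g X p b) {j : ℕ} (hj : j < g) :
    cpos X p b j (Ln X p b j) = (X j, b - p (X j)) := by
  have h1 := L.Wd_pos hj
  have h2 := L.Rr_pos hj.le
  have h3 := L.Rr_pos (show j + 1 ≤ g from hj)
  unfold cpos
  rw [if_neg (by unfold Ln; linarith), if_neg (by unfold Ln; linarith),
    if_neg (by unfold Ln; linarith)]
  have : X (j + 1) - (Ln X p b j - Rr X p b j - Wd X j - Rr X p b (j + 1)) = X j := by
    unfold Ln Wd; ring
  rw [this]

/-- holonomy of moving a point along the cell `j` -/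
noncomputable def zz (X : ℕ → ℝ) (p : ℝ → ℝ) (b : ℝ) (j : ℕ) (u : ℝ) (i : ℕ) : ℝ :=
  (if i = j then u else 0) - (if i + 1 = j then lam X p b j u else 0)
    - (if i = j + 1 then rho X p b j u else 0)

lemma Lad.chain_cpos (L : Lad g X p b) {j : ℕ} (hj : j < g) {u : ℝ} (h0 : 0 ≤ u)
    (hL : u ≤ Ln X p b j) :
    Chain g X p b (Finsupp.single (cpos X p b j u) 1 - Finsupp.single (X j, b - p (X j)) 1)
      (zz X p b j u) := by
  have h1 := L.Wd_pos hj
  have h2 := L.Rr_pos hj.le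
  have h3 := L.Rr_pos (show j + 1 ≤ g from hj)
  have a2 : b - p (X j) ≤ p (X j) := by unfold Rr at h2; linarith
  have a3 : b - p (X (j + 1)) ≤ p (X (j + 1)) := by unfold Rr at h3; linarith
  have a1 := (L.lt j hj).le
  have e2 : Rr X p b j = 2 * p (X j) - b := rfl
  have e3 : Rr X p b (j + 1) = 2 * p (X (j + 1)) - b := rfl
  have e1 : Wd X j = X (j + 1) - X j := rfl
  have eL : Ln X p b j = Rr X p b j + 2 * Wd X j + Rr X p b (j + 1) := rfl
  have m1 := L.rungMove hj.le le_rfl a2 a2 le_rfl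
  have m2 := L.topMove hj le_rfl a1 a1 le_rfl
  have m3 := L.rungMove (show j + 1 ≤ g from hj) a3 le_rfl le_rfl a3
  unfold cpos zz
  split_ifs with c1 c2 c3
  · have l : lam X p b j u = u := min_eq_left c1
    have r : rho X p b j u = 0 := max_eq_left (min_le_of_right_le (by linarith))
    refine (L.rungMove hj.le le_rfl a2 (y := b - p (X j) + u) (by linarith) (by linarith)).congr ?_
    intro i hi
    rw [l, r]
    simp
  · have l : lam X p b j u = Rr X p b j := min_eq_right (by linarith)
    have r : rho X p b j u = 0 := max_eq_left (min_le_of_right_le (by linarith))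
    have m := m1.add (L.topMove hj le_rfl a1 (y := X j + (u - Rr X p b j)) (by linarith)
      (by linarith))
    rw [add_comm, sub_add_sub_cancel] at m
    refine m.congr ?_
    intro i hi
    simp only [Pi.add_apply]
    rw [l, r, e2]
    split_ifs <;> first | omega | ring
  · have l : lam X p b j u = Rr X p b j := min_eq_right (by linarith)
    have r : rho X p b j u = u - Rr X p b j - Wd X j := by
      unfold rho; rw [min_eq_right (by linarith), max_eq_right (by linarith)]
    have m := (L.rungMove (show j + 1 ≤ g from hj) a3 le_rfl
      (y := p (X (j + 1)) - (u - Rr X p b j - Wd X j)) (by linarith) (by linarith)).add (m2.add m1)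
    rw [sub_add_sub_cancel, sub_add_sub_cancel] at m
    refine m.congr ?_
    intro i hi
    simp only [Pi.add_apply]
    rw [l, r, e2, e1]
    split_ifs <;> first | omega | ring
  · have l : lam X p b j u = Rr X p b j := min_eq_right (by linarith)
    have r : rho X p b j u = Rr X p b (j + 1) := by
      unfold rho; rw [min_eq_left (by linarith), max_eq_right (by linarith)]
    have m := (L.botMove hj a1 le_rfl
      (y := X (j + 1) - (u - Rr X p b j - Wd X j - Rr X p b (j + 1))) (by linarith)
      (by linarith)).add (m3.add (m2.add m1))
    rw [sub_add_sub_cancel, sub_add_sub_cancel, sub_add_sub_cancel] at m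
    refine m.congr ?_
    intro i hi
    simp only [Pi.add_apply]
    rw [l, r, e2, e1, e3]
    split_ifs <;> first | omega | ring

lemma Lad.cpos_mem (L : Lad g X p b) {j : ℕ} (hj : j < g) {u : ℝ} (h0 : 0 ≤ u)
    (hL : u ≤ Ln X p b j) :
    cpos X p b j u ∈ G g X p b ∧ X j ≤ (cpos X p b j u).1 ∧ (cpos X p b j u).1 ≤ X (j + 1) := by
  have e2 : Rr X p b j = 2 * p (X j) - b := rfl
  have e3 : Rr X p b (j + 1) = 2 * p (X (j + 1)) - b := rfl
  have e1 : Wd X j = X (j + 1) - X j := rfl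
  have eL : Ln X p b j = Rr X p b j + 2 * Wd X j + Rr X p b (j + 1) := rfl
  have h1 := L.Wd_pos hj
  have h2 := L.Rr_pos hj.le
  have h3 := L.Rr_pos (show j + 1 ≤ g from hj)
  have b0 := L.sle (Nat.zero_le j) hj.le
  have b1 := L.sle (show j + 1 ≤ g from hj) le_rfl
  unfold cpos
  split_ifs with c1 c2 c3
  · exact ⟨L.G_rung hj.le (by linarith) (by linarith), le_rfl, (L.lt j hj).le⟩
  · exact ⟨G_top (by linarith) (by linarith), by dsimp only; linarith, by dsimp only; linarith⟩
  · exact ⟨L.G_rung hj (by linarith) (by linarith), (L.lt j hj).le, le_rfl⟩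
  · exact ⟨G_bot (by linarith) (by linarith), by dsimp only; linarith, by dsimp only; linarith⟩

lemma Lad.exists_cpos (L : Lad g X p b) {j : ℕ} (hj : j < g) {P : ℝ × ℝ} (hP : P ∈ G g X p b)
    (hl : X j ≤ P.1) (hr : P.1 ≤ X (j + 1)) :
    ∃ u, 0 ≤ u ∧ u < Ln X p b j ∧ cpos X p b j u = P := by
  have e2 : Rr X p b j = 2 * p (X j) - b := rfl
  have e3 : Rr X p b (j + 1) = 2 * p (X (j + 1)) - b := rfl
  have e1 : Wd X j = X (j + 1) - X j := rfl
  have eL : Ln X p b j = Rr X p b j + 2 * Wd X j + Rr X p b (j + 1) := rfl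
  have h1 := L.Wd_pos hj
  have h2 := L.Rr_pos hj.le
  have h3 := L.Rr_pos (show j + 1 ≤ g from hj)
  obtain ⟨x, y⟩ := P
  have hbd := L.G_bd hP
  dsimp only at *
  by_cases c1 : x = X j
  · subst c1
    refine ⟨y - (b - p (X j)), by linarith, by linarith, ?_⟩
    unfold cpos
    rw [if_pos (by linarith)]
    simp
  by_cases c2 : x = X (j + 1)
  · subst c2
    by_cases c3 : y = p (X (j + 1))
    · refine ⟨Rr X p b j + Wd X j, by linarith, by linarith, ?_⟩
      unfold cpos
      rw [if_neg (by linarith), if_pos le_rfl, c3]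
      have : X j + (Rr X p b j + Wd X j - Rr X p b j) = X (j + 1) := by rw [e1]; ring
      rw [this]
    · have c4 : y < p (X (j + 1)) := lt_of_le_of_ne hbd.2 c3
      refine ⟨Rr X p b j + Wd X j + (p (X (j + 1)) - y), by linarith, by linarith, ?_⟩
      unfold cpos
      rw [if_neg (by linarith), if_neg (by linarith), if_pos (by linarith)]
      congr 1; ring
  have c1' := lt_of_le_of_ne hl (Ne.symm c1)
  have c2' := lt_of_le_of_ne hr c2
  rcases hP.2 with h | h | ⟨⟨k, hk, h⟩, -⟩
  · dsimp only at h
    refine ⟨Rr X p b j + (x - X j), by linarith, by linarith, ?_⟩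
    unfold cpos
    rw [if_neg (by linarith), if_pos (by linarith)]
    have : X j + (Rr X p b j + (x - X j) - Rr X p b j) = x := by ring
    rw [this, h]
  · dsimp only at h
    refine ⟨Rr X p b j + Wd X j + Rr X p b (j + 1) + (X (j + 1) - x), by linarith, by linarith, ?_⟩
    unfold cpos
    rw [if_neg (by linarith), if_neg (by linarith), if_neg (by linarith)]
    have : X (j + 1) - (Rr X p b j + Wd X j + Rr X p b (j + 1) + (X (j + 1) - x) - Rr X p b j - Wd X j
      - Rr X p b (j + 1)) = x := by ring
    rw [this, h]
  · exact absurd h (L.not_rung hj c1' c2' k hk)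

lemma Lad.chain_base (L : Lad g X p b) (j : ℕ) (hj : j ≤ g) :
    ∃ z, Chain g X p b (Finsupp.single (X j, b - p (X j)) 1
      - Finsupp.single (X 0, b - p (X 0)) 1) z := by
  induction j with
  | zero => exact ⟨0, by rw [sub_self]; exact Chain.zero⟩
  | succ n ih =>
    obtain ⟨z, hz⟩ := ih (by omega)
    have m := (L.botMove hj le_rfl (L.lt n hj).le (L.lt n hj).le le_rfl).add hz
    rw [sub_add_sub_cancel] at m
    exact ⟨_, m⟩

lemma Lad.chain_pt (L : Lad g X p b) {P : ℝ × ℝ} (hP : P ∈ G g X p b) :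
    ∃ z, Chain g X p b (Finsupp.single P 1 - Finsupp.single (X 0, b - p (X 0)) 1) z := by
  obtain ⟨j, hj, a, c⟩ := L.cell hP.1.1 hP.1.2
  obtain ⟨u, h0, h1, rfl⟩ := L.exists_cpos hj hP a c
  obtain ⟨z, hz⟩ := L.chain_base j hj.le
  have m := (L.chain_cpos hj h0 h1.le).add hz
  rw [sub_add_sub_cancel] at m
  exact ⟨_, m⟩

theorem Lad.exists_chain (L : Lad g X p b) {D : Div} (hD : ∀ P, D P ≠ 0 → P ∈ G g X p b)
    (hdeg : deg D = 0) : ∃ z, Chain g X p b D z := by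
  classical
  have h : ∀ P, ∃ z, P ∈ D.support →
      Chain g X p b (Finsupp.single P 1 - Finsupp.single (X 0, b - p (X 0)) 1) z := by
    intro P
    by_cases hP : P ∈ D.support
    · obtain ⟨z, hz⟩ := L.chain_pt (hD P (Finsupp.mem_support_iff.1 hP))
      exact ⟨z, fun _ => hz⟩
    · exact ⟨0, fun h => absurd h hP⟩
  choose z hz using h
  have m := Chain.sum D.support (D := fun P => D P • (Finsupp.single P 1
    - Finsupp.single (X 0, b - p (X 0)) 1)) (z := fun P => D P • z P)
    (fun P hP => (hz P hP).zsmul (D P))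
  suffices hh : ∑ P ∈ D.support, D P • (Finsupp.single P 1
      - Finsupp.single (X 0, b - p (X 0)) (1 : ℤ)) = D by
    rw [hh] at m; exact ⟨_, m⟩
  simp only [smul_sub, Finset.sum_sub_distrib, ← Finset.sum_smul]
  have e : ∑ i ∈ D.support, D i = 0 := hdeg
  rw [e, zero_smul, sub_zero]
  conv_rhs => rw [← Finsupp.sum_single D]
  unfold Finsupp.sum
  apply Finset.sum_congr rfl
  intro P _
  simp

end LadderAux
end

section
open scoped BigOperators
open TropicalHyperelliptic
namespace LadderAux
open Filter Topology Set
variable {g : ℕ} {X : ℕ → ℝ} {p : ℝ → ℝ} {b : ℝ}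

/-- combination of the motions in all cells -/
noncomputable def comb (g : ℕ) (t a c : ℕ → ℝ) (i : ℕ) : ℝ :=
  t i - (if i + 1 < g then a (i + 1) else 0) - (if 0 < i then c (i - 1) else 0)

lemma sum_comb (t a c : ℕ → ℝ) {i : ℕ} (hi : i < g) :
    ∑ j ∈ Finset.range g, ((if i = j then t j else 0) - (if i + 1 = j then a j else 0)
      - (if i = j + 1 then c j else 0)) = comb g t a c i := by
  rw [Finset.sum_sub_distrib, Finset.sum_sub_distrib, Finset.sum_ite_eq, Finset.sum_ite_eq]
  unfold comb
  have : ∑ j ∈ Finset.range g, (if i = j + 1 then c j else 0) =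
      if 0 < i then c (i - 1) else 0 := by
    split_ifs with h
    · rw [Finset.sum_eq_single (i - 1)]
      · rw [if_pos (by omega)]
      · intro j _ hj; rw [if_neg (by omega)]
      · intro hc; exact absurd (Finset.mem_range.2 (by omega)) hc
    · apply Finset.sum_eq_zero
      intro j _; rw [if_neg (by omega)]
  rw [this]
  simp [hi]

lemma Lad.lam_Ln (L : Lad g X p b) {j : ℕ} (hj : j < g) :
    lam X p b j (Ln X p b j) = Rr X p b j := by
  have h1 := L.Wd_pos hj
  have h3 := L.Rr_pos (show j + 1 ≤ g from hj)
  unfold lam; apply min_eq_right; unfold Ln; linarith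

lemma Lad.rho_Ln (L : Lad g X p b) {j : ℕ} (hj : j < g) :
    rho X p b j (Ln X p b j) = Rr X p b (j + 1) := by
  have h1 := L.Wd_pos hj
  have h3 := L.Rr_pos (show j + 1 ≤ g from hj)
  unfold rho; rw [min_eq_left (by unfold Ln; linarith), max_eq_right h3.le]

theorem Lad.chain_lift (L : Lad g X p b) (u : ℕ → ℝ) (n : ℕ → ℤ)
    (hu : ∀ j, j < g → 0 ≤ u j ∧ u j ≤ Ln X p b j) :
    Chain g X p b (∑ j ∈ Finset.range g, (Finsupp.single (cpos X p b j (u j)) 1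
      - Finsupp.single (X j, b - p (X j)) 1))
      (comb g (fun j => u j + n j * Ln X p b j) (fun j => lam X p b j (u j) + n j * Rr X p b j)
        (fun j => rho X p b j (u j) + n j * Rr X p b (j + 1))) := by
  have m : ∀ j ∈ Finset.range g, Chain g X p b (Finsupp.single (cpos X p b j (u j)) 1
      - Finsupp.single (X j, b - p (X j)) 1)
      (zz X p b j (u j) + n j • zz X p b j (Ln X p b j)) := by
    intro j hj
    have hj := Finset.mem_range.1 hj
    have m2 := (L.chain_cpos hj (L.Ln_pos hj).le le_rfl).zsmul (n j)
    rw [L.cpos_Ln hj, sub_self, smul_zero] at m2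
    have := (L.chain_cpos hj (hu j hj).1 (hu j hj).2).add m2
    rwa [add_zero] at this
  refine (Chain.sum _ m).congr ?_
  intro i hi
  rw [← sum_comb _ _ _ hi, Finset.sum_apply]
  apply Finset.sum_congr rfl
  intro j hj
  have hj := Finset.mem_range.1 hj
  rw [Pi.add_apply, Pi.smul_apply, zsmul_eq_mul]
  simp only [zz, L.lam_Ln hj, L.rho_Ln hj]
  split_ifs <;> first | omega | ring

theorem Lad.lattice (L : Lad g X p b) {z : ℕ → ℝ} (h : Chain g X p b 0 z) :
    ∃ n : ℕ → ℤ, ∀ i, i < g → z i = comb g (fun j => n j * Ln X p b j)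
      (fun j => n j * Rr X p b j) (fun j => n j * Rr X p b (j + 1)) i := by
  obtain ⟨oT, oB, oR, E1, E2, E3, hD, hz⟩ := h
  have hp : ∀ k, k ≤ g → b - p (X k) < p (X k) := fun k hk =>
    (L.pos (X k) (L.sle (Nat.zero_le _) hk) (L.sle hk le_rfl))
  have hcf : ∀ P, cform g X p b oT oB oR P = 0 := fun P => by rw [← hD P]; rfl
  have hsum : ∀ k, k ≤ g → ∀ y, ∑ m ∈ Finset.range (g + 1), (if X k = X m then oR m y else 0)
      = oR k y := by
    intro k hk y
    rw [Finset.sum_eq_single k]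
    · simp
    · intro m hm hmk
      rw [if_neg]
      intro e
      exact hmk (L.inj (by have := Finset.mem_range.1 hm; omega) hk e.symm)
    · intro hc; exact absurd (Finset.mem_range.2 (by omega)) hc
  have c1 : ∀ k, k ≤ g → oT (X k) + oR k (p (X k)) = 0 := by
    intro k hk
    have := hcf (X k, p (X k))
    simpa [cform, hsum k hk, (hp k hk).ne'] using this
  have c2 : ∀ k, k ≤ g → oB (X k) + oR k (b - p (X k)) = 0 := by
    intro k hk
    have := hcf (X k, b - p (X k))
    simpa [cform, hsum k hk, (hp k hk).ne] using this
  have c3 : ∀ k, k ≤ g → ∀ y, y ≠ p (X k) → y ≠ b - p (X k) → oR k y = 0 := by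
    intro k hk y h1 h2
    have := hcf (X k, y)
    simpa [cform, hsum k hk, h1, h2] using this
  have nsum : ∀ x, (∀ k, k ≤ g → x ≠ X k) → ∀ y,
      ∑ m ∈ Finset.range (g + 1), (if x = X m then oR m y else 0) = 0 := by
    intro x hx y
    apply Finset.sum_eq_zero
    intro m hm
    rw [if_neg (hx m (by have := Finset.mem_range.1 hm; omega))]
  have c4 : ∀ x, (∀ k, k ≤ g → x ≠ X k) → oT x = 0 := by
    intro x hx
    by_contra hc
    obtain ⟨a1, a2⟩ := E1.1 x hc
    have := hcf (x, p x)
    simp only [cform, if_true, nsum x hx, if_neg (L.pos x a1 a2).ne'] at this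
    omega
  have c5 : ∀ x, (∀ k, k ≤ g → x ≠ X k) → oB x = 0 := by
    intro x hx
    by_contra hc
    obtain ⟨a1, a2⟩ := E2.1 x hc
    have := hcf (x, b - p x)
    simp only [cform, if_true, nsum x hx, if_neg (L.pos x a1 a2).ne] at this
    omega
  set a : ℕ → ℤ := fun k => oT (X k) with ha
  have eR : ∀ k, k ≤ g → ∃ q : ℤ, oR k = Finsupp.single (p (X k)) (-a k) +
      Finsupp.single (b - p (X k)) q := by
    intro k hk
    refine ⟨oR k (b - p (X k)), ?_⟩
    have h0 : oR k (p (X k)) = - a k := by have := c1 k hk; simp only [ha]; omega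
    ext y
    simp only [Finsupp.add_apply, Finsupp.single_apply]
    by_cases h1 : y = p (X k)
    · subst h1; simp [(hp k hk).ne, h0]
    · by_cases h2 : y = b - p (X k)
      · subst h2; simp [(hp k hk).ne']
      · simp [c3 k hk y h1 h2, Ne.symm h1, Ne.symm h2]
  have eR' : ∀ k, k ≤ g → oR k = Finsupp.single (p (X k)) (-a k) +
      Finsupp.single (b - p (X k)) (a k) := by
    intro k hk
    obtain ⟨q, hq⟩ := eR k hk
    have := (E3 k hk).2
    rw [hq, M_add, M_single, M_single] at this
    have : q = a k := by push_cast at this; have h' : (q : ℝ) = a k := by linarith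
                         exact_mod_cast h'
    rw [hq, this]
  have eMR : ∀ k, k ≤ g → M (fun t => t) (oR k) = - (a k * Rr X p b k) := by
    intro k hk
    rw [eR' k hk, M_add, M_single, M_single]; unfold Rr; push_cast; ring
  have eB : oB = - oT := by
    ext x
    by_cases hx : ∃ k, k ≤ g ∧ x = X k
    · obtain ⟨k, hk, rfl⟩ := hx
      have h1 := c2 k hk
      have h2 : oR k (b - p (X k)) = a k := by
        rw [eR' k hk]
        simp [(hp k hk).ne']
      simp only [Finsupp.neg_apply]
      simp only [ha] at h2
      omega
    · push Not at hx
      simp [c4 x hx, c5 x hx]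
  have eT : oT = ∑ k ∈ Finset.range (g + 1), Finsupp.single (X k) (a k) := by
    ext x
    rw [Finsupp.finsetSum_apply]
    by_cases hx : ∃ k, k ≤ g ∧ x = X k
    · obtain ⟨k, hk, rfl⟩ := hx
      rw [Finset.sum_eq_single k]
      · simp [ha]
      · intro m hm hmk
        rw [Finsupp.single_apply, if_neg]
        intro e
        exact hmk (L.inj (by have := Finset.mem_range.1 hm; omega) hk e)
      · intro hc; exact absurd (Finset.mem_range.2 (by omega)) hc
    · push Not at hx
      rw [c4 x hx, eq_comm]
      apply Finset.sum_eq_zero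
      intro m hm
      rw [Finsupp.single_apply, if_neg (hx m (by have := Finset.mem_range.1 hm; omega)).symm]
  have MT : ∀ w : ℝ → ℝ, M w oT = ∑ k ∈ Finset.range (g + 1), (a k : ℝ) * w (X k) := by
    intro w
    have key : ∀ s : Finset ℕ, M w (∑ k ∈ s, Finsupp.single (X k) (a k)) =
        ∑ k ∈ s, (a k : ℝ) * w (X k) := by
      intro s
      induction s using Finset.induction_on with
      | empty => simp [M_zero]
      | insert i s hi ih => rw [Finset.sum_insert hi, Finset.sum_insert hi, M_add, M_single, ih]
    conv_lhs => rw [eT]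
    exact key _
  have tot : ∑ k ∈ Finset.range (g + 1), (a k : ℝ) = 0 := by
    have := E1.2
    rw [MT] at this
    simpa using this
  have totsplit : ∀ j, j ≤ g → ∑ k ∈ Finset.range (j + 1), (a k : ℝ) =
      - ∑ k ∈ Finset.Ico (j + 1) (g + 1), (a k : ℝ) := by
    intro j hj
    have := Finset.sum_range_add_sum_Ico (fun k => (a k : ℝ)) (show j + 1 ≤ g + 1 by omega)
    linarith
  set n : ℕ → ℤ := fun j => ∑ k ∈ Finset.Ico (j + 1) (g + 1), a k with hn
  have nr : ∀ j, ((n j : ℤ) : ℝ) = ∑ k ∈ Finset.Ico (j + 1) (g + 1), (a k : ℝ) := by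
    intro j; simp [hn]
  have n1 : ∀ j, j < g → (n j : ℝ) = a (j + 1) + n (j + 1) := by
    intro j hj
    rw [nr, nr, Finset.sum_eq_sum_Ico_succ_bot (by omega)]
  have n0 : (n 0 : ℝ) = - a 0 := by
    have := totsplit 0 (Nat.zero_le _)
    rw [nr]; simp at this ⊢; linarith
  have ng : n g = 0 := by simp [hn]
  have MTc : ∀ j, j < g → M (cl (X j) (X (j + 1))) oT = n j * Wd X j := by
    intro j hj
    rw [MT, ← Finset.sum_range_add_sum_Ico _ (show j + 1 ≤ g + 1 by omega)]
    have s1 : ∑ k ∈ Finset.range (j + 1), (a k : ℝ) * cl (X j) (X (j + 1)) (X k) =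
        ∑ k ∈ Finset.range (j + 1), (a k : ℝ) * X j := by
      apply Finset.sum_congr rfl
      intro k hk
      rw [cl_lo (L.lt j hj).le (L.sle (by have := Finset.mem_range.1 hk; omega) hj.le)]
    have s2 : ∑ k ∈ Finset.Ico (j + 1) (g + 1), (a k : ℝ) * cl (X j) (X (j + 1)) (X k) =
        ∑ k ∈ Finset.Ico (j + 1) (g + 1), (a k : ℝ) * X (j + 1) := by
      apply Finset.sum_congr rfl
      intro k hk
      have := Finset.mem_Ico.1 hk
      rw [cl_hi (L.lt j hj).le (L.sle (by omega) (by omega))]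
    rw [s1, s2, ← Finset.sum_mul, ← Finset.sum_mul, totsplit j hj.le, nr]
    unfold Wd; ring
  refine ⟨n, fun i hi => ?_⟩
  rw [hz i hi, hol, eB, M_neg, MTc i hi, eMR i hi.le, eMR (i + 1) hi]
  unfold comb Ln
  have e1 := n1 i hi
  have f1 : (if i + 1 < g then ((n (i + 1) : ℤ) : ℝ) * Rr X p b (i + 1) else 0) =
      n (i + 1) * Rr X p b (i + 1) := by
    split_ifs with c
    · rfl
    · have : i + 1 = g := by omega
      rw [this, ng]; simp
  have f2 : (if 0 < i then ((n (i - 1) : ℤ) : ℝ) * Rr X p b (i - 1 + 1) else 0) =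
      (a i + n i) * Rr X p b i := by
    split_ifs with c
    · rw [Nat.sub_add_cancel c, n1 (i - 1) (by omega), Nat.sub_add_cancel c]
    · have : i = 0 := by omega
      rw [this, n0]; ring
  have e2 : (a (i + 1) : ℝ) = n i - n (i + 1) := by linarith
  rw [f1, f2, e2]; ring

lemma KT {ι : Type*} (T : (ι → ℝ) → (ι → ℝ)) (hT : ∀ s t, s ≤ t → T s ≤ T t) (a c : ι → ℝ)
    (hac : a ≤ c) (ha : a ≤ T a) (hc : T c ≤ c) :
    ∃ t, a ≤ t ∧ T t = t ∧ ∀ s, a ≤ s → T s ≤ s → t ≤ s := by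
  let S : Set (ι → ℝ) := {s | a ≤ s ∧ T s ≤ s}
  let t : ι → ℝ := fun i => sInf ((fun s => s i) '' S)
  have hne : ∀ i, ((fun s : ι → ℝ => s i) '' S).Nonempty := fun i => ⟨_, c, ⟨hac, hc⟩, rfl⟩
  have hle : ∀ s ∈ S, t ≤ s := by
    intro s hs i
    apply csInf_le
    · refine ⟨a i, ?_⟩
      rintro _ ⟨s, hs, rfl⟩
      exact hs.1 i
    · exact ⟨s, hs, rfl⟩
  have hge : ∀ q : ι → ℝ, (∀ s ∈ S, q ≤ s) → q ≤ t := by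
    intro q hq i
    apply le_csInf (hne i)
    rintro _ ⟨s, hs, rfl⟩
    exact hq s hs i
  have hat : a ≤ t := hge a fun s hs => hs.1
  have h1 : T t ≤ t := hge _ fun s hs => (hT _ _ (hle s hs)).trans hs.2
  have h2 : t ≤ T t := hle _ ⟨ha.trans (hT _ _ hat), hT _ _ h1⟩
  exact ⟨t, hat, le_antisymm h1 h2, fun s h h' => hle s ⟨h, h'⟩⟩

end LadderAux
end

section
open scoped BigOperators
open TropicalHyperelliptic
namespace LadderAux
open Filter Topology Set
variable {g : ℕ} {X : ℕ → ℝ} {p : ℝ → ℝ} {b : ℝ}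

/-- winding number -/
noncomputable def wn (X : ℕ → ℝ) (p : ℝ → ℝ) (b : ℝ) (j : ℕ) (t : ℝ) : ℤ := ⌊t / Ln X p b j⌋

/-- reduced position -/
noncomputable def red (X : ℕ → ℝ) (p : ℝ → ℝ) (b : ℝ) (j : ℕ) (t : ℝ) : ℝ :=
  t - wn X p b j t * Ln X p b j

noncomputable def lamZ (X : ℕ → ℝ) (p : ℝ → ℝ) (b : ℝ) (j : ℕ) (t : ℝ) : ℝ :=
  lam X p b j (red X p b j t) + wn X p b j t * Rr X p b j

noncomputable def rhoZ (X : ℕ → ℝ) (p : ℝ → ℝ) (b : ℝ) (j : ℕ) (t : ℝ) : ℝ :=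
  rho X p b j (red X p b j t) + wn X p b j t * Rr X p b (j + 1)

lemma Lad.red_mem (L : Lad g X p b) {j : ℕ} (hj : j < g) (t : ℝ) :
    0 ≤ red X p b j t ∧ red X p b j t < Ln X p b j := by
  have h := L.Ln_pos hj
  have h1 := Int.floor_le (t / Ln X p b j)
  have h2 := Int.lt_floor_add_one (t / Ln X p b j)
  rw [le_div_iff₀ h] at h1
  rw [div_lt_iff₀ h] at h2
  unfold red wn
  constructor <;> linarith

lemma Lad.wn_eq (L : Lad g X p b) {j : ℕ} (hj : j < g) {u : ℝ} (n : ℤ) (h0 : 0 ≤ u)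
    (h1 : u < Ln X p b j) : wn X p b j (u + n * Ln X p b j) = n := by
  have h := L.Ln_pos hj
  unfold wn
  rw [Int.floor_eq_iff, le_div_iff₀ h, div_lt_iff₀ h]
  constructor <;> linarith

lemma Lad.lamZ_eq (L : Lad g X p b) {j : ℕ} (hj : j < g) {u : ℝ} (n : ℤ) (h0 : 0 ≤ u)
    (h1 : u < Ln X p b j) :
    lamZ X p b j (u + n * Ln X p b j) = lam X p b j u + n * Rr X p b j := by
  unfold lamZ red
  rw [L.wn_eq hj n h0 h1, add_sub_cancel_right]

lemma Lad.rhoZ_eq (L : Lad g X p b) {j : ℕ} (hj : j < g) {u : ℝ} (n : ℤ) (h0 : 0 ≤ u)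
    (h1 : u < Ln X p b j) :
    rhoZ X p b j (u + n * Ln X p b j) = rho X p b j u + n * Rr X p b (j + 1) := by
  unfold rhoZ red
  rw [L.wn_eq hj n h0 h1, add_sub_cancel_right]

lemma lam_mono (j : ℕ) {s t : ℝ} (h : s ≤ t) : lam X p b j s ≤ lam X p b j t :=
  min_le_min_right _ h

lemma rho_mono (j : ℕ) {s t : ℝ} (h : s ≤ t) : rho X p b j s ≤ rho X p b j t :=
  max_le_max_left _ (min_le_min_left _ (by linarith))

lemma Lad.lam_bd (L : Lad g X p b) {j : ℕ} (hj : j < g) {u : ℝ} (h0 : 0 ≤ u) :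
    0 ≤ lam X p b j u ∧ lam X p b j u ≤ Rr X p b j :=
  ⟨le_min h0 (L.Rr_pos hj.le).le, min_le_right _ _⟩

lemma Lad.rho_bd (L : Lad g X p b) {j : ℕ} (hj : j < g) (u : ℝ) :
    0 ≤ rho X p b j u ∧ rho X p b j u ≤ Rr X p b (j + 1) :=
  ⟨le_max_left _ _, max_le (L.Rr_pos hj).le (min_le_left _ _)⟩

lemma quasi_mono {f : ℝ → ℝ} {R : ℝ} (hR : 0 ≤ R) (hf : ∀ s t, s ≤ t → f s ≤ f t)
    (hb : ∀ s, 0 ≤ s → 0 ≤ f s ∧ f s ≤ R) {u v : ℝ} (hu : 0 ≤ u) (hv : 0 ≤ v) {n m : ℤ}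
    (hnm : n ≤ m) (huv : n = m → u ≤ v) : f u + n * R ≤ f v + m * R := by
  rcases hnm.eq_or_lt with h | h
  · have := hf u v (huv h)
    rw [h]; linarith
  · have h1 : (n : ℝ) + 1 ≤ m := by exact_mod_cast h
    have := hb u hu
    have := hb v hv
    nlinarith

lemma Lad.wn_mono (L : Lad g X p b) {j : ℕ} (hj : j < g) {s t : ℝ} (h : s ≤ t) :
    wn X p b j s ≤ wn X p b j t :=
  Int.floor_mono (div_le_div_of_nonneg_right h (L.Ln_pos hj).le)

lemma Lad.lamZ_mono (L : Lad g X p b) {j : ℕ} (hj : j < g) {s t : ℝ} (h : s ≤ t) :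
    lamZ X p b j s ≤ lamZ X p b j t := by
  refine quasi_mono (L.Rr_pos hj.le).le (fun _ _ h => lam_mono j h) (fun s hs => L.lam_bd hj hs)
    (L.red_mem hj s).1 (L.red_mem hj t).1 (L.wn_mono hj h) ?_
  intro e
  unfold red; rw [e]; linarith

lemma Lad.rhoZ_mono (L : Lad g X p b) {j : ℕ} (hj : j < g) {s t : ℝ} (h : s ≤ t) :
    rhoZ X p b j s ≤ rhoZ X p b j t := by
  refine quasi_mono (L.Rr_pos hj).le (fun _ _ h => rho_mono j h) (fun s _ => L.rho_bd hj s)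
    (L.red_mem hj s).1 (L.red_mem hj t).1 (L.wn_mono hj h) ?_
  intro e
  unfold red; rw [e]; linarith

/-- both points on the open rung `k` -/
def Bad (X : ℕ → ℝ) (p : ℝ → ℝ) (b : ℝ) (u : ℕ → ℝ) (j : ℕ) : Prop :=
  (0 < u (j + 1) ∧ u (j + 1) < Rr X p b (j + 1)) ∧
    (Rr X p b j + Wd X j < u j ∧ u j < Rr X p b j + Wd X j + Rr X p b (j + 1))

theorem Lad.exists_red (L : Lad g X p b) (z : ℕ → ℝ) :
    ∃ u : ℕ → ℝ, (∀ j, j < g → 0 ≤ u j ∧ u j < Ln X p b j) ∧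
      (∀ j, j + 1 < g → ¬ Bad X p b u j) ∧
      Chain g X p b (∑ j ∈ Finset.range g, (Finsupp.single (cpos X p b j (u j)) 1
      - Finsupp.single (X j, b - p (X j)) 1)) z := by
  classical
  let T : (ℕ → ℝ) → (ℕ → ℝ) := fun s i => if i < g then z i +
    (if i + 1 < g then lamZ X p b (i + 1) (s (i + 1)) else 0)
      + (if 0 < i then rhoZ X p b (i - 1) (s (i - 1)) else 0) else 0
  have hT : ∀ s t, s ≤ t → T s ≤ T t := by
    intro s t h i
    simp only [T]
    split_ifs with h1 h2 h3 h3
    · have a1 := L.lamZ_mono h2 (h (i + 1))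
      have a2 := L.rhoZ_mono (show i - 1 < g by omega) (h (i - 1))
      linarith
    · have a1 := L.lamZ_mono h2 (h (i + 1))
      linarith
    · have a2 := L.rhoZ_mono (show i - 1 < g by omega) (h (i - 1))
      linarith
    · exact le_rfl
    · exact le_rfl
  obtain ⟨N, hN⟩ := exists_nat_gt (∑ i ∈ Finset.range g, |z i| / Wd X i)
  have hNi : ∀ i, i < g → |z i| < N * Wd X i := by
    intro i hi
    rw [← div_lt_iff₀ (L.Wd_pos hi)]
    refine lt_of_le_of_lt ?_ hN
    refine Finset.single_le_sum (f := fun i => |z i| / Wd X i) ?_ (Finset.mem_range.2 hi)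
    intro k hk
    exact div_nonneg (abs_nonneg _) (L.Wd_pos (Finset.mem_range.1 hk)).le
  let a : ℤ → ℕ → ℝ := fun n i => if i < g then (n : ℝ) * Ln X p b i else 0
  have eT : ∀ n : ℤ, ∀ i, i < g → T (a n) i = z i +
      (if i + 1 < g then (n : ℝ) * Rr X p b (i + 1) else 0)
        + (if 0 < i then (n : ℝ) * Rr X p b i else 0) := by
    intro n i hi
    have e1 : ∀ k, k < g → lamZ X p b k (a n k) = n * Rr X p b k := by
      intro k hk
      have h := L.lamZ_eq hk n le_rfl (L.Ln_pos hk)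
      simp only [a, if_pos hk]
      rw [zero_add] at h
      rw [h]; unfold lam; rw [min_eq_left (L.Rr_pos hk.le).le]; ring
    have e2 : ∀ k, k < g → rhoZ X p b k (a n k) = n * Rr X p b (k + 1) := by
      intro k hk
      have h := L.rhoZ_eq hk n le_rfl (L.Ln_pos hk)
      simp only [a, if_pos hk]
      rw [zero_add] at h
      have h1 := L.Rr_pos hk.le
      have h2 := L.Wd_pos hk
      rw [h]; unfold rho; rw [max_eq_left (min_le_of_right_le (by linarith))]; ring
    simp only [T, if_pos hi]
    congr 1
    · split_ifs with c
      · rw [e1 _ c]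
      · rfl
    · split_ifs with c
      · rw [e2 _ (by omega), Nat.sub_add_cancel c]
      · rfl
  have hNpos : (0:ℝ) ≤ N := Nat.cast_nonneg N
  have hlo : ∀ i, i < g → a (-N) i < T (a (-N)) i := by
    intro i hi
    rw [eT _ i hi]
    have h1 := mul_nonneg hNpos (L.Rr_pos hi.le).le
    have h2 := mul_nonneg hNpos (L.Rr_pos (show i + 1 ≤ g from hi)).le
    have h3 := hNi i hi
    have h4 := neg_abs_le (z i)
    have h5 := abs_nonneg (z i)
    simp only [a, if_pos hi, Ln]
    push_cast
    split_ifs <;> linarith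
  have hhi : ∀ i, i < g → T (a N) i ≤ a N i := by
    intro i hi
    rw [eT _ i hi]
    have h1 := mul_nonneg hNpos (L.Rr_pos hi.le).le
    have h2 := mul_nonneg hNpos (L.Rr_pos (show i + 1 ≤ g from hi)).le
    have h3 := hNi i hi
    have h4 := le_abs_self (z i)
    have h5 := abs_nonneg (z i)
    simp only [a, if_pos hi, Ln]
    push_cast
    split_ifs <;> linarith
  have Tout : ∀ s i, ¬ i < g → T s i = 0 := fun s i hi => if_neg hi
  have aout : ∀ n i, ¬ i < g → a n i = 0 := fun n i hi => if_neg hi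
  obtain ⟨t, hat, htt, hmin⟩ := KT T hT (a (-N)) (a N) (by
      intro i
      by_cases hi : i < g
      · have := mul_nonneg hNpos (L.Ln_pos hi).le
        simp only [a, if_pos hi]; push_cast; linarith
      · rw [aout _ _ hi, aout _ _ hi]) (by
      intro i
      by_cases hi : i < g
      · exact (hlo i hi).le
      · rw [aout _ _ hi, Tout _ _ hi]) (by
      intro i
      by_cases hi : i < g
      · exact hhi i hi
      · rw [aout _ _ hi, Tout _ _ hi])
  have hat' : ∀ i, i < g → a (-N) i < t i := by
    intro i hi
    have := hT _ _ hat i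
    rw [htt] at this
    exact (hlo i hi).trans_le this
  refine ⟨fun j => red X p b j (t j), fun j hj => L.red_mem hj (t j), ?_, ?_⟩
  · rintro k hk ⟨⟨b1, b2⟩, b3, b4⟩
    dsimp only at b1 b2 b3 b4
    have hk' : k < g := by omega
    obtain ⟨e, e0, h⟩ : ∃ e : ℝ, 0 < e ∧ (e ≤ red X p b (k + 1) (t (k + 1)) ∧
        e ≤ red X p b k (t k) - (Rr X p b k + Wd X k) ∧ e ≤ t k - a (-N) k ∧
        e ≤ t (k + 1) - a (-N) (k + 1)) := by
      have q1 := hat' k hk'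
      have q2 := hat' (k + 1) hk
      refine ⟨min (min (red X p b (k + 1) (t (k + 1))) (red X p b k (t k) - (Rr X p b k + Wd X k)))
        (min (t k - a (-N) k) (t (k + 1) - a (-N) (k + 1))), ?_, ?_, ?_, ?_, ?_⟩
      · refine lt_min (lt_min b1 (by linarith)) (lt_min (by linarith) (by linarith))
      · exact (min_le_left _ _).trans (min_le_left _ _)
      · exact (min_le_left _ _).trans (min_le_right _ _)
      · exact (min_le_right _ _).trans (min_le_left _ _)
      · exact (min_le_right _ _).trans (min_le_right _ _)
    obtain ⟨d1, d2, d3, d4⟩ := h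
    have p1 := L.Rr_pos hk'.le
    have p2 := L.Wd_pos hk'
    have f1 : lamZ X p b (k + 1) (t (k + 1) - e) = lamZ X p b (k + 1) (t (k + 1)) - e := by
      have m := L.red_mem hk (t (k + 1))
      have q : t (k + 1) - e = (red X p b (k + 1) (t (k + 1)) - e) +
        wn X p b (k + 1) (t (k + 1)) * Ln X p b (k + 1) := by unfold red; ring
      conv_lhs => rw [q]
      rw [L.lamZ_eq hk _ (by linarith) (by linarith)]
      unfold lamZ lam
      rw [min_eq_left (by linarith), min_eq_left (by linarith)]
      ring
    have f2 : rhoZ X p b k (t k - e) = rhoZ X p b k (t k) - e := by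
      have m := L.red_mem hk' (t k)
      have q : t k - e = (red X p b k (t k) - e) +
        wn X p b k (t k) * Ln X p b k := by unfold red; ring
      conv_lhs => rw [q]
      rw [L.rhoZ_eq hk' _ (by linarith) (by linarith)]
      unfold rhoZ rho
      rw [min_eq_right (by linarith), min_eq_right (by linarith), max_eq_right (by linarith),
        max_eq_right (by linarith)]
      ring
    let t' : ℕ → ℝ := fun i => if i = k ∨ i = k + 1 then t i - e else t i
    have ht' : t' ≤ t := by
      intro i
      simp only [t']
      split_ifs <;> linarith
    have hk0 : t' k = t k - e := by simp [t']
    have hk1 : t' (k + 1) = t (k + 1) - e := by simp [t']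
    have key := hmin t' (by
      intro i
      by_cases i1 : i = k
      · subst i1; rw [hk0]; linarith
      by_cases i2 : i = k + 1
      · subst i2; rw [hk1]; linarith
      simp only [t', i1, i2, or_self, if_false]
      exact hat i) (by
      intro i
      by_cases i1 : i = k
      · subst i1
        have e1 := congrFun htt i
        rw [hk0, ← e1]
        simp only [T, if_pos hk', if_pos hk, hk1, f1]
        have : t' (i - 1) = t (i - 1) ∨ i = 0 := by
          by_cases c : i = 0
          · exact Or.inr c
          · left; simp only [t']; rw [if_neg (by omega)]
        rcases this with h | h
        · rw [h]; linarith
        · simp [h]; linarith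
      by_cases i2 : i = k + 1
      · subst i2
        have e1 := congrFun htt (k + 1)
        rw [hk1, ← e1]
        have : t' (k + 1 + 1) = t (k + 1 + 1) := by
          simp only [t']; rw [if_neg (by omega)]
        simp only [T, if_pos hk, this, if_pos (Nat.succ_pos k), Nat.add_sub_cancel, hk0, f2]
        linarith
      have e1 := congrFun htt i
      have e2 := hT _ _ ht' i
      have e3 : t' i = t i := by simp [t', i1, i2]
      rw [e3]; linarith)
    have := key k
    rw [hk0] at this
    linarith
  · refine (L.chain_lift (fun j => red X p b j (t j)) (fun j => wn X p b j (t j))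
      (fun j hj => ⟨(L.red_mem hj (t j)).1, (L.red_mem hj (t j)).2.le⟩)).congr ?_
    intro i hi
    have e1 := congrFun htt i
    simp only [T, if_pos hi] at e1
    unfold comb
    have e2 : red X p b i (t i) + wn X p b i (t i) * Ln X p b i = t i := by unfold red; ring
    dsimp only
    rw [e2]
    unfold lamZ rhoZ at e1
    linarith

end LadderAux
end

section
open scoped BigOperators
open TropicalHyperelliptic
namespace LadderAux
open Filter Topology Set
variable {g : ℕ} {X : ℕ → ℝ} {p : ℝ → ℝ} {b : ℝ}

/-- Scalar comparison on one cycle, ordered case. -/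
theorem scal_le {l w r u v : ℝ} (hl : 0 < l) (hw : 0 < w) (hr : 0 < r) (hu : 0 ≤ u)
    (hv : v < l + 2 * w + r) (huv : u ≤ v) :
    0 ≤ min v l - min u l ∧
    0 ≤ max 0 (min r (v - l - w)) - max 0 (min r (u - l - w)) ∧
    (min v l - min u l) + (max 0 (min r (v - l - w)) - max 0 (min r (u - l - w))) ≤ v - u ∧
    ((min v l - min u l) + (max 0 (min r (v - l - w)) - max 0 (min r (u - l - w))) = v - u →
      u < v → (v ≤ l ∧ min v l - min u l = v - u ∧
          max 0 (min r (v - l - w)) - max 0 (min r (u - l - w)) = 0) ∨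
        (l + w ≤ u ∧ v ≤ l + w + r ∧ min v l - min u l = 0 ∧
          max 0 (min r (v - l - w)) - max 0 (min r (u - l - w)) = v - u)) := by
  rcases min_cases v l with ⟨a1, a2⟩ | ⟨a1, a2⟩ <;>
  rcases min_cases u l with ⟨b1, b2⟩ | ⟨b1, b2⟩ <;>
  rcases min_cases r (v - l - w) with ⟨c1, c2⟩ | ⟨c1, c2⟩ <;>
  rcases min_cases r (u - l - w) with ⟨d1, d2⟩ | ⟨d1, d2⟩ <;>
  rcases max_cases 0 (min r (v - l - w)) with ⟨e1, e2⟩ | ⟨e1, e2⟩ <;>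
  rcases max_cases 0 (min r (u - l - w)) with ⟨f1, f2⟩ | ⟨f1, f2⟩ <;>
  rw [a1, b1, e1, f1] <;> (try rw [c1] at e2 ⊢) <;> (try rw [d1] at f2 ⊢) <;>
  first
  | (exfalso; linarith)
  | (refine ⟨by linarith, by linarith, by linarith, ?_⟩
     intro h1 h2
     first
     | (exfalso; linarith)
     | (left; refine ⟨by linarith, by linarith, by linarith⟩)
     | (right; refine ⟨by linarith, by linarith, by linarith, by linarith⟩))

/-- Scalar comparison, positive winding difference. -/
theorem scal_pos {l w r u v m : ℝ} (hl : 0 < l) (hw : 0 < w) (hr : 0 < r) (hu : 0 ≤ u)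
    (hv0 : 0 ≤ v) (hul : u < l + 2 * w + r)
    (hv : v < l + 2 * w + r) (hm : 1 ≤ m) :
    0 ≤ min v l - min u l + m * l ∧
    0 ≤ max 0 (min r (v - l - w)) - max 0 (min r (u - l - w)) + m * r ∧
    (min v l - min u l + m * l) +
      (max 0 (min r (v - l - w)) - max 0 (min r (u - l - w)) + m * r)
      < v - u + m * (l + 2 * w + r) := by
  have i1 : l ≤ m * l := by nlinarith
  have i2 : r ≤ m * r := by nlinarith
  have i3 : w ≤ m * w := by nlinarith
  have i4 : m * (l + 2 * w + r) = m * l + 2 * (m * w) + m * r := by ring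
  rw [i4]
  have q1 : 0 ≤ min v l := le_min hv0 hl.le
  have q2 : min u l ≤ l := min_le_right _ _
  have q3 : 0 ≤ max 0 (min r (v - l - w)) := le_max_left _ _
  have q4 : max 0 (min r (u - l - w)) ≤ r := max_le hr.le (min_le_left _ _)
  refine ⟨by linarith, by linarith, ?_⟩
  have k1 : min v l + max 0 (min r (v - l - w)) ≤ v := by
    rcases min_cases v l with ⟨a1, a2⟩ | ⟨a1, a2⟩ <;>
    rcases min_cases r (v - l - w) with ⟨c1, c2⟩ | ⟨c1, c2⟩ <;>
    rcases max_cases 0 (min r (v - l - w)) with ⟨e1, e2⟩ | ⟨e1, e2⟩ <;>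
    rw [a1, e1] <;> (try rw [c1] at e2 ⊢) <;> linarith
  have k2 : u - min u l - max 0 (min r (u - l - w)) < 2 * w := by
    rcases min_cases u l with ⟨a1, a2⟩ | ⟨a1, a2⟩ <;>
    rcases min_cases r (u - l - w) with ⟨c1, c2⟩ | ⟨c1, c2⟩ <;>
    rcases max_cases 0 (min r (u - l - w)) with ⟨e1, e2⟩ | ⟨e1, e2⟩ <;>
    rw [a1, e1] <;> (try rw [c1] at e2 ⊢) <;> linarith
  linarith

theorem scal {l w r u v : ℝ} (hl : 0 < l) (hw : 0 < w) (hr : 0 < r) (hu : 0 ≤ u)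
    (hv0 : 0 ≤ v) (hul : u < l + 2 * w + r)
    (hv : v < l + 2 * w + r) (n : ℤ) {δ la rh : ℝ}
    (hδ : δ = v - u - n * (l + 2 * w + r)) (hla : la = min v l - min u l - n * l)
    (hrh : rh = max 0 (min r (v - l - w)) - max 0 (min r (u - l - w)) - n * r) :
    |la| + |rh| ≤ |δ| ∧ (δ = 0 → u = v) ∧
    (|la| + |rh| = |δ| → δ ≠ 0 →
      (u ≤ l ∧ v ≤ l ∧ δ = v - u ∧ la = δ ∧ rh = 0) ∨
      (l + w ≤ u ∧ u ≤ l + w + r ∧ l + w ≤ v ∧ v ≤ l + w + r ∧ δ = v - u ∧ la = 0 ∧ rh = δ)) := by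
  rcases lt_trichotomy n 0 with hn | hn | hn
  · have hn' : (1 : ℝ) ≤ -(n : ℝ) := by
      have : n ≤ -1 := by omega
      have : (n : ℝ) ≤ -1 := by exact_mod_cast this
      linarith
    obtain ⟨h1, h2, h3⟩ := scal_pos hl hw hr hu hv0 hul hv hn'
    have a1 : 0 ≤ la := by linarith
    have a2 : 0 ≤ rh := by linarith
    have a3 : la + rh < δ := by linarith
    rw [abs_of_nonneg a1, abs_of_nonneg a2, abs_of_nonneg (by linarith)]
    exact ⟨a3.le, fun h => by linarith, fun h => by linarith⟩
  · subst hn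
    simp only [Int.cast_zero, zero_mul, sub_zero] at hδ hla hrh
    rcases le_total u v with h | h
    · obtain ⟨h1, h2, h3, h4⟩ := scal_le hl hw hr hu hv h
      rw [← hla] at h1
      rw [← hrh] at h2
      rw [← hla, ← hrh, ← hδ] at h3 h4
      rw [abs_of_nonneg h1, abs_of_nonneg h2, abs_of_nonneg (by linarith)]
      refine ⟨h3, fun h => by linarith, fun e ne => ?_⟩
      have : u < v := lt_of_le_of_ne h (fun h => ne (by linarith))
      rcases h4 e this with ⟨k1, k2, k3⟩ | ⟨k1, k2, k3, k4⟩
      · left; exact ⟨by linarith, k1, hδ, k2, k3⟩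
      · right; exact ⟨k1, by linarith, by linarith, k2, hδ, k3, k4⟩
    · obtain ⟨h1, h2, h3, h4⟩ := scal_le hl hw hr hv0 hul h
      have e1 : min u l - min v l = -la := by linarith
      have e2 : max 0 (min r (u - l - w)) - max 0 (min r (v - l - w)) = -rh := by linarith
      have e3 : u - v = -δ := by linarith
      rw [e1] at h1
      rw [e2] at h2
      rw [e1, e2, e3] at h3 h4
      rw [abs_of_nonpos (by linarith), abs_of_nonpos (by linarith), abs_of_nonpos (by linarith)]
      refine ⟨h3, fun h => by linarith, fun e ne => ?_⟩
      have : v < u := lt_of_le_of_ne h (fun h => ne (by linarith))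
      rcases h4 e this with ⟨k1, k2, k3⟩ | ⟨k1, k2, k3, k4⟩
      · left; exact ⟨by linarith, by linarith, by linarith, by linarith, by linarith⟩
      · right
        exact ⟨by linarith, by linarith, by linarith, by linarith, by linarith, by linarith,
          by linarith⟩
  · have hn' : (1 : ℝ) ≤ (n : ℝ) := by exact_mod_cast hn
    obtain ⟨h1, h2, h3⟩ := scal_pos hl hw hr hv0 hu hv hul hn'
    have a1 : la ≤ 0 := by linarith
    have a2 : rh ≤ 0 := by linarith
    have a3 : δ < la + rh := by linarith
    rw [abs_of_nonpos a1, abs_of_nonpos a2, abs_of_nonpos (by linarith)]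
    exact ⟨by linarith, fun h => by linarith, fun h => by linarith⟩

/-- Re-indexing of the two neighbour sums. -/
theorem shift_sum (A C : ℕ → ℝ) (g : ℕ) :
    ∑ i ∈ Finset.range g, ((if i + 1 < g then A (i + 1) else 0) + (if 0 < i then C (i - 1) else 0))
    = ∑ j ∈ Finset.range g, ((if 0 < j then A j else 0) + (if j + 1 < g then C j else 0)) := by
  cases g with
  | zero => simp
  | succ n =>
    rw [Finset.sum_add_distrib, Finset.sum_add_distrib]
    rw [Finset.sum_range_succ, Finset.sum_range_succ' (fun i => if 0 < i then C (i - 1) else 0),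
      Finset.sum_range_succ' (fun i => if 0 < i then A i else 0),
      Finset.sum_range_succ (fun i => if i + 1 < n + 1 then C i else 0)]
    simp only [lt_irrefl, if_false, add_zero, Nat.succ_pos, if_true, Nat.add_sub_cancel]
    congr 1
    · refine Finset.sum_congr rfl fun i hi => ?_
      rw [if_pos (by have := Finset.mem_range.1 hi; omega)]
    · refine Finset.sum_congr rfl fun i hi => ?_
      rw [if_pos (by have := Finset.mem_range.1 hi; omega)]

theorem ite_abs (P : Prop) [Decidable P] (x : ℝ) : |if P then x else 0| = if P then |x| else 0 := by
  split_ifs <;> simp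

theorem l1_tight {d la rh : ℕ → ℝ} (h1 : ∀ j < g, |la j| + |rh j| ≤ |d j|)
    (h2 : ∀ i < g, d i = (if i + 1 < g then la (i + 1) else 0) + (if 0 < i then rh (i - 1) else 0)) :
    ∀ j < g, |d j| = (if 0 < j then |la j| else 0) + (if j + 1 < g then |rh j| else 0) ∧
      |d j| = (if j + 1 < g then |la (j + 1)| else 0) + (if 0 < j then |rh (j - 1)| else 0) := by
  have a1 : ∀ j ∈ Finset.range g,
      (if 0 < j then |la j| else 0) + (if j + 1 < g then |rh j| else 0) ≤ |d j| := by
    intro j hj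
    have := h1 j (Finset.mem_range.1 hj)
    have := abs_nonneg (la j)
    have := abs_nonneg (rh j)
    split_ifs <;> linarith
  have a2 : ∀ j ∈ Finset.range g,
      |d j| ≤ (if j + 1 < g then |la (j + 1)| else 0) + (if 0 < j then |rh (j - 1)| else 0) := by
    intro j hj
    have := h2 j (Finset.mem_range.1 hj)
    rw [← ite_abs, ← ite_abs, this]
    exact abs_add_le _ _
  have s1 := Finset.sum_le_sum a1
  have s2 := Finset.sum_le_sum a2
  rw [shift_sum (fun i => |la i|) (fun i => |rh i|)] at s2
  have e1 := (Finset.sum_eq_sum_iff_of_le a1).1 (le_antisymm s1 s2)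
  have e2 := (Finset.sum_eq_sum_iff_of_le a2).1
    (by rw [shift_sum (fun i => |la i|) (fun i => |rh i|)]; exact le_antisymm s2 s1)
  intro j hj
  exact ⟨(e1 j (Finset.mem_range.2 hj)).symm, e2 j (Finset.mem_range.2 hj)⟩

/-- Combinatorial classification of the nonzero differences. -/
theorem pairing {d la rh : ℕ → ℝ} (h1 : ∀ j < g, |la j| + |rh j| ≤ |d j|)
    (h2 : ∀ i < g, d i = (if i + 1 < g then la (i + 1) else 0) + (if 0 < i then rh (i - 1) else 0))
    (h3 : ∀ j < g, |la j| + |rh j| = |d j| → d j ≠ 0 →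
      (la j = d j ∧ rh j = 0) ∨ (la j = 0 ∧ rh j = d j)) :
    (∀ j < g, d j ≠ 0 → |la j| + |rh j| = |d j| ∧
      ((0 < j ∧ la j = d j ∧ rh j = 0) ∨ (j + 1 < g ∧ la j = 0 ∧ rh j = d j))) ∧
    (∀ j < g, d j ≠ 0 → rh j = d j → j + 1 < g ∧ la (j + 1) = d (j + 1) ∧ d (j + 1) = d j) ∧
    (∀ j < g, d j ≠ 0 → la j = d j → 0 < j ∧ rh (j - 1) = d (j - 1) ∧ d (j - 1) ≠ 0) := by
  have T := l1_tight h1 h2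
  have t0 : ∀ j < g, d j ≠ 0 → |la j| + |rh j| = |d j| ∧
      ((0 < j ∧ la j = d j ∧ rh j = 0) ∨ (j + 1 < g ∧ la j = 0 ∧ rh j = d j)) := by
    intro j hj ne
    have p0 := abs_pos.2 ne
    have e := (T j hj).1
    have i1 := h1 j hj
    have := abs_nonneg (la j)
    have := abs_nonneg (rh j)
    have e' : |la j| + |rh j| = |d j| := by split_ifs at e <;> linarith
    refine ⟨e', ?_⟩
    rcases h3 j hj e' ne with ⟨a, c⟩ | ⟨a, c⟩
    · left
      refine ⟨?_, a, c⟩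
      by_contra hc
      rw [if_neg hc, c] at e
      simp at e
      exact ne e
    · right
      refine ⟨?_, a, c⟩
      by_contra hc
      rw [if_neg hc, a] at e
      simp at e
      exact ne e
  have tR : ∀ k j, j + k = g → 0 < k → d j ≠ 0 → rh j = d j →
      j + 1 < g ∧ d (j + 1) ≠ 0 ∧ la (j + 1) = d (j + 1) := by
    intro k
    induction k with
    | zero => intro j _ h; omega
    | succ k ih =>
      intro j hjk _ ne hr
      have hj : j < g := by omega
      have hp := abs_pos.2 ne
      rcases (t0 j hj ne).2 with ⟨a1, a2, a3⟩ | ⟨a1, a2, a3⟩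
      · rw [hr] at a3; exact absurd a3 ne
      have e := (T (j + 1) a1).2
      rw [if_pos (Nat.succ_pos j), Nat.add_sub_cancel, hr] at e
      have e0 : 0 ≤ (if j + 1 + 1 < g then |la (j + 1 + 1)| else 0) := by
        split_ifs
        · exact abs_nonneg _
        · exact le_rfl
      have ne1 : d (j + 1) ≠ 0 := abs_pos.1 (by linarith)
      refine ⟨a1, ne1, ?_⟩
      rcases (t0 (j + 1) a1 ne1).2 with ⟨b1, b2, b3⟩ | ⟨b1, b2, b3⟩
      · exact b2
      obtain ⟨c1, c2, c3⟩ := ih (j + 1) (by omega) (by omega) ne1 b3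
      have f := (T (j + 1 + 1) c1).2
      rw [if_pos (Nat.succ_pos _), Nat.add_sub_cancel, b3] at f
      have f0 : 0 ≤ (if j + 1 + 1 + 1 < g then |la (j + 1 + 1 + 1)| else 0) := by
        split_ifs
        · exact abs_nonneg _
        · exact le_rfl
      rw [if_pos c1, c3] at e
      linarith
  have tL : ∀ j < g, d j ≠ 0 → la j = d j →
      0 < j ∧ rh (j - 1) = d (j - 1) ∧ d (j - 1) ≠ 0 := by
    intro j
    induction j with
    | zero =>
      intro hj ne hl
      rcases (t0 0 hj ne).2 with ⟨a1, a2, a3⟩ | ⟨a1, a2, a3⟩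
      · omega
      · rw [hl] at a2; exact absurd a2 ne
    | succ j ih =>
      intro hj ne hl
      rw [Nat.add_sub_cancel]
      have hj' : j < g := by omega
      have hp := abs_pos.2 ne
      have e := (T j hj').2
      rw [if_pos hj, hl] at e
      have e0 : 0 ≤ (if 0 < j then |rh (j - 1)| else 0) := by
        split_ifs
        · exact abs_nonneg _
        · exact le_rfl
      have ne1 : d j ≠ 0 := abs_pos.1 (by linarith)
      refine ⟨Nat.succ_pos _, ?_, ne1⟩
      rcases (t0 j hj' ne1).2 with ⟨b1, b2, b3⟩ | ⟨b1, b2, b3⟩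
      · exfalso
        obtain ⟨c1, c2, c3⟩ := ih hj' ne1 b2
        have f := (T (j - 1) (by omega)).2
        have q : j - 1 + 1 = j := by omega
        rw [q, if_pos hj', b2] at f
        have f0 : 0 ≤ (if 0 < j - 1 then |rh (j - 1 - 1)| else 0) := by
          split_ifs
          · exact abs_nonneg _
          · exact le_rfl
        rw [if_pos c1, c2] at e
        linarith
      · exact b3
  refine ⟨t0, ?_, tL⟩
  intro j hj ne hr
  obtain ⟨a1, a2, a3⟩ := tR (g - j) j (by omega) (by omega) ne hr
  refine ⟨a1, a3, ?_⟩
  have e := h2 (j + 1) a1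
  rw [if_pos (Nat.succ_pos j), Nat.add_sub_cancel, hr] at e
  have : (if j + 1 + 1 < g then la (j + 1 + 1) else 0) = 0 := by
    split_ifs with hc
    · by_contra hne
      have : d (j + 1 + 1) ≠ 0 := by
        intro h0
        have i1 := h1 _ hc
        rw [h0, abs_zero] at i1
        have := abs_nonneg (rh (j + 1 + 1))
        have := abs_pos.2 hne
        linarith
      rcases (t0 _ hc this).2 with ⟨b1, b2, b3⟩ | ⟨b1, b2, b3⟩
      · obtain ⟨c1, c2, c3⟩ := tL _ hc this b2
        rw [Nat.add_sub_cancel] at c2 c3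
        rcases (t0 _ a1 a2).2 with ⟨q1, q2, q3⟩ | ⟨q1, q2, q3⟩
        · rw [c2] at q3; exact c3 q3
        · rw [a3] at q2; exact c3 q2
      · exact hne b2
    · rfl
  rw [this, zero_add] at e
  exact e

theorem Lad.cpos_right (L : Lad g X p b) {j : ℕ} (hj : j < g) {u : ℝ}
    (h1 : Rr X p b j + Wd X j ≤ u) (h2 : u ≤ Rr X p b j + Wd X j + Rr X p b (j + 1)) :
    cpos X p b j u = (X (j + 1), p (X (j + 1)) - (u - Rr X p b j - Wd X j)) := by
  have hw := L.Wd_pos hj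
  unfold cpos
  rw [if_neg (by linarith)]
  split_ifs with h3
  · have e : u = Rr X p b j + Wd X j := le_antisymm h3 h1
    have e2 : X j + (u - Rr X p b j) = X (j + 1) := by rw [e]; unfold Wd; ring
    rw [e2, e]; ext <;> simp
  · rfl

theorem Lad.cpos_left (L : Lad g X p b) {j : ℕ} {u : ℝ}
    (h2 : u ≤ Rr X p b j) :
    cpos X p b j u = (X j, b - p (X j) + u) := by
  unfold cpos
  rw [if_pos h2]

/-- Uniqueness of the reduced representative. -/
theorem Lad.unique_red (L : Lad g X p b) (u v : ℕ → ℝ)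
    (hu : ∀ j < g, 0 ≤ u j ∧ u j < Ln X p b j) (hv : ∀ j < g, 0 ≤ v j ∧ v j < Ln X p b j)
    (bu : ∀ j, j + 1 < g → ¬ Bad X p b u j) (bv : ∀ j, j + 1 < g → ¬ Bad X p b v j)
    (hc : Chain g X p b (∑ j ∈ Finset.range g, Finsupp.single (cpos X p b j (v j)) (1 : ℤ) -
      ∑ j ∈ Finset.range g, Finsupp.single (cpos X p b j (u j)) (1 : ℤ)) 0) :
    ∑ j ∈ Finset.range g, Finsupp.single (cpos X p b j (u j)) (1 : ℤ) =
      ∑ j ∈ Finset.range g, Finsupp.single (cpos X p b j (v j)) (1 : ℤ) := by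
  have cu := L.chain_lift u (fun _ => 0) (fun j hj => ⟨(hu j hj).1, (hu j hj).2.le⟩)
  have cv := L.chain_lift v (fun _ => 0) (fun j hj => ⟨(hv j hj).1, (hv j hj).2.le⟩)
  have hh := (cv.sub cu).sub hc
  have hD : (∑ j ∈ Finset.range g, (Finsupp.single (cpos X p b j (v j)) (1 : ℤ) -
        Finsupp.single (X j, b - p (X j)) 1) -
      ∑ j ∈ Finset.range g, (Finsupp.single (cpos X p b j (u j)) (1 : ℤ) -
        Finsupp.single (X j, b - p (X j)) 1)) -
      (∑ j ∈ Finset.range g, Finsupp.single (cpos X p b j (v j)) (1 : ℤ) -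
      ∑ j ∈ Finset.range g, Finsupp.single (cpos X p b j (u j)) (1 : ℤ)) = 0 := by
    rw [Finset.sum_sub_distrib, Finset.sum_sub_distrib]; abel
  rw [hD] at hh
  obtain ⟨n, hn⟩ := L.lattice hh
  let d : ℕ → ℝ := fun j => v j - u j - n j * (Rr X p b j + 2 * Wd X j + Rr X p b (j + 1))
  let la : ℕ → ℝ := fun j => min (v j) (Rr X p b j) - min (u j) (Rr X p b j) - n j * Rr X p b j
  let rh : ℕ → ℝ := fun j => max 0 (min (Rr X p b (j + 1)) (v j - Rr X p b j - Wd X j)) -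
    max 0 (min (Rr X p b (j + 1)) (u j - Rr X p b j - Wd X j)) - n j * Rr X p b (j + 1)
  have S : ∀ j, j < g → _ := fun j hj => scal (L.Rr_pos hj.le) (L.Wd_pos hj) (L.Rr_pos hj)
    (hu j hj).1 (hv j hj).1 (hu j hj).2 (hv j hj).2 (n j) (δ := d j) (la := la j) (rh := rh j)
    rfl rfl rfl
  have h2 : ∀ i < g, d i = (if i + 1 < g then la (i + 1) else 0) +
      (if 0 < i then rh (i - 1) else 0) := by
    intro i hi
    have := hn i hi
    simp only [Pi.sub_apply, Pi.zero_apply, comb, lam, rho, Ln, Int.cast_zero, zero_mul,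
      add_zero, sub_zero] at this
    simp only [d, la, rh]
    split_ifs at this ⊢ <;> linarith
  obtain ⟨t0, tR, tL⟩ := pairing (fun j hj => (S j hj).1) h2 (fun j hj e ne => by
    rcases (S j hj).2.2 e ne with ⟨_, _, _, a, c⟩ | ⟨_, _, _, _, _, a, c⟩
    · exact Or.inl ⟨a, c⟩
    · exact Or.inr ⟨a, c⟩)
  classical
  let A : ℕ → Div := fun j => Finsupp.single (cpos X p b j (u j)) (1 : ℤ) -
    Finsupp.single (cpos X p b j (v j)) (1 : ℤ)
  let h : ℕ → Div := fun j => if d j ≠ 0 ∧ rh j = d j then A j else 0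
  have A0 : ∀ j < g, d j = 0 → A j = 0 := by
    intro j hj e
    have := (S j hj).2.1 e
    simp only [A, this, sub_self]
  have pair : ∀ j < g, d j ≠ 0 → rh j = d j → A j + A (j + 1) = 0 := by
    intro j hj ne hr
    obtain ⟨a1, a2, a3⟩ := tR j hj ne hr
    have ne1 : d (j + 1) ≠ 0 := by rw [a3]; exact ne
    have hR := L.Rr_pos a1.le
    rcases (S j hj).2.2 (t0 j hj ne).1 ne with ⟨_, _, _, _, c⟩ | ⟨p1, p2, p3, p4, p5, _, _⟩
    · rw [hr] at c; exact absurd c ne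
    rcases (S (j + 1) a1).2.2 (t0 _ a1 ne1).1 ne1 with ⟨q1, q2, q3, _, _⟩ | ⟨_, _, _, _, _, c, _⟩
    swap
    · rw [a2] at c; exact absurd c ne1
    have nu := bu j a1
    have nv := bv j a1
    unfold Bad at nu nv
    have u0 := (hu _ a1).1
    have v0 := (hv _ a1).1
    have key : u j - Rr X p b j - Wd X j + v (j + 1) = Rr X p b (j + 1) := by
      have nu' : (u (j + 1) ≤ 0 ∨ Rr X p b (j + 1) ≤ u (j + 1)) ∨
          (u j ≤ Rr X p b j + Wd X j ∨ Rr X p b j + Wd X j + Rr X p b (j + 1) ≤ u j) := by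
        by_contra hcon
        push Not at hcon
        exact nu ⟨⟨hcon.1.1, hcon.1.2⟩, ⟨hcon.2.1, hcon.2.2⟩⟩
      have nv' : (v (j + 1) ≤ 0 ∨ Rr X p b (j + 1) ≤ v (j + 1)) ∨
          (v j ≤ Rr X p b j + Wd X j ∨ Rr X p b j + Wd X j + Rr X p b (j + 1) ≤ v j) := by
        by_contra hcon
        push Not at hcon
        exact nv ⟨⟨hcon.1.1, hcon.1.2⟩, ⟨hcon.2.1, hcon.2.2⟩⟩
      rcases lt_or_gt_of_ne ne with hlt | hlt <;>
      rcases nu' with (h1 | h1) | (h1 | h1) <;> rcases nv' with (h2 | h2) | (h2 | h2) <;>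
        linarith
    have e1 : cpos X p b j (u j) = cpos X p b (j + 1) (v (j + 1)) := by
      rw [L.cpos_right hj p1 p2, L.cpos_left q2]
      have : Rr X p b (j + 1) = 2 * p (X (j + 1)) - b := rfl
      ext <;> simp <;> linarith
    have e2 : cpos X p b j (v j) = cpos X p b (j + 1) (u (j + 1)) := by
      rw [L.cpos_right hj p3 p4, L.cpos_left q1]
      have : Rr X p b (j + 1) = 2 * p (X (j + 1)) - b := rfl
      ext <;> simp <;> linarith
    simp only [A, e1, e2]
    abel
  have main : ∀ m < g, ∑ j ∈ Finset.range (m + 1), A j = h m := by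
    intro m
    induction m with
    | zero =>
      intro hm
      rw [Finset.sum_range_one]
      simp only [h]
      split_ifs with hc
      · rfl
      · by_cases ne : d 0 = 0
        · exact A0 0 hm ne
        · rcases (t0 0 hm ne).2 with ⟨a, _, _⟩ | ⟨_, _, a⟩
          · omega
          · exact absurd ⟨ne, a⟩ hc
    | succ m ih =>
      intro hm
      rw [Finset.sum_range_succ, ih (by omega)]
      by_cases hr : d m ≠ 0 ∧ rh m = d m
      · obtain ⟨a1, a2, a3⟩ := tR m (by omega) hr.1 hr.2
        have : ¬ (d (m + 1) ≠ 0 ∧ rh (m + 1) = d (m + 1)) := by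
          rintro ⟨ne, e⟩
          rcases (t0 _ hm ne).2 with ⟨_, _, q⟩ | ⟨_, q, _⟩
          · rw [e] at q; exact ne q
          · rw [a2] at q; exact ne q
        simp only [h, if_pos hr, if_neg this]
        exact pair m (by omega) hr.1 hr.2
      · simp only [h, if_neg hr, zero_add]
        split_ifs with hc
        · rfl
        · by_cases ne : d (m + 1) = 0
          · exact A0 _ hm ne
          · rcases (t0 _ hm ne).2 with ⟨_, a, _⟩ | ⟨_, _, a⟩
            · obtain ⟨_, c2, c3⟩ := tL _ hm ne a
              exact absurd ⟨c3, c2⟩ hr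
            · exact absurd ⟨ne, a⟩ hc
  have g1 := L.g1
  have fin := main (g - 1) (by omega)
  have q : g - 1 + 1 = g := by omega
  rw [q] at fin
  have : ¬ (d (g - 1) ≠ 0 ∧ rh (g - 1) = d (g - 1)) := by
    rintro ⟨ne, e⟩
    have := (tR (g - 1) (by omega) ne e).1
    omega
  simp only [h, if_neg this] at fin
  rw [← sub_eq_zero, ← Finset.sum_sub_distrib]
  exact fin

end LadderAux
end

section
open scoped BigOperators
open TropicalHyperelliptic
namespace LadderAux
open Filter Topology Set

/-- The abscissas of the vertical edges. -/
noncomputable def XX (c : ℤ → ℝ) (k : ℕ) : ℝ := c (k : ℤ) - c ((k : ℤ) + 1)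

variable {g : ℕ} {c : ℤ → ℝ}

theorem XX_lt (hc : Hyp g c) {k : ℕ} (hk : k < g) : XX c k < XX c (k + 1) := by
  obtain ⟨h1, h2, h3, h4, h5⟩ := hc
  unfold XX
  push_cast
  have e : (k : ℤ) + 1 + 1 = (k : ℤ) + 2 := by ring
  rw [e]
  by_cases h : k + 2 ≤ g
  · have := h4 k (by omega)
    linarith
  · have hk' : g = k + 1 := by omega
    subst hk'
    push_cast at h1 h2 h5
    rw [e] at h1
    have e3 : (k : ℤ) + 1 - 1 = k := by ring
    rw [e3] at h5
    linarith

theorem XX_le (hc : Hyp g c) {i j : ℕ} (hij : i ≤ j) (hj : j ≤ g) : XX c i ≤ XX c j := by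
  induction j, hij using Nat.le_induction with
  | base => exact le_rfl
  | succ j hij ih => exact (ih (by omega)).trans (XX_lt hc (by omega)).le

theorem XX_g (hc : Hyp g c) : XX c g = 0 := by
  unfold XX
  rw [hc.1, hc.2.1]; ring

theorem le_Ptilde {i : ℕ} (hi : i ≤ g + 1) (x : ℝ) : c i + (i : ℝ) * x ≤ Ptilde g c x := by
  unfold Ptilde
  exact Finset.le_sup' (fun i : ℕ => c (i : ℤ) + (i : ℝ) * x) (Finset.mem_range.2 (by omega))

theorem Pmax {m : ℕ} (hm : m ≤ g + 1) {x : ℝ} (h1 : ∀ i < m, XX c i ≤ x)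
    (h2 : ∀ i, m ≤ i → i ≤ g → x ≤ XX c i) : Ptilde g c x = c m + (m : ℝ) * x := by
  apply le_antisymm _ (le_Ptilde hm x)
  unfold Ptilde
  apply Finset.sup'_le
  intro i hi
  have hi' : i ≤ g + 1 := by have := Finset.mem_range.1 hi; omega
  rcases le_total m i with h | h
  · clear hi
    induction i, h using Nat.le_induction with
    | base => exact le_rfl
    | succ j hj ih =>
      have := ih (by omega)
      have := h2 j hj (by omega)
      unfold XX at this
      push_cast
      linarith
  · clear hi hi' h2
    revert h1 hm
    induction m, h using Nat.le_induction with
    | base => intro _ _; exact le_rfl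
    | succ j hj ih =>
      intro hm h1
      have := ih (by omega) (fun i hi => h1 i (by omega))
      have := h1 j (by omega)
      unfold XX at this
      push_cast
      linarith

theorem Ptilde_cont : Continuous (Ptilde g c) := by
  unfold Ptilde
  apply Continuous.finset_sup'_apply
  intro i _
  fun_prop

theorem b_lt (hc : Hyp g c) (x : ℝ) : c (-1) - Ptilde g c x < Ptilde g c x := by
  have h := le_Ptilde (g := g) (c := c) (i := 0) (by omega) x
  have := hc.2.2.1
  simp at h
  linarith

theorem lad (hg : 1 ≤ g) (hc : Hyp g c) : Lad g (XX c) (Ptilde g c) (c (-1)) where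
  g1 := hg
  lt := fun k hk => XX_lt hc hk
  lin := by
    intro k hk
    have key : ∀ x, XX c k ≤ x → x ≤ XX c (k + 1) →
        Ptilde g c x = c ((k + 1 : ℕ) : ℤ) + ((k + 1 : ℕ) : ℝ) * x := by
      intro x h1 h2
      apply Pmax (by omega)
      · intro i hi; exact (XX_le hc (by omega) (by omega)).trans h1
      · intro i hi hi'; exact h2.trans (XX_le hc hi hi')
    intro x h1 h2
    rw [key x h1 h2, key _ le_rfl (XX_lt hc hk).le]
    push_cast
    ring
  pos := fun x _ _ => b_lt hc x

theorem kink {h : ℝ → ℝ} {a a' : ℝ} (hd : DifferentiableAt ℝ h 0)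
    (h1 : ∀ᶠ t in 𝓝 (0 : ℝ), 0 ≤ t → h t = h 0 + a * t)
    (h2 : ∀ᶠ t in 𝓝 (0 : ℝ), t ≤ 0 → h t = h 0 + a' * t) : a = a' := by
  have d := hd.hasDerivAt
  have lin : ∀ q : ℝ, HasDerivAt (fun t => h 0 + q * t) q 0 := by
    intro q
    have := ((hasDerivAt_id (0 : ℝ)).const_mul q).const_add (h 0)
    simpa using this
  have r1 : HasDerivWithinAt h a (Ici 0) 0 := by
    apply (lin a).hasDerivWithinAt.congr_of_eventuallyEq
    · filter_upwards [nhdsWithin_le_nhds h1, self_mem_nhdsWithin] with t ht ht'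
      exact ht ht'
    · simp
  have r2 : HasDerivWithinAt h a' (Iic 0) 0 := by
    apply (lin a').hasDerivWithinAt.congr_of_eventuallyEq
    · filter_upwards [nhdsWithin_le_nhds h2, self_mem_nhdsWithin] with t ht ht'
      exact ht ht'
    · simp
  have e1 := (uniqueDiffWithinAt_Ici (0 : ℝ)).eq_deriv _ r1 d.hasDerivWithinAt
  have e2 := (uniqueDiffWithinAt_Iic (0 : ℝ)).eq_deriv _ r2 d.hasDerivWithinAt
  rw [e1, e2]

theorem Ftilde_line {P : ℝ × ℝ} (hd : DifferentiableAt ℝ (Ftilde g c) P) (w : ℝ × ℝ) :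
    DifferentiableAt ℝ (fun t : ℝ => Ftilde g c (P + t • w)) 0 := by
  have : DifferentiableAt ℝ (Ftilde g c) (P + (0 : ℝ) • w) := by simpa using hd
  exact DifferentiableAt.comp (0 : ℝ) (g := Ftilde g c) (f := fun t : ℝ => P + t • w)
    this (by fun_prop)

theorem nd_top (hc : Hyp g c) (x : ℝ) :
    ¬ DifferentiableAt ℝ (Ftilde g c) (x, Ptilde g c x) := by
  intro hd
  have := b_lt hc x
  have hk := kink (a := 2) (a' := 1) (Ftilde_line hd (0, 1))
  have e0 : Ftilde g c (x, Ptilde g c x) = 2 * Ptilde g c x := by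
    unfold Ftilde
    dsimp only
    rw [max_eq_left]
    apply max_le <;> linarith
  simp only [zero_smul, add_zero, e0] at hk
  have := hk (by
    filter_upwards [] with t ht
    simp only [Ftilde, Prod.smul_mk, Prod.mk_add_mk, smul_eq_mul, mul_zero, mul_one, add_zero]
    rw [max_eq_left]
    · ring
    · apply max_le <;> linarith) (by
    have : ∀ᶠ t in 𝓝 (0 : ℝ), c (-1) - 2 * Ptilde g c x < t := lt_mem_nhds (by linarith)
    filter_upwards [this] with t h1 ht
    simp only [Ftilde, Prod.smul_mk, Prod.mk_add_mk, smul_eq_mul, mul_zero, mul_one, add_zero]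
    rw [max_eq_right, max_eq_left]
    · ring
    · linarith
    · exact le_max_of_le_left (by linarith))
  norm_num at this

theorem nd_bot (hc : Hyp g c) (x : ℝ) :
    ¬ DifferentiableAt ℝ (Ftilde g c) (x, c (-1) - Ptilde g c x) := by
  intro hd
  have := b_lt hc x
  have hk := kink (a := 1) (a' := 0) (Ftilde_line hd (0, 1))
  have e0 : Ftilde g c (x, c (-1) - Ptilde g c x) = c (-1) := by
    unfold Ftilde
    dsimp only
    rw [max_eq_right, max_eq_right]
    · linarith
    · exact le_max_of_le_right (by linarith)
  simp only [zero_smul, add_zero, e0] at hk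
  have := hk (by
    have : ∀ᶠ t in 𝓝 (0 : ℝ), t < 2 * Ptilde g c x - c (-1) := gt_mem_nhds (by linarith)
    filter_upwards [this] with t h1 ht
    simp only [Ftilde, Prod.smul_mk, Prod.mk_add_mk, smul_eq_mul, mul_zero, mul_one, add_zero]
    rw [max_eq_right, max_eq_left]
    · ring
    · linarith
    · exact le_max_of_le_left (by linarith)) (by
    filter_upwards [] with t ht
    simp only [Ftilde, Prod.smul_mk, Prod.mk_add_mk, smul_eq_mul, mul_zero, mul_one, add_zero]
    rw [max_eq_right, max_eq_right]
    · ring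
    · linarith
    · exact le_max_of_le_right (by linarith))
  norm_num at this

theorem mid_ev {P : ℝ × ℝ} (h1 : c (-1) - Ptilde g c P.1 < P.2) (h2 : P.2 < Ptilde g c P.1) :
    ∀ᶠ Q in 𝓝 P, Ftilde g c Q = Q.2 + Ptilde g c Q.1 := by
  have c0 : Continuous (fun Q : ℝ × ℝ => Ptilde g c Q.1) := Ptilde_cont.comp continuous_fst
  have a1 : ∀ᶠ Q : ℝ × ℝ in 𝓝 P, c (-1) - Ptilde g c Q.1 < Q.2 :=
    (isOpen_lt (continuous_const.sub c0) continuous_snd).mem_nhds h1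
  have a2 : ∀ᶠ Q : ℝ × ℝ in 𝓝 P, Q.2 < Ptilde g c Q.1 :=
    (isOpen_lt continuous_snd c0).mem_nhds h2
  filter_upwards [a1, a2] with Q q1 q2
  unfold Ftilde
  rw [max_eq_right, max_eq_left]
  · linarith
  · exact le_max_of_le_left (by linarith)

theorem nd_rung (hc : Hyp g c) {k : ℕ} (hk : k ≤ g) {y : ℝ}
    (h1 : c (-1) - Ptilde g c (XX c k) < y) (h2 : y < Ptilde g c (XX c k)) :
    ¬ DifferentiableAt ℝ (Ftilde g c) (XX c k, y) := by
  intro hd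
  have hkk := kink (a := ((k + 1 : ℕ) : ℝ)) (a' := k) (Ftilde_line hd (1, 0))
  have ev := mid_ev (P := (XX c k, y)) h1 h2
  have ct : Tendsto (fun t : ℝ => ((XX c k, y) : ℝ × ℝ) + t • ((1, 0) : ℝ × ℝ)) (𝓝 0)
      (𝓝 (XX c k, y)) := by
    have : Continuous (fun t : ℝ => ((XX c k, y) : ℝ × ℝ) + t • ((1, 0) : ℝ × ℝ)) := by fun_prop
    simpa using this.tendsto 0
  have ev' := ct.eventually ev
  have e0 := ev.self_of_nhds
  simp only [zero_smul, add_zero, e0] at hkk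
  have pk : ∀ x, (∀ i < k, XX c i ≤ x) → x ≤ XX c k → Ptilde g c x = c k + k * x := by
    intro x q1 q2
    exact Pmax (by omega) q1 (fun i i1 i2 => q2.trans (XX_le hc i1 i2))
  have p0 : Ptilde g c (XX c k) = c k + k * XX c k :=
    pk _ (fun i hi => XX_le hc hi.le hk) le_rfl
  have ce : c ((k : ℤ) + 1) = c k - XX c k := by unfold XX; ring
  have := hkk (by
    have r : ∀ᶠ t in 𝓝 (0 : ℝ), k + 1 ≤ g → t < XX c (k + 1) - XX c k := by
      by_cases h : k + 1 ≤ g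
      · have : ∀ᶠ t in 𝓝 (0 : ℝ), t < XX c (k + 1) - XX c k :=
          gt_mem_nhds (by linarith [XX_lt hc h])
        filter_upwards [this] with t ht _ using ht
      · exact Eventually.of_forall fun t h' => absurd h' h
    filter_upwards [ev', r] with t e1 e2 ht
    rw [e1]
    simp only [Prod.smul_mk, Prod.mk_add_mk, smul_eq_mul, mul_zero, mul_one, add_zero]
    rw [p0, Pmax (m := k + 1) (by omega)]
    · push_cast; rw [ce]; ring
    · intro i hi
      have := XX_le hc (show i ≤ k by omega) hk
      linarith
    · intro i i1 i2
      have := e2 (by omega)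
      have := XX_le hc i1 i2
      linarith) (by
    have r : ∀ᶠ t in 𝓝 (0 : ℝ), 1 ≤ k → XX c (k - 1) - XX c k < t := by
      by_cases h : 1 ≤ k
      · have : ∀ᶠ t in 𝓝 (0 : ℝ), XX c (k - 1) - XX c k < t := by
          apply lt_mem_nhds
          have := XX_lt hc (show k - 1 < g by omega)
          rw [show k - 1 + 1 = k by omega] at this
          linarith
        filter_upwards [this] with t ht _ using ht
      · exact Eventually.of_forall fun t h' => absurd h' h
    filter_upwards [ev', r] with t e1 e2 ht
    rw [e1]
    simp only [Prod.smul_mk, Prod.mk_add_mk, smul_eq_mul, mul_zero, mul_one, add_zero]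
    rw [p0, pk]
    · ring
    · intro i hi
      have := e2 (by omega)
      have := XX_le hc (show i ≤ k - 1 by omega) (by omega)
      linarith
    · linarith)
  push_cast at this
  linarith

theorem d_out {P : ℝ × ℝ} (hc : Hyp g c)
    (h : Ptilde g c P.1 < P.2 ∨ P.2 < c (-1) - Ptilde g c P.1) :
    DifferentiableAt ℝ (Ftilde g c) P := by
  have c0 : Continuous (fun Q : ℝ × ℝ => Ptilde g c Q.1) := Ptilde_cont.comp continuous_fst
  rcases h with h | h
  · have a2 : ∀ᶠ Q : ℝ × ℝ in 𝓝 P, Ptilde g c Q.1 < Q.2 :=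
      (isOpen_lt c0 continuous_snd).mem_nhds h
    have e : Ftilde g c =ᶠ[𝓝 P] fun Q => 2 * Q.2 := by
      filter_upwards [a2] with Q q
      have := b_lt hc Q.1
      unfold Ftilde
      rw [max_eq_left]
      apply max_le <;> linarith
    exact DifferentiableAt.congr_of_eventuallyEq (by fun_prop) e
  · have a2 : ∀ᶠ Q : ℝ × ℝ in 𝓝 P, Q.2 < c (-1) - Ptilde g c Q.1 :=
      (isOpen_lt continuous_snd (continuous_const.sub c0)).mem_nhds h
    have e : Ftilde g c =ᶠ[𝓝 P] fun Q => c (-1) := by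
      filter_upwards [a2] with Q q
      have := b_lt hc Q.1
      unfold Ftilde
      rw [max_eq_right, max_eq_right]
      · linarith
      · exact le_max_of_le_right (by linarith)
    exact DifferentiableAt.congr_of_eventuallyEq (by fun_prop) e

theorem d_mid {P : ℝ × ℝ} (hc : Hyp g c) {k : ℕ} (hk : k < g) (x1 : XX c k < P.1)
    (x2 : P.1 < XX c (k + 1)) (h1 : c (-1) - Ptilde g c P.1 < P.2) (h2 : P.2 < Ptilde g c P.1) :
    DifferentiableAt ℝ (Ftilde g c) P := by
  have ev := mid_ev h1 h2
  have a1 : ∀ᶠ Q : ℝ × ℝ in 𝓝 P, XX c k < Q.1 :=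
    (isOpen_lt continuous_const continuous_fst).mem_nhds x1
  have a2 : ∀ᶠ Q : ℝ × ℝ in 𝓝 P, Q.1 < XX c (k + 1) :=
    (isOpen_lt continuous_fst continuous_const).mem_nhds x2
  have e : Ftilde g c =ᶠ[𝓝 P] fun Q => Q.2 + (c ((k + 1 : ℕ) : ℤ) + ((k + 1 : ℕ) : ℝ) * Q.1) := by
    filter_upwards [ev, a1, a2] with Q e q1 q2
    rw [e, Pmax (m := k + 1) (by omega)]
    · intro i hi
      exact (XX_le hc (by omega) (by omega)).trans q1.le
    · intro i i1 i2
      exact q2.le.trans (XX_le hc i1 i2)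
  exact DifferentiableAt.congr_of_eventuallyEq (by fun_prop) e

theorem Gam_eq (hg : 1 ≤ g) (hc : Hyp g c) :
    Gam g c = G g (XX c) (Ptilde g c) (c (-1)) := by
  have L := lad hg hc
  have x0 : XX c 0 = c 0 - c 1 := by unfold XX; simp
  have xg := XX_g hc
  ext ⟨x, y⟩
  constructor
  · rintro ⟨nd, hx0, hxg⟩
    dsimp only at hx0 hxg
    rw [← x0] at hx0
    rw [← xg] at hxg
    refine ⟨⟨hx0, hxg⟩, ?_⟩
    by_contra hcon
    push Not at hcon
    obtain ⟨n1, n2, n3⟩ := hcon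
    dsimp only at n1 n2 n3
    apply nd
    by_cases o : Ptilde g c x < y ∨ y < c (-1) - Ptilde g c x
    · exact d_out hc o
    push Not at o
    have y1 : y < Ptilde g c x := lt_of_le_of_ne o.1 n1
    have y2 : c (-1) - Ptilde g c x < y := lt_of_le_of_ne o.2 (Ne.symm n2)
    obtain ⟨k, hk, k1, k2⟩ := L.cell hx0 hxg
    have k1' : XX c k < x := by
      refine lt_of_le_of_ne k1 fun e => ?_
      have := n3 ⟨k, hk.le, e.symm⟩ y2.le
      linarith
    have k2' : x < XX c (k + 1) := by
      refine lt_of_le_of_ne k2 fun e => ?_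
      have := n3 ⟨k + 1, hk, e⟩ y2.le
      linarith
    exact d_mid hc hk k1' k2' y2 y1
  · rintro ⟨⟨hx0, hxg⟩, h⟩
    dsimp only at hx0 hxg h
    refine ⟨?_, by rw [← x0]; exact hx0, by rw [← xg]; exact hxg⟩
    show ¬ DifferentiableAt ℝ (Ftilde g c) (x, y)
    rcases h with rfl | rfl | ⟨⟨k, hk, rfl⟩, h1, h2⟩
    · exact nd_top hc x
    · exact nd_bot hc x
    · rcases h1.lt_or_eq with h1 | rfl
      · rcases h2.lt_or_eq with h2 | rfl
        · exact nd_rung hc hk h1 h2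
        · exact nd_top hc _
      · exact nd_bot hc _

theorem V_eq (hc : Hyp g c) {k : ℕ} (hk : k ≤ g) :
    V g c (g - k) = (XX c k, Ptilde g c (XX c k)) := by
  have e : ((g - k : ℕ) : ℤ) = (g : ℤ) - k := by omega
  have p0 : Ptilde g c (XX c k) = c k + k * XX c k :=
    Pmax (by omega) (fun i hi => XX_le hc hi.le hk) (fun i i1 i2 => XX_le hc i1 i2)
  unfold V
  rw [p0, e]
  have e2 : (g : ℤ) - ((g : ℤ) - k) = k := by ring
  rw [e2]
  unfold XX
  ext
  · rfl
  · push_cast; ring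

end LadderAux
end

section
open scoped BigOperators
open TropicalHyperelliptic
namespace LadderAux
open Filter Topology Set

section
variable {g : ℕ} {X : ℕ → ℝ} {p : ℝ → ℝ} {b : ℝ}

theorem Lad.open_left (L : Lad g X p b) {j : ℕ} (hj : j < g) {u : ℝ} (h0 : 0 ≤ u)
    (hL : u < Ln X p b j) : ((cpos X p b j u).1 = X j ∧ b - p (X j) < (cpos X p b j u).2 ∧
      (cpos X p b j u).2 < p (X j)) ↔ 0 < u ∧ u < Rr X p b j := by
  have hw := L.Wd_pos hj
  have hr := L.Rr_pos (show j + 1 ≤ g from hj)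
  have hR : Rr X p b j = 2 * p (X j) - b := rfl
  have hW : Wd X j = X (j + 1) - X j := rfl
  unfold Ln at hL
  constructor
  · rintro ⟨h1, h2, h3⟩
    unfold cpos at h1 h2 h3
    split_ifs at h1 h2 h3 with q1 q2 q3 <;> dsimp only at h1 h2 h3
    · constructor <;> linarith
    · linarith
    · linarith
    · linarith
  · rintro ⟨h1, h2⟩
    rw [L.cpos_left h2.le]
    dsimp only
    exact ⟨rfl, by linarith, by linarith⟩

theorem Lad.open_right (L : Lad g X p b) {j : ℕ} (hj : j < g) {u : ℝ} (h0 : 0 ≤ u) :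
    ((cpos X p b j u).1 = X (j + 1) ∧ b - p (X (j + 1)) < (cpos X p b j u).2 ∧
      (cpos X p b j u).2 < p (X (j + 1))) ↔
      Rr X p b j + Wd X j < u ∧ u < Rr X p b j + Wd X j + Rr X p b (j + 1) := by
  have hw := L.Wd_pos hj
  have hr := L.Rr_pos (show j + 1 ≤ g from hj)
  have hR : Rr X p b (j + 1) = 2 * p (X (j + 1)) - b := rfl
  have hW : Wd X j = X (j + 1) - X j := rfl
  constructor
  · rintro ⟨h1, h2, h3⟩
    unfold cpos at h1 h2 h3
    split_ifs at h1 h2 h3 with q1 q2 q3 <;> dsimp only at h1 h2 h3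
    · linarith
    · rw [h1] at h3; linarith
    · constructor <;> linarith
    · linarith
  · rintro ⟨h1, h2⟩
    rw [L.cpos_right hj h1.le h2.le]
    dsimp only
    exact ⟨rfl, by linarith, by linarith⟩

end

variable {g : ℕ} {c : ℤ → ℝ}

theorem alphaCycle_eq (hg : 1 ≤ g) (hc : Hyp g c) {j : ℕ} (hj : j < g) :
    alphaCycle g c (g - 1 - j + 1) =
      {P | P ∈ G g (XX c) (Ptilde g c) (c (-1)) ∧ XX c j ≤ P.1 ∧ P.1 ≤ XX c (j + 1)} := by
  unfold alphaCycle
  rw [Gam_eq hg hc, Nat.add_sub_cancel]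
  have e1 : g - 1 - j + 1 = g - j := by omega
  have e2 : g - 1 - j = g - (j + 1) := by omega
  rw [e1, e2, V_eq hc hj.le, V_eq hc hj]

theorem mem_alphaOpen (hg : 1 ≤ g) (hc : Hyp g c) {m : ℕ} (hm : m ≤ g) (P : ℝ × ℝ) :
    P ∈ alphaOpen g c (g - m) ↔ P.1 = XX c m ∧ c (-1) - Ptilde g c (XX c m) < P.2 ∧
      P.2 < Ptilde g c (XX c m) := by
  have bl := b_lt hc (XX c m)
  unfold alphaOpen
  rw [Gam_eq hg hc, V_eq hc hm]
  obtain ⟨x, y⟩ := P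
  constructor
  · rintro ⟨h, h1, h2, h3⟩
    dsimp only at h1
    subst h1
    have h2' : y ≠ Ptilde g c (XX c m) := fun e => h2 (by rw [e])
    have h3' : y ≠ c (-1) - Ptilde g c (XX c m) := fun e => h3 (by rw [e]; rfl)
    refine ⟨rfl, ?_⟩
    rcases h.2 with e | e | ⟨_, e1, e2⟩
    · exact absurd e h2'
    · exact absurd e h3'
    · exact ⟨lt_of_le_of_ne e1 (Ne.symm h3'), lt_of_le_of_ne e2 h2'⟩
  · rintro ⟨h1, h2, h3⟩
    dsimp only at h1 h2 h3
    subst h1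
    refine ⟨⟨⟨XX_le hc (Nat.zero_le _) hm, XX_le hc hm le_rfl⟩,
      Or.inr (Or.inr ⟨⟨m, hm, rfl⟩, h2.le, h3.le⟩)⟩, rfl, ?_, ?_⟩
    · intro e
      have := congrArg Prod.snd e
      dsimp only at this
      linarith
    · intro e
      have := congrArg Prod.snd e
      simp only [TropicalHyperelliptic.conj] at this
      linarith

theorem Dtilde_iff (hg : 1 ≤ g) (hc : Hyp g c) (A : Div) :
    A ∈ Dtilde g c ↔ ∃ u : ℕ → ℝ,
      (∀ j < g, 0 ≤ u j ∧ u j < Ln (XX c) (Ptilde g c) (c (-1)) j) ∧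
      (∀ j, j + 1 < g → ¬ Bad (XX c) (Ptilde g c) (c (-1)) u j) ∧
      A = ∑ j ∈ Finset.range g,
        Finsupp.single (cpos (XX c) (Ptilde g c) (c (-1)) j (u j)) (1 : ℤ) := by
  have L := lad hg hc
  constructor
  · rintro ⟨Pt, h1, h2, rfl⟩
    have : ∀ j : ℕ, ∃ u : ℝ, ∀ hj : j < g, 0 ≤ u ∧ u < Ln (XX c) (Ptilde g c) (c (-1)) j ∧
        cpos (XX c) (Ptilde g c) (c (-1)) j u = Pt ⟨g - 1 - j, by omega⟩ := by
      intro j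
      by_cases hj : j < g
      · have := h1 ⟨g - 1 - j, by omega⟩
        dsimp only at this
        rw [alphaCycle_eq hg hc hj] at this
        obtain ⟨u, hu⟩ := L.exists_cpos hj this.1 this.2.1 this.2.2
        exact ⟨u, fun _ => hu⟩
      · exact ⟨0, fun h => absurd h hj⟩
    choose u hu using this
    refine ⟨u, fun j hj => ⟨(hu j hj).1, (hu j hj).2.1⟩, ?_, ?_⟩
    · rintro j hj ⟨b1, b2⟩
      have hj' : j < g := by omega
      have r1 := (L.open_left hj (hu _ hj).1 (hu _ hj).2.1).2 b1
      have r2 := (L.open_right hj' (hu _ hj').1).2 b2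
      rw [(hu _ hj).2.2] at r1
      rw [(hu _ hj').2.2] at r2
      have := h2 (g - (j + 1)) (by omega) (by omega) _ _
        ((mem_alphaOpen hg hc (by omega) _).2 r1) ((mem_alphaOpen hg hc (by omega) _).2 r2)
      have := congrArg Fin.val this
      dsimp only at this
      omega
    · rw [← Finset.sum_range_reflect, Finset.sum_range]
      refine Finset.sum_congr rfl fun i _ => ?_
      have hi := i.2
      rw [(hu (g - 1 - i) (by omega)).2.2]
      congr 2
      ext
      dsimp only
      omega
  · rintro ⟨u, hu, hb, rfl⟩
    refine ⟨fun i => cpos (XX c) (Ptilde g c) (c (-1)) (g - 1 - i) (u (g - 1 - i)), ?_, ?_, ?_⟩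
    · intro i
      have hi := i.2
      have hj : g - 1 - (i : ℕ) < g := by omega
      have := alphaCycle_eq hg hc hj
      rw [show g - 1 - (g - 1 - (i : ℕ)) + 1 = i + 1 by omega] at this
      rw [this]
      exact L.cpos_mem hj (hu _ hj).1 (hu _ hj).2.le
    · have key : ∀ m, 1 ≤ m → m < g → ∀ j < g, ∀ j' < g, j < j' →
          cpos (XX c) (Ptilde g c) (c (-1)) j (u j) ∈ alphaOpen g c (g - m) →
          cpos (XX c) (Ptilde g c) (c (-1)) j' (u j') ∈ alphaOpen g c (g - m) → False := by
        intro m m1 mg j hj j' hj' hlt a1 a2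
        rw [mem_alphaOpen hg hc mg.le] at a1 a2
        have t1 := (L.cpos_mem hj (hu _ hj).1 (hu _ hj).2.le).2
        have t2 := (L.cpos_mem hj' (hu _ hj').1 (hu _ hj').2.le).2
        rw [a1.1] at t1
        rw [a2.1] at t2
        have s1 : m ≤ j + 1 := by
          by_contra h
          have := L.slt (show j + 1 < m by omega) mg.le
          linarith
        have s2 : j' ≤ m := by
          by_contra h
          have := L.slt (show m < j' by omega) hj'.le
          linarith
        have e1 : j' = j + 1 := by omega
        have e2 : m = j + 1 := by omega
        subst e1
        subst e2
        exact hb j hj' ⟨(L.open_left hj' (hu _ hj').1 (hu _ hj').2).1 a2,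
          (L.open_right hj (hu _ hj).1).1 a1⟩
      intro k k1 k2 i i' a1 a2
      have hi := i.2
      have hi' := i'.2
      rw [show k = g - (g - k) by omega] at a1 a2
      dsimp only at a1 a2
      by_contra hne
      have hne' : (i : ℕ) ≠ i' := fun e => hne (Fin.ext e)
      rcases lt_or_gt_of_ne hne' with h | h
      · exact key (g - k) (by omega) (by omega) _ (by omega) _ (by omega) (by omega) a2 a1
      · exact key (g - k) (by omega) (by omega) _ (by omega) _ (by omega) (by omega) a1 a2
    · rw [← Finset.sum_range_reflect, Finset.sum_range]

theorem deg_eq (D : Div) : deg D = Finsupp.linearCombination ℤ (fun _ : ℝ × ℝ => (1 : ℤ)) D := by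
  unfold deg
  rw [Finsupp.linearCombination_apply]
  simp

theorem linEquiv_iff (S : Set (ℝ × ℝ)) (D D' : Div) :
    LinEquiv S D D' ↔ IsPrincipal S (D' - D) := by
  unfold LinEquiv IsPrincipal
  refine exists_congr fun f => and_congr Iff.rfl (forall_congr' fun P => ?_)
  rw [Finsupp.sub_apply]
  constructor <;> intro h <;> linarith

theorem final (g : ℕ) (c : ℤ → ℝ) (hg : 1 ≤ g) (hc : Hyp g c)
    (Dstar : Div) (hDstar_deg : deg Dstar = g)
    (hDstar_supp : ↑Dstar.support ⊆ Gam g c) :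
    (∀ D : Div, ↑D.support ⊆ Gam g c → deg D = 0 →
      ∃ A ∈ Dtilde g c, LinEquiv (Gam g c) D (A - Dstar))
    ∧ (∀ A ∈ Dtilde g c, ∀ B ∈ Dtilde g c, LinEquiv (Gam g c) A B → A = B) := by
  have L := lad hg hc
  rw [Gam_eq hg hc] at *
  have gp := L.g1
  refine ⟨?_, ?_⟩
  · intro D hD hdeg
    let E : Div := ∑ j ∈ Finset.range g,
      Finsupp.single (XX c j, c (-1) - Ptilde g c (XX c j)) (1 : ℤ)
    have hE : ∀ P, E P ≠ 0 → P ∈ G g (XX c) (Ptilde g c) (c (-1)) := by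
      intro P hP
      simp only [E, Finsupp.finset_sum_apply] at hP
      obtain ⟨j, hj, hne⟩ := Finset.exists_ne_zero_of_sum_ne_zero hP
      have hj' := Finset.mem_range.1 hj
      have : (XX c j, c (-1) - Ptilde g c (XX c j)) = P := by
        by_contra h
        exact hne (Finsupp.single_eq_of_ne (Ne.symm h))
      rw [← this]
      exact ⟨⟨XX_le hc (Nat.zero_le _) hj'.le, XX_le hc hj'.le le_rfl⟩, Or.inr (Or.inl rfl)⟩
    obtain ⟨z, hz⟩ := L.exists_chain (D := D + Dstar - E) (by
      intro P hP
      by_contra hcon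
      have e1 : D P = 0 := by
        by_contra h; exact hcon (hD (Finset.mem_coe.2 (Finsupp.mem_support_iff.2 h)))
      have e2 : Dstar P = 0 := by
        by_contra h; exact hcon (hDstar_supp (Finset.mem_coe.2 (Finsupp.mem_support_iff.2 h)))
      have e3 : E P = 0 := by
        by_contra h; exact hcon (hE P h)
      apply hP
      rw [Finsupp.sub_apply, Finsupp.add_apply, e1, e2, e3]; rfl) (by
      rw [deg_eq] at *
      rw [map_sub, map_add, hdeg, hDstar_deg]
      simp [E])
    obtain ⟨u, hu, hb, hch⟩ := L.exists_red z
    refine ⟨_, (Dtilde_iff hg hc _).2 ⟨u, hu, hb, rfl⟩, ?_⟩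
    rw [linEquiv_iff]
    apply L.principal_of_chain
    have := hch.sub hz
    rw [sub_self] at this
    convert this using 1
    rw [Finset.sum_sub_distrib]
    simp only [E]
    abel
  · intro A hA B hB h
    obtain ⟨u, hu, bu, rfl⟩ := (Dtilde_iff hg hc _).1 hA
    obtain ⟨v, hv, bv, rfl⟩ := (Dtilde_iff hg hc _).1 hB
    rw [linEquiv_iff] at h
    exact L.unique_red u v hu hv bu bv (L.chain_of_principal h)

end LadderAux
end

/-- **Theorem (Inoue–Takenawa).**  Let `Γ̄` be the tropical hyperelliptic curve of
genus `g` and `Γ` its bounded part, and fix `D* ∈ 𝔇_g^+(Γ)`.  The restriction of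
`φ̄ : 𝔇_g^+(Γ) → J(Γ)`, `φ̄(A) ≡ A − D*` (mod principal divisors), to the subset
`𝔇̃_g^+(Γ)` is a bijection `𝔇̃_g^+(Γ) → J(Γ)`: every degree-`0` divisor `D`
supported on `Γ` satisfies `A − D* ∼ D` for exactly one `A ∈ 𝔇̃_g^+(Γ)`. -/
theorem phiBar_bijOn_Dtilde (g : ℕ) (c : ℤ → ℝ) (hg : 1 ≤ g) (hc : Hyp g c)
    (Dstar : Div) (hDstar_eff : Eff Dstar) (hDstar_deg : deg Dstar = g)
    (hDstar_supp : ↑Dstar.support ⊆ Gam g c) :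
    (∀ D : Div, ↑D.support ⊆ Gam g c → deg D = 0 →
      ∃ A ∈ Dtilde g c, LinEquiv (Gam g c) D (A - Dstar))
    ∧ (∀ A ∈ Dtilde g c, ∀ B ∈ Dtilde g c, LinEquiv (Gam g c) A B → A = B) := by
  exact LadderAux.final g c hg hc Dstar hDstar_deg hDstar_supp
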